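/- arXiv:2007.03707 — 11 statements merged into one kernel-verified Lean document; each statement's English description precedes it below -/
import Mathlib

section
/- Let n and k be positive integers with 2*k ≤ n, and let V be a ℂ-linear subspace of the k-th graded component Λ^k ℂ^n of the exterior algebra Λ ℂ^n such that x ∧ y = 0 for all x, y ∈ V. Then dim_ℂ V ≤ binomial(n-1, k-1). -/
open Module Finset

section LeadingTerms

variable {K W ι : Type*} [Field K] [AddCommGroup W] [Module K W]

/-- The indices of the terms of maximal weight, with respect to the basis `b` and the weight `w`,
of the elements of the subspace `V`. -/
def leadingIndices (b : Basis ι K W) (w : ι → ℕ) (V : Submodule K W) : Set ι :=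
  {i | ∃ x ∈ V, b.repr x i ≠ 0 ∧ ∀ j, b.repr x j ≠ 0 → w j ≤ w i}

lemma finrank_le_ncard_leadingIndices [Finite ι] (b : Basis ι K W) (w : ι → ℕ)
    (V : Submodule K W) : finrank K V ≤ (leadingIndices b w V).ncard := by
  have : Fintype (leadingIndices b w V) := Fintype.ofFinite _
  let f : V →ₗ[K] (leadingIndices b w V → K) :=
    LinearMap.pi fun i => (b.coord i).comp V.subtype
  have hf : Function.Injective f := by
    rw [injective_iff_map_eq_zero]
    intro x hx
    by_contra hne
    have hsupp : (b.repr (x : W)).support.Nonempty := by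
      simpa [Finsupp.support_nonempty_iff] using hne
    obtain ⟨i, hi, hmax⟩ := exists_max_image _ w hsupp
    rw [Finsupp.mem_support_iff] at hi
    have hL : i ∈ leadingIndices b w V :=
      ⟨x, x.2, hi, fun j hj => hmax j (Finsupp.mem_support_iff.mpr hj)⟩
    exact hi (congrFun hx ⟨i, hL⟩)
  have := LinearMap.finrank_le_finrank_of_injective hf
  rwa [finrank_fintype_fun_eq_card, Fintype.card_eq_nat_card, Nat.card_coe_set_eq] at this

end LeadingTerms

namespace ExteriorAlgebra

variable {K M I : Type*} [Field K] [AddCommGroup M] [Module K M] [LinearOrder I]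

lemma basis_mul_eq_zero (b : Basis I K M) {s t : Finset I} (h : ¬Disjoint s t) :
    b.ExteriorAlgebra s * b.ExteriorAlgebra t = 0 :=
  basis_mul_of_not_disjoint b (Set.powersetCard.ofCard (s := s) rfl)
    (Set.powersetCard.ofCard (s := t) rfl) h

lemma exists_basis_mul_eq_smul_union (b : Basis I K M) {s t : Finset I} (h : Disjoint s t) :
    ∃ c : K, c ≠ 0 ∧
      b.ExteriorAlgebra s * b.ExteriorAlgebra t = c • b.ExteriorAlgebra (s ∪ t) := by
  have hmul := basis_mul_of_disjoint b (Set.powersetCard.ofCard (s := s) rfl)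
    (Set.powersetCard.ofCard (s := t) rfl) h
  have hunion : (Set.powersetCard.disjUnion (s := Set.powersetCard.ofCard (s := s) rfl)
      (t := Set.powersetCard.ofCard (s := t) rfl) h : Finset I) = s ∪ t :=
    disjUnion_eq_union _ _ h
  rw [hunion] at hmul
  refine ⟨((Equiv.Perm.sign (Set.powersetCard.permOfDisjoint
    (s := Set.powersetCard.ofCard (s := s) rfl)
    (t := Set.powersetCard.ofCard (s := t) rfl) h) : ℤ) : K), ?_, ?_⟩
  · rcases Int.units_eq_one_or (Equiv.Perm.sign (Set.powersetCard.permOfDisjoint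
      (s := Set.powersetCard.ofCard (s := s) rfl)
      (t := Set.powersetCard.ofCard (s := t) rfl) h)) with h1 | h1 <;> simp [h1]
  · rw [Int.cast_smul_eq_zsmul]
    exact hmul

lemma basis_repr_eq_zero_of_mem_exteriorPower (b : Basis I K M) {k : ℕ}
    {x : ExteriorAlgebra K M} (hx : x ∈ ⋀[K]^k M) {s : Finset I} (hs : s.card ≠ k) :
    b.ExteriorAlgebra.repr x s = 0 := by
  have hzero : (b.ExteriorAlgebra.coord s).comp (⋀[K]^k M).subtype = 0 := by
    refine (b.exteriorPower k).ext fun t => ?_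
    have hts : (t : Finset I) ≠ s := by
      rintro rfl
      exact hs t.2
    simp only [LinearMap.comp_apply, Submodule.subtype_apply, ← basis_eq_coe_basis,
      Basis.coord_apply, Basis.repr_self, LinearMap.zero_apply]
    exact Finsupp.single_eq_of_ne hts.symm
  exact LinearMap.congr_fun hzero ⟨x, hx⟩

/-- The coefficient of a product at the union of the two disjoint leading monomials does not
vanish. -/
lemma mul_ne_zero_of_disjoint_leading [Fintype I] (b : Basis I K M) {w : Finset I → ℕ}
    (hinj : Function.Injective w) (hadd : ∀ s t, Disjoint s t → w (s ∪ t) = w s + w t)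
    {x y : ExteriorAlgebra K M} {s t : Finset I} (hst : Disjoint s t)
    (hs : b.ExteriorAlgebra.repr x s ≠ 0)
    (hxs : ∀ u, b.ExteriorAlgebra.repr x u ≠ 0 → w u ≤ w s)
    (ht : b.ExteriorAlgebra.repr y t ≠ 0)
    (hyt : ∀ u, b.ExteriorAlgebra.repr y u ≠ 0 → w u ≤ w t) :
    x * y ≠ 0 := by
  set B := b.ExteriorAlgebra
  have hterm : ∀ u v, (u, v) ≠ (s, t) →
      B.repr x u * (B.repr y v * B.repr (B u * B v) (s ∪ t)) = 0 := by
    intro u v huv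
    by_cases hu : B.repr x u = 0
    · simp [hu]
    by_cases hv : B.repr y v = 0
    · simp [hv]
    by_cases hd : Disjoint u v
    · obtain ⟨c, -, hc⟩ := exists_basis_mul_eq_smul_union b hd
      have hne : s ∪ t ≠ u ∪ v := by
        intro h
        have hw := congrArg w h
        rw [hadd _ _ hst, hadd _ _ hd] at hw
        have hus := hxs u hu
        have hvt := hyt v hv
        have hu_eq : u = s := hinj (by omega)
        have hv_eq : v = t := hinj (by omega)
        exact huv (by rw [hu_eq, hv_eq])
      rw [hc, map_smul, Basis.repr_self, Finsupp.smul_apply, Finsupp.single_eq_of_ne hne]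
      simp
    · rw [basis_mul_eq_zero b hd]
      simp
  have hcoeff : B.repr (x * y) (s ∪ t) =
      ∑ p : Finset I × Finset I,
        B.repr x p.1 * (B.repr y p.2 * B.repr (B p.1 * B p.2) (s ∪ t)) := by
    conv_lhs => rw [← B.sum_repr x, ← B.sum_repr y, sum_mul_sum]
    simp [Fintype.sum_prod_type, Finsupp.finsetSum_apply, mul_left_comm]
  obtain ⟨c, hc0, hc⟩ := exists_basis_mul_eq_smul_union b hst
  rw [Fintype.sum_eq_single (s, t) fun p hp => hterm p.1 p.2 hp, hc, map_smul,
    Basis.repr_self, Finsupp.smul_apply, Finsupp.single_eq_same] at hcoeff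
  intro hxy
  rw [hxy] at hcoeff
  simp [hs, ht, hc0] at hcoeff

end ExteriorAlgebra

lemma Fin.sum_two_pow_injective (n : ℕ) :
    Function.Injective fun s : Finset (Fin n) => ∑ i ∈ s, 2 ^ (i : ℕ) := by
  intro s t h
  refine map_injective Fin.valEmbedding (geomSum_injective le_rfl ?_)
  simpa using h

theorem stmt_0 (n k : ℕ) (hn : 0 < n) (hk : 0 < k) (hkn : 2 * k ≤ n)
    (V : Submodule ℂ (ExteriorAlgebra ℂ (Fin n → ℂ)))
    (hV : V ≤ ⋀[ℂ]^k (Fin n → ℂ))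
    (hmul : ∀ x ∈ V, ∀ y ∈ V, x * y = 0) :
    Module.finrank ℂ V ≤ (n - 1).choose (k - 1) := by
  classical
  let b := Pi.basisFun ℂ (Fin n)
  let w : Finset (Fin n) → ℕ := fun s => ∑ i ∈ s, 2 ^ (i : ℕ)
  refine (finrank_le_ncard_leadingIndices b.ExteriorAlgebra w V).trans ?_
  rw [Set.ncard_eq_toFinset_card']
  refine erdos_ko_rado (r := k) ?_ ?_ (by omega)
  · rw [Set.coe_toFinset]
    rintro s ⟨x, hx, hs, hxs⟩ t ⟨y, hy, ht, hyt⟩ hst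
    exact ExteriorAlgebra.mul_ne_zero_of_disjoint_leading b (Fin.sum_two_pow_injective n)
      (fun _ _ h => sum_union h) hst hs hxs ht hyt (hmul x hx y hy)
  · rw [Set.coe_toFinset]
    rintro s ⟨x, hx, hs, -⟩
    by_contra hcard
    exact hs (ExteriorAlgebra.basis_repr_eq_zero_of_mem_exteriorPower b (hV hx) hcard)
end

section
/- Let n and k be positive integers with 2*k ≤ n. If 𝒜 is an intersecting family of k-element subsets of {1,...,n}, then |𝒜| ≤ binomial(n-1, k-1). -/
theorem stmt_1 (n k : ℕ) (hn : 0 < n) (hk : 0 < k) (hkn : 2 * k ≤ n)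
    (𝒜 : Finset (Finset ℕ))
    (hground : ∀ A ∈ 𝒜, A ⊆ Finset.Icc 1 n)
    (hcard : ∀ A ∈ 𝒜, A.card = k)
    (hint : ∀ A ∈ 𝒜, ∀ B ∈ 𝒜, (A ∩ B).Nonempty) :
    𝒜.card ≤ (n - 1).choose (k - 1) := by
  let pull (A : Finset ℕ) : Finset (Fin n) := {i | i.val + 1 ∈ A}
  have mem_pull (A : Finset ℕ) (i : Fin n) : i ∈ pull A ↔ i.val + 1 ∈ A := by simp [pull]
  have exists_index {A : Finset ℕ} (hA : A ∈ 𝒜) {x : ℕ} (hx : x ∈ A) :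
      ∃ i : Fin n, i.val + 1 = x := by
    have h := Finset.mem_Icc.mp (hground A hA hx)
    exact ⟨⟨x - 1, by omega⟩, Nat.sub_add_cancel h.1⟩
  have image_pull {A : Finset ℕ} (hA : A ∈ 𝒜) :
      (pull A).image (fun i => i.val + 1) = A := by
    ext x
    simp only [Finset.mem_image, mem_pull]
    constructor
    · rintro ⟨i, hi, rfl⟩
      exact hi
    · intro hx
      obtain ⟨i, rfl⟩ := exists_index hA hx
      exact ⟨i, hx, rfl⟩
  have succ_injective : Function.Injective (fun i : Fin n => i.val + 1) :=
    (Nat.succ_injective).comp Fin.val_injective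
  have pull_injOn : Set.InjOn pull 𝒜 := fun A hA B hB h => by
    rw [← image_pull hA, ← image_pull hB, h]
  rw [← Finset.card_image_of_injOn pull_injOn]
  refine Finset.erdos_ko_rado ?_ ?_ (by omega)
  · intro S hS T hT hdisj
    obtain ⟨A, hA, rfl⟩ := Finset.mem_image.mp hS
    obtain ⟨B, hB, rfl⟩ := Finset.mem_image.mp hT
    obtain ⟨x, hx⟩ := hint A hA B hB
    rw [Finset.mem_inter] at hx
    obtain ⟨i, rfl⟩ := exists_index hA hx.1
    exact Finset.disjoint_left.mp hdisj ((mem_pull A i).mpr hx.1) ((mem_pull B i).mpr hx.2)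
  · intro S hS
    obtain ⟨A, hA, rfl⟩ := Finset.mem_image.mp hS
    rw [← hcard A hA, ← Finset.card_image_of_injective _ succ_injective, image_pull hA]
end

section
/- Let n and k be positive integers with 2*k < n. If 𝒜 is an intersecting family of k-element subsets of {1,...,n} with |𝒜| = binomial(n-1, k-1), then all sets in 𝒜 share a common element, i.e. there exists x ∈ {1,...,n} with x ∈ A for every A ∈ 𝒜. -/
open Finset

namespace ErdosKoRado

/-- A function on `r`-subsets of `X` that is invariant under exchanging one element is constant. -/
lemma eq_of_exchange {α β : Type*} [DecidableEq α] {X : Finset α} {r : ℕ} {h : Finset α → β}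
    (H : ∀ C ⊆ X, C.card + 1 = r → ∀ a ∈ X, ∀ b ∈ X, a ∉ C → b ∉ C → a ≠ b →
      h (insert a C) = h (insert b C))
    {A B : Finset α} (hA : A ⊆ X) (hB : B ⊆ X) (hAr : A.card = r) (hBr : B.card = r) :
    h A = h B := by
  induction hm : (A \ B).card generalizing A with
  | zero =>
    rw [card_eq_zero, sdiff_eq_empty_iff_subset] at hm
    rw [eq_of_subset_of_card_le hm (by omega)]
  | succ m ih =>
    have hBA : (B \ A).card = m + 1 := by
      have h₁ := card_sdiff_add_card_inter A B
      have h₂ := card_sdiff_add_card_inter B A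
      rw [inter_comm] at h₂
      omega
    obtain ⟨a, ha⟩ := card_pos.1 (by omega : 0 < (A \ B).card)
    obtain ⟨b, hb⟩ := card_pos.1 (by omega : 0 < (B \ A).card)
    rw [mem_sdiff] at ha hb
    have hab : a ≠ b := by rintro rfl; exact ha.2 hb.1
    have hcard : (A.erase a).card + 1 = r := by rw [card_erase_add_one ha.1, hAr]
    have hbA : b ∉ A.erase a := fun h ↦ hb.2 (mem_of_mem_erase h)
    have hsub : A.erase a ⊆ X := (erase_subset _ _).trans hA
    have step := H _ hsub hcard a (hA ha.1) b (hB hb.1) (notMem_erase _ _) hbA hab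
    rw [insert_erase ha.1] at step
    rw [step]
    refine ih (insert_subset (hB hb.1) hsub) (by rw [card_insert_of_notMem hbA, hcard]) ?_
    rw [insert_sdiff_of_mem _ hb.1, erase_sdiff_comm, card_erase_of_mem (mem_sdiff.2 ha), hm, Nat.add_sub_cancel]

/-- Two colourings with the same colour class sizes differ by a permutation. It is enough to
compare all colours but one. -/
lemma exists_perm_comp_eq {α γ : Type*} [Fintype α] [DecidableEq α] [Fintype γ] [DecidableEq γ]
    (f g : α → Option γ)
    (h : ∀ c : γ, #{a | f a = some c} = #{a | g a = some c}) :
    ∃ σ : Equiv.Perm α, ∀ a, g (σ a) = f a := by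
  have key : ∀ c, #{a | f a = c} = #{a | g a = c} := by
    rintro (_ | c)
    · have hf := card_eq_sum_card_fiberwise (f := f) (s := univ) (t := univ) (by simp)
      have hg := card_eq_sum_card_fiberwise (f := g) (s := univ) (t := univ) (by simp)
      rw [Fintype.sum_option] at hf hg
      simp only [h] at hf
      omega
    · exact h c
  have e : ∀ c, Nonempty ({a // f a = c} ≃ {a // g a = c}) := fun c ↦
    Fintype.card_eq.1 (by simpa only [Fintype.card_subtype] using key c)
  exact ⟨Equiv.ofFiberEquiv fun c ↦ (e c).some, Equiv.ofFiberEquiv_map _⟩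

lemma exists_perm_image_eq {α : Type*} [Fintype α] [DecidableEq α] {S T : Finset α}
    (h : S.card = T.card) : ∃ σ : Equiv.Perm α, S.image σ = T := by
  obtain ⟨σ, hσ⟩ := exists_perm_comp_eq (fun a ↦ if a ∈ S then some () else none)
    (fun a ↦ if a ∈ T then some () else none) (by simpa using h)
  have hmem : ∀ a, σ a ∈ T ↔ a ∈ S := fun a ↦ by have := hσ a; grind
  refine ⟨σ, ?_⟩
  ext b
  obtain ⟨a, rfl⟩ := σ.surjective b
  simp [hmem]

/-- Permutations can be prescribed on two disjoint sets and two further points. -/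
lemma exists_perm_image_pair {α : Type*} [Fintype α] [DecidableEq α] {P Q C D : Finset α}
    {p q x y : α} (hPC : P.card = C.card) (hQD : Q.card = D.card)
    (hPQ : Disjoint P Q) (hCD : Disjoint C D) (hpq : p ≠ q) (hxy : x ≠ y)
    (hpP : p ∉ P) (hqP : q ∉ P) (hpQ : p ∉ Q) (hqQ : q ∉ Q)
    (hxC : x ∉ C) (hyC : y ∉ C) (hxD : x ∉ D) (hyD : y ∉ D) :
    ∃ σ : Equiv.Perm α, P.image σ = C ∧ Q.image σ = D ∧ σ p = x ∧ σ q = y := by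
  let col (P Q : Finset α) (p q a : α) : Option (Fin 4) :=
    if a ∈ P then some 0 else if a ∈ Q then some 1 else if a = p then some 2
    else if a = q then some 3 else none
  have fib : ∀ {P Q : Finset α} {p q : α}, Disjoint P Q → p ≠ q → p ∉ P → q ∉ P → p ∉ Q → q ∉ Q →
      (∀ a, col P Q p q a = some 0 ↔ a ∈ P) ∧ (∀ a, col P Q p q a = some 1 ↔ a ∈ Q) ∧
      (∀ a, col P Q p q a = some 2 ↔ a = p) ∧ (∀ a, col P Q p q a = some 3 ↔ a = q) := by
    intro P Q p q hd h₁ h₂ h₃ h₄ h₅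
    rw [disjoint_left] at hd
    refine ⟨fun a ↦ ?_, fun a ↦ ?_, fun a ↦ ?_, fun a ↦ ?_⟩ <;> simp only [col] <;>
      split_ifs <;> simp <;> grind
  obtain ⟨f0, f1, f2, f3⟩ := fib hPQ hpq hpP hqP hpQ hqQ
  obtain ⟨g0, g1, g2, g3⟩ := fib hCD hxy hxC hyC hxD hyD
  obtain ⟨σ, hσ⟩ := exists_perm_comp_eq (col P Q p q) (col C D x y) (by
    intro c
    match c with
    | 0 => simpa [f0, g0] using hPC
    | 1 => simpa [f1, g1] using hQD
    | 2 => simp [f2, g2, filter_eq']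
    | 3 => simp [f3, g3, filter_eq'])
  refine ⟨σ, ?_, ?_, (g2 _).1 (by rw [hσ, f2]), (g3 _).1 (by rw [hσ, f3])⟩
  · ext b
    obtain ⟨a, rfl⟩ := σ.surjective b
    simp [← f0, ← g0, hσ]
  · ext b
    obtain ⟨a, rfl⟩ := σ.surjective b
    simp [← f1, ← g1, hσ]

/-- Averaging over all permutations: a fixed set `S` of the same size as the members of `𝒜` is
moved into `𝒜` with frequency `#𝒜 / (card α).choose #S`. -/
lemma choose_mul_card_perm_image_mem {α : Type*} [Fintype α] [DecidableEq α]
    {𝒜 : Finset (Finset α)} {S : Finset α} (h𝒜 : ∀ A ∈ 𝒜, A.card = S.card) :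
    (Fintype.card α).choose S.card * #{σ : Equiv.Perm α | S.image σ ∈ 𝒜} =
      𝒜.card * Fintype.card (Equiv.Perm α) := by
  have const : ∀ A : Finset α, A.card = S.card →
      #{σ : Equiv.Perm α | S.image σ = A} = #{σ : Equiv.Perm α | S.image σ = S} := by
    intro A hA
    obtain ⟨τ, hτ⟩ := exists_perm_image_eq hA
    refine card_equiv (Equiv.mulLeft τ) fun σ ↦ ?_
    simp only [mem_filter_univ, Equiv.coe_mulLeft, Equiv.Perm.coe_mul, ← image_image]
    conv_rhs => rhs; rw [← hτ]
    exact (image_injective τ.injective).eq_iff.symm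
  have count : ∀ ℬ : Finset (Finset α), (∀ A ∈ ℬ, A.card = S.card) →
      #{σ : Equiv.Perm α | S.image σ ∈ ℬ} =
        ℬ.card * #{σ : Equiv.Perm α | S.image σ = S} := by
    intro ℬ hℬ
    rw [card_eq_sum_card_fiberwise (f := fun σ : Equiv.Perm α ↦ S.image σ) (t := ℬ)
      (by intro σ hσ; simpa using hσ), ← smul_eq_mul, ← sum_const]
    refine sum_congr rfl fun A hA ↦ ?_
    rw [← const A (hℬ A hA), filter_filter]
    congr 1
    ext σ
    simp only [mem_filter_univ, and_iff_right_iff_imp]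
    rintro rfl
    exact hA
  have total := count (powersetCard S.card univ) (by simp)
  have hall : ∀ σ : Equiv.Perm α, S.image σ ∈ powersetCard S.card univ := fun σ ↦
    mem_powersetCard.2 ⟨subset_univ _, card_image_of_injective _ σ.injective⟩
  simp only [hall, filter_true, card_powersetCard, card_univ] at total
  rw [count 𝒜 h𝒜, total]
  ring

section Arc

variable {n : ℕ} [NeZero n]

lemma val_add_cases (a b : ZMod n) :
    (a + b).val = a.val + b.val ∨ (a + b).val + n = a.val + b.val := by
  rcases lt_or_ge (a.val + b.val) n with h | h
  · exact .inl (ZMod.val_add_of_lt h)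
  · exact .inr (by rw [ZMod.val_add_of_le h]; omega)

lemma card_filter_val {a b : ℕ} (hb : b ≤ n) :
    #{j : ZMod n | a ≤ j.val ∧ j.val < b} = b - a := by
  rw [← Nat.card_Ico, ← card_image_of_injective _ (ZMod.val_injective n)]
  congr 1
  ext m
  simp only [mem_image, mem_filter_univ, mem_Ico]
  refine ⟨by rintro ⟨j, hj, rfl⟩; exact hj, fun hm ↦ ⟨m, ?_, ?_⟩⟩ <;>
    rw [ZMod.val_cast_of_lt (by omega)]
  exact hm

/-- The arc of length `k` starting at `i` on the `n`-cycle. -/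
def arc (k : ℕ) (i : ZMod n) : Finset (ZMod n) := {j | (j - i).val < k}

lemma mem_arc {k : ℕ} {i j : ZMod n} : j ∈ arc k i ↔ (j - i).val < k := by simp [arc]

lemma card_arc {k : ℕ} (hk : k ≤ n) (i : ZMod n) : (arc k i).card = k := by
  have := card_filter_val (a := 0) hk
  simp only [zero_le, true_and, Nat.sub_zero] at this
  refine Eq.trans ?_ this
  exact card_equiv (Equiv.subRight i) fun j ↦ by simp [mem_arc]

lemma val_sub_of_mem_arc {k : ℕ} {i i' j : ZMod n} (h : j ∈ arc k i) (h' : j ∈ arc k i') :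
    (i - i').val < k ∨ n < (i - i').val + k := by
  rw [mem_arc] at h h'
  have := val_add_cases (i - i') (j - i)
  rw [sub_add_sub_cancel'] at this
  omega

/-- Katona's lemma: at most `k` arcs of length `k` on an `n`-cycle pairwise meet. -/
lemma card_le_of_arcs_meet {k : ℕ} (hkn : 2 * k ≤ n) {T : Finset (ZMod n)}
    (hT : ∀ i ∈ T, ∀ i' ∈ T, (arc k i ∩ arc k i').Nonempty) : T.card ≤ k := by
  have hval : ∀ i ∈ T, ∀ i' ∈ T, (i - i').val < k ∨ n < (i - i').val + k := by
    intro i hi i' hi'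
    obtain ⟨j, hj⟩ := hT i hi i' hi'
    rw [mem_inter] at hj
    exact val_sub_of_mem_arc hj.1 hj.2
  obtain rfl | ⟨i₀, h₀⟩ := T.eq_empty_or_nonempty
  · simp
  rw [← card_range k]
  refine card_le_card_of_injOn
    (fun i ↦ if (i - i₀).val < k then (i - i₀).val else (i - i₀).val - (n - k)) ?_ ?_
  · intro i hi
    have := hval i hi i₀ h₀
    have := ZMod.val_lt (i - i₀)
    simp only [coe_range, Set.mem_Iio]
    split_ifs <;> omega
  · intro i hi i' hi' heq
    have h₁ := hval i hi i₀ h₀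
    have h₂ := hval i' hi' i₀ h₀
    have h₃ := hval i hi i' hi'
    have h₄ := hval i' hi' i hi
    have l₁ := ZMod.val_lt (i - i₀)
    have l₂ := ZMod.val_lt (i' - i₀)
    have a₁ := val_add_cases (i - i') (i' - i₀)
    have a₂ := val_add_cases (i' - i) (i - i₀)
    rw [sub_add_sub_cancel] at a₁ a₂
    have l₃ := ZMod.val_lt (i - i')
    have l₄ := ZMod.val_lt (i' - i)
    suffices (i - i₀).val = (i' - i₀).val from sub_left_injective (ZMod.val_injective n this)
    dsimp only at heq
    split_ifs at heq <;> omega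

/-- In the equality case, every cyclic ordering has exactly `k` arcs in the family. -/
lemma card_arcs_eq {k : ℕ} (hk : 0 < k) (hkn : 2 * k ≤ n) {𝒜 : Finset (Finset (ZMod n))}
    (hcard : ∀ A ∈ 𝒜, A.card = k) (hint : ∀ A ∈ 𝒜, ∀ B ∈ 𝒜, (A ∩ B).Nonempty)
    (hsize : 𝒜.card = (n - 1).choose (k - 1)) (σ : Equiv.Perm (ZMod n)) :
    #{i | (arc k i).image σ ∈ 𝒜} = k := by
  have hle : ∀ σ : Equiv.Perm (ZMod n), #{i | (arc k i).image σ ∈ 𝒜} ≤ k := by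
    intro σ
    refine card_le_of_arcs_meet hkn fun i hi i' hi' ↦ ?_
    rw [mem_filter_univ] at hi hi'
    have := hint _ hi _ hi'
    rwa [← image_inter _ _ σ.injective, image_nonempty] at this
  have hpos : 0 < n.choose k := Nat.choose_pos (by omega)
  have hsum : ∑ σ : Equiv.Perm (ZMod n), #{i | (arc k i).image σ ∈ 𝒜} =
      ∑ σ : Equiv.Perm (ZMod n), k := by
    have swap : ∑ σ : Equiv.Perm (ZMod n), #{i | (arc k i).image σ ∈ 𝒜} =
        ∑ i : ZMod n, #{σ : Equiv.Perm (ZMod n) | (arc k i).image σ ∈ 𝒜} := by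
      simp only [card_filter]
      exact sum_comm
    refine Nat.eq_of_mul_eq_mul_left hpos ?_
    rw [swap, mul_sum]
    have each : ∀ i : ZMod n,
        n.choose k * #{σ : Equiv.Perm (ZMod n) | (arc k i).image σ ∈ 𝒜} =
          𝒜.card * Fintype.card (Equiv.Perm (ZMod n)) := by
      intro i
      have hi := card_arc (n := n) (k := k) (by omega) i
      have := choose_mul_card_perm_image_mem (𝒜 := 𝒜) (S := arc k i) (by rwa [hi])
      rwa [hi, ZMod.card] at this
    have hchoose : n * (n - 1).choose (k - 1) = n.choose k * k := by
      have := Nat.add_one_mul_choose_eq (n - 1) (k - 1)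
      rwa [Nat.sub_add_cancel (by omega), Nat.sub_add_cancel hk] at this
    rw [sum_congr rfl fun i _ ↦ each i, sum_const, sum_const, card_univ, card_univ, ZMod.card,
      hsize, smul_eq_mul, smul_eq_mul, ← mul_assoc, hchoose]
    ring
  exact (sum_eq_sum_iff_of_le fun σ _ ↦ hle σ).1 hsum σ (mem_univ _)

/-- If the number of arcs in `𝒜` is the same for all cyclic orderings, then replacing `x` by `y`
has the same effect on membership in `𝒜` for any two disjoint `(k - 1)`-sets. -/
lemma exchange_identity {k : ℕ} (hk : 0 < k) (hkn : 2 * k ≤ n) {𝒜 : Finset (Finset (ZMod n))}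
    {m : ℕ} (harc : ∀ σ : Equiv.Perm (ZMod n), #{i | (arc k i).image σ ∈ 𝒜} = m)
    {C D : Finset (ZMod n)} {x y : ZMod n} (hC : C.card + 1 = k) (hD : D.card + 1 = k)
    (hCD : Disjoint C D) (hxy : x ≠ y) (hxC : x ∉ C) (hyC : y ∉ C) (hxD : x ∉ D) (hyD : y ∉ D) :
    (if insert x C ∈ 𝒜 then 1 else 0) + (if insert y D ∈ 𝒜 then 1 else 0) =
      (if insert y C ∈ 𝒜 then 1 else 0) + (if insert x D ∈ 𝒜 then 1 else 0) := by
  set p : ZMod n := ((k - 1 : ℕ) : ZMod n) with hp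
  set q : ZMod n := (k : ZMod n) with hq
  have vp : p.val = k - 1 := ZMod.val_cast_of_lt (by omega)
  have vq : q.val = k := ZMod.val_cast_of_lt (by omega)
  let P : Finset (ZMod n) := {j | 0 ≤ j.val ∧ j.val < k - 1}
  let Q : Finset (ZMod n) := {j | k + 1 ≤ j.val ∧ j.val < 2 * k}
  have mP : ∀ j, j ∈ P ↔ 0 ≤ j.val ∧ j.val < k - 1 := fun j ↦ by simp [P]
  have mQ : ∀ j, j ∈ Q ↔ k + 1 ≤ j.val ∧ j.val < 2 * k := fun j ↦ by simp [Q]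
  have hpq : p ≠ q := fun h ↦ by rw [h] at vp; omega
  have eqp : ∀ j : ZMod n, j.val = k - 1 → j = p := fun j h ↦
    ZMod.val_injective n (h.trans vp.symm)
  have eqq : ∀ j : ZMod n, j.val = k → j = q := fun j h ↦
    ZMod.val_injective n (h.trans vq.symm)
  have hpP : p ∉ P := by rw [mP]; omega
  have hqP : q ∉ P := by rw [mP]; omega
  have hpQ : p ∉ Q := by rw [mQ]; omega
  have hqQ : q ∉ Q := by rw [mQ]; omega
  obtain ⟨σ, σP, σQ, σp, σq⟩ := exists_perm_image_pair (P := P) (Q := Q) (C := C) (D := D)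
    (p := p) (q := q) (x := x) (y := y)
    (by rw [card_filter_val (by omega)]; omega) (by rw [card_filter_val (by omega)]; omega)
    (disjoint_left.2 fun j h h' ↦ by rw [mP] at h; rw [mQ] at h'; omega)
    hCD hpq hxy hpP hqP hpQ hqQ hxC hyC hxD hyD
  have arc0 : arc k 0 = insert p P := by
    ext j
    rw [mem_arc, sub_zero, mem_insert, mP]
    refine ⟨fun h ↦ ?_, ?_⟩
    · by_cases hj : j.val = k - 1
      · exact .inl (eqp j hj)
      · right; omega
    · rintro (rfl | h) <;> omega
  have arcq : arc k q = insert q Q := by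
    ext j
    rw [mem_arc, mem_insert, mQ]
    have hv := val_add_cases (j - q) q
    rw [sub_add_cancel] at hv
    have := ZMod.val_lt j
    have := ZMod.val_lt (j - q)
    refine ⟨fun h ↦ ?_, ?_⟩
    · by_cases hj : j.val = k
      · exact .inl (eqq j hj)
      · right; omega
    · rintro (rfl | h)
      · simpa using hk
      · omega
  have hq0 : q ≠ 0 := fun h ↦ by rw [h, ZMod.val_zero] at vq; omega
  have swapP : P.image (Equiv.swap p q) = P := by
    conv_rhs => rw [← image_id (s := P)]
    exact image_congr fun j hj ↦ Equiv.swap_apply_of_ne_of_ne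
      (ne_of_mem_of_not_mem hj hpP) (ne_of_mem_of_not_mem hj hqP)
  have swapQ : Q.image (Equiv.swap p q) = Q := by
    conv_rhs => rw [← image_id (s := Q)]
    exact image_congr fun j hj ↦ Equiv.swap_apply_of_ne_of_ne
      (ne_of_mem_of_not_mem hj hpQ) (ne_of_mem_of_not_mem hj hqQ)
  have other : ∀ i, i ≠ 0 → i ≠ q → (arc k i).image (Equiv.swap p q) = arc k i := by
    intro i hi0 hiq
    have h1 : p + 1 = q := by rw [hp, hq, ← Nat.cast_add_one, Nat.sub_add_cancel hk]
    have hmem : p ∈ arc k i ↔ q ∈ arc k i := by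
      rw [mem_arc, mem_arc]
      have a₁ := val_add_cases (p - i) i
      have a₂ := val_add_cases (q - i) i
      rw [sub_add_cancel] at a₁ a₂
      have l₁ := ZMod.val_lt (p - i)
      have l₂ := ZMod.val_lt (q - i)
      have l₃ := ZMod.val_lt i
      have n0 : i.val ≠ 0 := fun h ↦ hi0 ((ZMod.val_eq_zero i).1 h)
      have nq : i.val ≠ k := fun h ↦ hiq (eqq i h)
      omega
    ext j
    obtain ⟨j, rfl⟩ := (Equiv.swap p q).surjective j
    rw [(Equiv.swap p q).injective.mem_finset_image, Equiv.swap_apply_def]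
    split_ifs with h h'
    · rw [h, hmem]
    · rw [h', hmem]
    · rfl
  have e₁ := harc σ
  have e₂ := harc (σ * Equiv.swap p q)
  have h0 : (0 : ZMod n) ∈ univ.erase q := mem_erase.2 ⟨hq0.symm, mem_univ _⟩
  rw [card_filter, ← add_sum_erase _ _ (mem_univ q), ← add_sum_erase _ _ h0] at e₁ e₂
  simp only [Equiv.Perm.coe_mul, ← image_image] at e₂
  rw [sum_congr rfl (g := fun i ↦ if (arc k i).image σ ∈ 𝒜 then 1 else 0) fun i hi ↦ by
    simp only [mem_erase] at hi
    rw [other i hi.1 hi.2.1]] at e₂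
  simp only [arc0, arcq, image_insert, swapP, swapQ, Equiv.swap_apply_left,
    Equiv.swap_apply_right, σP, σQ, σp, σq] at e₁ e₂
  omega

end Arc

lemma exists_subset_compl_card {α : Type*} [Fintype α] [DecidableEq α] {E : Finset α} {r : ℕ}
    (h : E.card + r ≤ Fintype.card α) : ∃ D : Finset α, Disjoint D E ∧ D.card = r := by
  obtain ⟨D, hD, hDr⟩ := exists_subset_card_eq (s := Eᶜ) (n := r) (by rw [card_compl]; omega)
  exact ⟨D, disjoint_left.2 fun a ha ↦ mem_compl.1 (hD ha), hDr⟩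

/-- The equality case of the Erdős–Ko–Rado theorem on `ZMod n`. -/
theorem exists_forall_mem {n k : ℕ} [NeZero n] (hk : 0 < k) (hkn : 2 * k < n)
    {𝒜 : Finset (Finset (ZMod n))} (hcard : ∀ A ∈ 𝒜, A.card = k)
    (hint : ∀ A ∈ 𝒜, ∀ B ∈ 𝒜, (A ∩ B).Nonempty)
    (hsize : 𝒜.card = (n - 1).choose (k - 1)) : ∃ x, ∀ A ∈ 𝒜, x ∈ A := by
  have ident := @exchange_identity n _ k hk hkn.le 𝒜 k
    (card_arcs_eq hk hkn.le hcard hint hsize)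
  obtain ⟨A, hA⟩ : 𝒜.Nonempty := by
    rw [← card_pos, hsize]
    exact Nat.choose_pos (by omega)
  obtain ⟨B, hBA, hBk⟩ := exists_subset_compl_card (E := A) (r := k)
    (by rw [hcard A hA, ZMod.card]; omega)
  have hB : B ∉ 𝒜 := fun hB ↦ by
    have := hint B hB A hA
    rw [disjoint_iff_inter_eq_empty.1 hBA] at this
    exact not_nonempty_empty this
  obtain ⟨C, x, y, hC, hxC, hyC, hxy, hx, hy⟩ : ∃ (C : Finset (ZMod n)) (x y : ZMod n),
      C.card + 1 = k ∧ x ∉ C ∧ y ∉ C ∧ x ≠ y ∧ insert x C ∈ 𝒜 ∧ insert y C ∉ 𝒜 := by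
    by_contra! hcon
    have := eq_of_exchange (X := univ) (r := k) (h := fun S ↦ S ∈ 𝒜) (A := A) (B := B)
      (fun C _ hC a _ b _ ha hb hab ↦ propext
        ⟨hcon C a b hC ha hb hab, hcon C b a hC hb ha hab.symm⟩)
      (subset_univ _) (subset_univ _) (hcard A hA) hBk
    exact hB (this.mp hA)
  have disj : ∀ {C D : Finset (ZMod n)}, C.card + 1 = k → D.card + 1 = k → Disjoint C D →
      x ∉ C → y ∉ C → x ∉ D → y ∉ D → (insert x C ∈ 𝒜 ∧ insert y C ∉ 𝒜) →
      (insert x D ∈ 𝒜 ∧ insert y D ∉ 𝒜) := by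
    intro C D hC hD hCD hxC hyC hxD hyD ⟨h₁, h₂⟩
    have := ident hC hD hCD hxy hxC hyC hxD hyD
    rw [if_pos h₁, if_neg h₂] at this
    grind
  have all : ∀ D : Finset (ZMod n), D.card + 1 = k → x ∉ D → y ∉ D →
      insert x D ∈ 𝒜 ∧ insert y D ∉ 𝒜 := by
    intro D hD hxD hyD
    have := eq_of_exchange (X := {x, y}ᶜ) (r := k - 1)
      (h := fun S ↦ insert x S ∈ 𝒜 ∧ insert y S ∉ 𝒜) (A := C) (B := D) ?_
      (fun a ha ↦ by simp; grind) (fun a ha ↦ by simp; grind) (by omega) (by omega)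
    · exact this.mp ⟨hx, hy⟩
    intro S hS hSk a haX b hbX ha hb hab
    have hxS : x ∉ S := fun h ↦ by simpa using hS h
    have hyS : y ∉ S := fun h ↦ by simpa using hS h
    simp only [mem_compl, mem_insert, mem_singleton, not_or] at haX hbX
    obtain ⟨E, hE, hEk⟩ := exists_subset_compl_card (E := insert a (insert b (insert x (insert y S))))
      (r := k - 1) (by
        have h₁ := card_insert_le a (insert b (insert x (insert y S)))
        have h₂ := card_insert_le b (insert x (insert y S))
        have h₃ := card_insert_le x (insert y S)
        have h₄ := card_insert_le y S
        rw [ZMod.card]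
        omega)
    simp only [disjoint_insert_right] at hE
    obtain ⟨haE, hbE, hxE, hyE, hSE⟩ := hE
    have ca : (insert a S).card + 1 = k := by rw [card_insert_of_notMem ha]; omega
    have cb : (insert b S).card + 1 = k := by rw [card_insert_of_notMem hb]; omega
    have da : Disjoint (insert a S) E := disjoint_insert_left.2 ⟨haE, hSE.symm⟩
    have db : Disjoint (insert b S) E := disjoint_insert_left.2 ⟨hbE, hSE.symm⟩
    have xa : x ∉ insert a S := by grind
    have xb : x ∉ insert b S := by grind
    have ya : y ∉ insert a S := by grind
    have yb : y ∉ insert b S := by grind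
    exact propext
      ⟨fun h ↦ disj (by omega) cb db.symm hxE hyE xb yb (disj ca (by omega) da xa ya hxE hyE h),
        fun h ↦ disj (by omega) ca da.symm hxE hyE xa ya (disj cb (by omega) db xb yb hxE hyE h)⟩
  refine ⟨x, fun B hB ↦ ?_⟩
  by_contra hxB
  have hyB : y ∉ B := fun hyB ↦ by
    have hE := (all (B.erase y) (by rw [card_erase_add_one hyB, hcard B hB])
      (fun h ↦ hxB (mem_of_mem_erase h)) (notMem_erase _ _)).2
    rw [insert_erase hyB] at hE
    exact hE hB
  obtain ⟨E, hE, hEk⟩ := exists_subset_compl_card (E := insert x (insert y B)) (r := k - 1) (by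
    have h₁ := card_insert_le x (insert y B)
    have h₂ := card_insert_le y B
    rw [hcard B hB] at h₂
    rw [ZMod.card]
    omega)
  simp only [disjoint_insert_right] at hE
  obtain ⟨hxE, hyE, hEB⟩ := hE
  have := hint _ (all E (by omega) hxE hyE).1 B hB
  rw [disjoint_iff_inter_eq_empty.1 (disjoint_insert_left.2 ⟨hxB, hEB⟩)] at this
  exact not_nonempty_empty this

end ErdosKoRado

theorem stmt_2 (n k : ℕ) (hn : 0 < n) (hk : 0 < k) (hkn : 2 * k < n)
    (𝒜 : Finset (Finset ℕ))
    (hground : ∀ A ∈ 𝒜, A ⊆ Finset.Icc 1 n)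
    (hcard : ∀ A ∈ 𝒜, A.card = k)
    (hint : ∀ A ∈ 𝒜, ∀ B ∈ 𝒜, (A ∩ B).Nonempty)
    (hsize : 𝒜.card = (n - 1).choose (k - 1)) :
    ∃ x ∈ Finset.Icc 1 n, ∀ A ∈ 𝒜, x ∈ A := by
  have : NeZero n := ⟨hn.ne'⟩
  let g : ZMod n ↪ ℕ := ⟨fun z ↦ z.val + 1, fun a b h ↦ ZMod.val_injective n (by simpa using h)⟩
  have hg : ∀ z, g z = z.val + 1 := fun _ ↦ rfl
  have hrange : Finset.univ.map g = Finset.Icc 1 n := by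
    ext m
    simp only [mem_map, mem_univ, true_and, mem_Icc, hg]
    constructor
    · rintro ⟨z, rfl⟩
      have := ZMod.val_lt z
      omega
    · intro hm
      exact ⟨(m - 1 : ℕ), by rw [ZMod.val_cast_of_lt (by omega)]; omega⟩
  let ℬ : Finset (Finset (ZMod n)) := {B | B.map g ∈ 𝒜}
  have hℬ : ∀ B, B ∈ ℬ ↔ B.map g ∈ 𝒜 := fun B ↦ by simp [ℬ]
  have hlift : ∀ A ∈ 𝒜, ∃ B ∈ ℬ, B.map g = A := by
    intro A hA
    have hA' := hground A hA
    rw [← hrange, subset_map_iff] at hA'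
    obtain ⟨B, -, rfl⟩ := hA'
    exact ⟨B, (hℬ B).2 hA, rfl⟩
  have himage : ℬ.map (mapEmbedding g).toEmbedding = 𝒜 := by
    ext A
    simp only [mem_map, RelEmbedding.coe_toEmbedding, mapEmbedding_apply]
    exact ⟨by rintro ⟨B, hB, rfl⟩; exact (hℬ B).1 hB, hlift A⟩
  obtain ⟨x, hx⟩ := ErdosKoRado.exists_forall_mem (𝒜 := ℬ) hk hkn
    (fun B hB ↦ by rw [← card_map g, hcard _ ((hℬ B).1 hB)])
    (fun A hA B hB ↦ by
      have := hint _ ((hℬ A).1 hA) _ ((hℬ B).1 hB)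
      rwa [← map_inter, map_nonempty] at this)
    (by rw [← hsize, ← himage, card_map])
  refine ⟨g x, hrange ▸ mem_map_of_mem g (mem_univ x), fun A hA ↦ ?_⟩
  obtain ⟨B, hB, rfl⟩ := hlift A hA
  exact mem_map_of_mem g (hx B hB)
end

section
/- Let n and k be positive integers with 2*k ≤ n. If 𝒜 is a shifted intersecting family of k-element subsets of {1,...,n}, then |𝒜| ≤ binomial(n-1, k-1). -/
theorem Finset.image_succ_filter_fin {n : ℕ} {A : Finset ℕ} (hA : A ⊆ Finset.Icc 1 n) :
    (Finset.univ.filter fun i : Fin n => i.val + 1 ∈ A).image (fun i => i.val + 1) = A := by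
  ext a
  simp only [Finset.mem_image, Finset.mem_filter, Finset.mem_univ, true_and]
  constructor
  · rintro ⟨i, hi, rfl⟩
    exact hi
  · intro ha
    obtain ⟨h1, h2⟩ := Finset.mem_Icc.mp (hA ha)
    have h : a - 1 + 1 = a := by omega
    exact ⟨⟨a - 1, by omega⟩, by simpa only [h] using ha, h⟩

theorem stmt_3 (n k : ℕ) (hn : 0 < n) (hk : 0 < k) (hkn : 2 * k ≤ n)
    (𝒜 : Finset (Finset ℕ))
    (hground : ∀ A ∈ 𝒜, A ⊆ Finset.Icc 1 n)
    (hcard : ∀ A ∈ 𝒜, A.card = k)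
    (hint : ∀ A ∈ 𝒜, ∀ B ∈ 𝒜, (A ∩ B).Nonempty)
    (hshift : ∀ S ∈ 𝒜, ∀ i ∈ S, ∀ j, 1 ≤ j → j < i → j ∉ S →
      insert j (S.erase i) ∈ 𝒜) :
    𝒜.card ≤ (n - 1).choose (k - 1) := by
  let f : Finset ℕ → Finset (Fin n) := fun A => Finset.univ.filter fun i => i.val + 1 ∈ A
  have hf : ∀ A ∈ 𝒜, (f A).image (fun i => i.val + 1) = A := fun A hA =>
    Finset.image_succ_filter_fin (hground A hA)
  have hinj : Set.InjOn f 𝒜 := fun A hA B hB h => by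
    rw [← hf A hA, ← hf B hB, h]
  rw [← Finset.card_image_of_injOn hinj]
  apply Finset.erdos_ko_rado
  · intro S hS T hT hdisj
    obtain ⟨A, hA, rfl⟩ := Finset.mem_image.mp hS
    obtain ⟨B, hB, rfl⟩ := Finset.mem_image.mp hT
    obtain ⟨a, ha⟩ := hint A hA B hB
    obtain ⟨haA, haB⟩ := Finset.mem_inter.mp ha
    obtain ⟨h1, h2⟩ := Finset.mem_Icc.mp (hground A hA haA)
    have h : a - 1 + 1 = a := by omega
    have hA' : (⟨a - 1, by omega⟩ : Fin n) ∈ f A := by simpa [f, h] using haA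
    exact Finset.disjoint_left.mp hdisj hA' (by simpa [f, h] using haB)
  · intro S hS
    obtain ⟨A, hA, rfl⟩ := Finset.mem_image.mp hS
    rw [← hcard A hA]
    conv_rhs => rw [← hf A hA]
    exact (Finset.card_image_of_injective _ fun i j h => Fin.ext (Nat.succ.inj h)).symm
  · omega
end

section
/- Let n and k be positive integers with 2*k ≤ n, and let 𝒜 be a shifted intersecting family of k-element subsets of {1,...,n}. Then the family link_𝒜(n) = { A \ {n} : A ∈ 𝒜, n ∈ A } is intersecting; that is, for all C, D ∈ link_𝒜(n), C ∩ D ≠ ∅. -/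
theorem stmt_4 (n k : ℕ) (hn : 0 < n) (hk : 0 < k) (hkn : 2 * k ≤ n)
    (𝒜 : Finset (Finset ℕ))
    (hground : ∀ A ∈ 𝒜, A ⊆ Finset.Icc 1 n)
    (hcard : ∀ A ∈ 𝒜, A.card = k)
    (hint : ∀ A ∈ 𝒜, ∀ B ∈ 𝒜, (A ∩ B).Nonempty)
    (hshift : ∀ S ∈ 𝒜, ∀ i ∈ S, ∀ j, 1 ≤ j → j < i → j ∉ S →
      insert j (S.erase i) ∈ 𝒜) :
    ∀ C ∈ (𝒜.filter fun A => n ∈ A).image (fun A => A.erase n),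
    ∀ D ∈ (𝒜.filter fun A => n ∈ A).image (fun A => A.erase n),
      (C ∩ D).Nonempty := by
  simp only [Finset.mem_image, Finset.mem_filter]
  rintro _ ⟨A, ⟨hA, hnA⟩, rfl⟩ _ ⟨B, ⟨hB, hnB⟩, rfl⟩
  by_contra hdisj
  rw [Finset.not_nonempty_iff_eq_empty, Finset.eq_empty_iff_forall_notMem] at hdisj
  have hunion : (A ∪ B).card < (Finset.Icc 1 n).card := by
    have hinter : 0 < (A ∩ B).card := (hint A hA B hB).card_pos
    have hsum := Finset.card_union_add_card_inter A B
    rw [hcard A hA, hcard B hB] at hsum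
    rw [Nat.card_Icc]
    omega
  obtain ⟨j, hj, hjAB⟩ := Finset.exists_mem_notMem_of_card_lt_card hunion
  rw [Finset.mem_union, not_or] at hjAB
  rw [Finset.mem_Icc] at hj
  have hjn : j ≠ n := fun h => hjAB.1 (h ▸ hnA)
  obtain ⟨x, hx⟩ :=
    hint _ (hshift A hA n hnA j hj.1 (lt_of_le_of_ne hj.2 hjn) hjAB.1) B hB
  rw [Finset.mem_inter, Finset.mem_insert] at hx
  obtain ⟨rfl | hxA, hxB⟩ := hx
  · exact hjAB.2 hxB
  · exact hdisj x (Finset.mem_inter.2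
      ⟨hxA, Finset.mem_erase.2 ⟨Finset.ne_of_mem_erase hxA, hxB⟩⟩)
end

section
/- Let F be a field, let n be a positive integer, and let V be an F-linear subspace of the space M_n(F) of n×n matrices over F such that every matrix in V is nilpotent. Then dim_F V ≤ n*(n-1)/2 (that is, dim_F V ≤ binomial(n,2)). -/
/-- A minimal nonempty set of indices on which every row of `M` has a nonzero entry supports a
generalized permutation matrix. -/
theorem exists_monomial_principal_submatrix {ι F : Type*} [Fintype ι] [Nonempty ι] [Zero F]
    (M : ι → ι → F) (hM : ∀ i, ∃ j, M i j ≠ 0) :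
    ∃ (S : Finset ι), S.Nonempty ∧
      ∀ j ∈ S, ∃ i ∈ S, M i j ≠ 0 ∧ ∀ k ∈ S, k ≠ i → M k j = 0 := by
  classical
  obtain ⟨S, -, hS⟩ := exists_minimal_le_of_wellFoundedLT
    (fun S : Finset ι ↦ S.Nonempty ∧ ∀ i ∈ S, ∃ j ∈ S, M i j ≠ 0) Finset.univ
    ⟨Finset.univ_nonempty, fun i _ ↦ by simpa using hM i⟩
  have image_eq (f : ι → ι) (hf : ∀ i ∈ S, f i ∈ S ∧ M i (f i) ≠ 0) : S.image f = S := by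
    have hsub : S.image f ⊆ S := Finset.image_subset_iff.2 fun i hi ↦ (hf i hi).1
    refine hsub.antisymm (hS.le_of_le ⟨hS.prop.1.image f, fun i hi ↦ ?_⟩ hsub)
    exact ⟨f i, Finset.mem_image_of_mem f (hsub hi), (hf i (hsub hi)).2⟩
  have inj (f : ι → ι) (hf : ∀ i ∈ S, f i ∈ S ∧ M i (f i) ≠ 0) : Set.InjOn f S :=
    Finset.card_image_iff.1 (by rw [image_eq f hf])
  have hrow : ∀ i, ∃ j, i ∈ S → j ∈ S ∧ M i j ≠ 0 := fun i ↦ by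
    by_cases hi : i ∈ S
    · obtain ⟨j, hj⟩ := hS.prop.2 i hi
      exact ⟨j, fun _ ↦ hj⟩
    · exact ⟨i, fun h ↦ absurd h hi⟩
  choose f hf using hrow
  refine ⟨S, hS.prop.1, fun j hj ↦ ?_⟩
  obtain ⟨i, hi, rfl⟩ : ∃ i ∈ S, f i = j := by
    rw [← image_eq f hf] at hj
    exact Finset.mem_image.1 hj
  refine ⟨i, hi, (hf i hi).2, fun k hk hki ↦ ?_⟩
  by_contra hne
  refine hki (inj (Function.update f k (f i)) (fun l hl ↦ ?_) hk hi ?_)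
  · rcases eq_or_ne l k with rfl | hlk
    · simpa using ⟨hj, hne⟩
    · simpa [hlk] using hf l hl
  · simp [Function.update_of_ne hki.symm]

/-- In every basis, a space of nilpotent endomorphisms has a basis vector whose span is not the
range of a nonzero endomorphism of the space. -/
theorem exists_basis_vector_forall_eq_zero {ι F E : Type*} [Fintype ι] [Nonempty ι] [Field F]
    [AddCommGroup E] [Module F E] (b : Module.Basis ι F E) (V : Submodule F (Module.End F E))
    (hV : ∀ A ∈ V, IsNilpotent A) :
    ∃ i, ∀ A ∈ V, (∀ y, A y ∈ Submodule.span F {b i}) → A = 0 := by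
  classical
  by_contra! h
  choose A hAV hspan hA0 using h
  have hA (i : ι) (y : E) : A i y = b.repr (A i y) i • b i := by
    obtain ⟨c, hc⟩ := Submodule.mem_span_singleton.1 (hspan i y)
    simp [← hc]
  obtain ⟨S, ⟨j₀, hj₀⟩, hS⟩ := exists_monomial_principal_submatrix
    (fun i j ↦ b.repr (A i (b j)) i) (fun i ↦ by
      by_contra! h0
      exact hA0 i (b.ext fun j ↦ by rw [hA i (b j), h0 j]; simp))
  obtain ⟨m, hm⟩ := hV (∑ i ∈ S, A i) (V.sum_mem fun i _ ↦ hAV i)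
  have hpow (m : ℕ) : ∀ j ∈ S, ((∑ i ∈ S, A i) ^ m) (b j) ≠ 0 := by
    induction m with
    | zero => intro j _; simpa using b.ne_zero j
    | succ m ih =>
      intro j hj
      obtain ⟨i, hi, hij, hne⟩ := hS j hj
      have hsum : (∑ i ∈ S, A i) (b j) = b.repr (A i (b j)) i • b i := by
        rw [LinearMap.sum_apply, Finset.sum_eq_single_of_mem i hi, ← hA]
        intro k hk hki
        rw [hA, hne k hk hki, zero_smul]
      rw [pow_succ, Module.End.mul_apply, hsum, map_smul]
      exact smul_ne_zero hij (ih i hi)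
  exact hpow m j₀ hj₀ (by simp [hm])

/-- **Gerstenhaber's theorem** for endomorphisms of a finite-dimensional space. -/
theorem finrank_le_choose_two_of_forall_isNilpotent {F : Type*} [Field F] (n : ℕ) :
    ∀ {E : Type*} [AddCommGroup E] [Module F E] [FiniteDimensional F E],
      Module.finrank F E = n → ∀ V : Submodule F (Module.End F E),
      (∀ A ∈ V, IsNilpotent A) → Module.finrank F V ≤ n.choose 2 := by
  induction n with
  | zero =>
    intro E _ _ _ hn V _
    refine (Submodule.finrank_le V).trans ?_
    simp [Module.finrank_linearMap, hn]
  | succ n ih =>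
    intro E _ _ _ hn V hV
    obtain ⟨i, hx⟩ := exists_basis_vector_forall_eq_zero (Module.finBasisOfFinrankEq F E hn) V hV
    have hx0 := (Module.finBasisOfFinrankEq F E hn).ne_zero i
    set x := Module.finBasisOfFinrankEq F E hn i
    let p := Submodule.span F {x}
    let ev : V →ₗ[F] E := (LinearMap.applyₗ x).comp V.subtype
    have hp (A : LinearMap.ker ev) : p ≤ p.comap (A : V).1 := by
      have hAx : (A : V).1 x = 0 := A.2
      rw [Submodule.span_singleton_le_iff_mem, Submodule.mem_comap, hAx]
      exact p.zero_mem
    let T : LinearMap.ker ev →ₗ[F] Module.End F (E ⧸ p) :=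
      { toFun := fun A ↦ p.mapQ p (A : V).1 (hp A)
        map_add' := fun A B ↦ by ext; simp
        map_smul' := fun c A ↦ by ext; simp }
    have hT : Function.Injective T := by
      rw [injective_iff_map_eq_zero]
      intro A hA
      ext1
      ext1
      refine hx _ (A : V).2 fun y ↦ ?_
      have h0 : T A (p.mkQ y) = 0 := by simp [hA]
      exact (Submodule.Quotient.mk_eq_zero p).1 h0
    have hker : Module.finrank F (LinearMap.ker ev) ≤ n.choose 2 := by
      rw [← LinearMap.finrank_range_of_inj hT]
      refine ih ?_ _ ?_
      · have h1 := p.finrank_quotient_add_finrank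
        rw [finrank_span_singleton hx0, hn] at h1
        omega
      · rintro _ ⟨A, rfl⟩
        obtain ⟨m, hm⟩ := hV _ (A : V).2
        refine ⟨m, ?_⟩
        change (p.mapQ p (A : V).1 (hp A)) ^ m = 0
        rw [← Submodule.mapQ_pow p (hp A) m]
        ext y
        simp [hm]
    have hrange : Module.finrank F (LinearMap.range ev) < n + 1 := by
      rw [← hn]
      refine Submodule.finrank_lt fun htop ↦ ?_
      obtain ⟨A, hA⟩ : x ∈ LinearMap.range ev := htop ▸ Submodule.mem_top
      have hAx : A.1 x = x := hA
      obtain ⟨m, hm⟩ := hV _ A.2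
      have hfix : (A.1 ^ m) x = x := by
        rw [Module.End.pow_apply]
        exact Function.iterate_fixed hAx m
      exact hx0 (by rw [← hfix, hm, LinearMap.zero_apply])
    have hsum := LinearMap.finrank_range_add_finrank_ker ev
    have hchoose := Nat.choose_succ_succ' n 1
    simp only [Nat.choose_one_right, Nat.reduceAdd] at hchoose
    omega

theorem stmt_5 (F : Type*) [Field F] (n : ℕ) (hn : 0 < n)
    (V : Submodule F (Matrix (Fin n) (Fin n) F))
    (hnil : ∀ A ∈ V, IsNilpotent A) :
    Module.finrank F V ≤ n.choose 2 := by
  rw [← (Matrix.toLinAlgEquiv' (R := F) (n := Fin n)).toLinearEquiv.finrank_map_eq V]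
  refine finrank_le_choose_two_of_forall_isNilpotent n (by simp) _ ?_
  rintro _ ⟨A, hA, rfl⟩
  exact (hnil A hA).map (Matrix.toLinAlgEquiv' (R := F) (n := Fin n))
end

section
/- Let F be a field, let n be a positive integer, and let V be an F-linear subspace of M_n(F) such that every matrix in V is nilpotent and dim_F V = n*(n-1)/2. Then there exists an invertible matrix g ∈ GL_n(F) such that g V g⁻¹ equals the subspace of all strictly upper triangular n×n matrices (matrices A with A_{ij} = 0 whenever i ≥ j). -/
open Polynomial in
theorem Matrix.charpolyRev_eq_one_of_isNilpotent {F ι : Type*} [Field F] [Fintype ι] [DecidableEq ι]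
    {M : Matrix ι ι F} (hM : IsNilpotent M) : M.charpolyRev = 1 := by
  obtain ⟨a, -, ha⟩ := Polynomial.isUnit_iff.mp (Matrix.isUnit_charpolyRev_of_isNilpotent hM)
  have h0 : M.charpolyRev.eval 0 = 1 := M.eval_charpolyRev
  rw [← ha, eval_C] at h0
  rw [← ha, h0, C_1]

open Polynomial in
theorem Matrix.trace_mul_eq_zero_of_isNilpotent_aux {F ι : Type*} [Field F] [Fintype ι]
    [DecidableEq ι] {A B : Matrix ι ι F} (hA : IsNilpotent A) (hB : IsNilpotent B)
    (hAB : IsNilpotent (A + B)) :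
    (A * B).trace = 0 ∧ ((A + B) * (A * B)).trace = 0 := by
  have dA := charpolyRev_eq_one_of_isNilpotent hA
  have dB := charpolyRev_eq_one_of_isNilpotent hB
  have dS := charpolyRev_eq_one_of_isNilpotent hAB
  set T : Matrix ι ι F[X] := 1 - (X : F[X]) • (A + B).map C with hT
  have hTR : T * T.adjugate = 1 := by
    rw [mul_adjugate]
    change (A + B).charpolyRev • _ = _
    rw [dS, one_smul]
  set R := T.adjugate
  have hR : R = 1 + (X : F[X]) • ((A + B).map C * R) := by
    have : T * R = R - (X : F[X]) • ((A + B).map C * R) := by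
      rw [hT, sub_mul, one_mul, smul_mul_assoc]
    rw [← hTR, this]; abel
  set Q := A.map C * B.map (C : F →+* F[X]) with hQ
  have hQ' : Q = (A * B).map (C : F →+* F[X]) := (Matrix.map_mul).symm
  have hfac : (1 - (X : F[X]) • A.map C) * (1 - (X : F[X]) • B.map C)
      = T * (1 + (X ^ 2 : F[X]) • (R * Q)) := by
    rw [mul_add, mul_one, mul_smul_comm, ← mul_assoc, hTR, one_mul, hT, hQ,
      Matrix.map_add _ (fun a b => C_add)]
    simp only [sub_mul, mul_sub, one_mul, mul_one, smul_mul_smul_comm, pow_two, smul_add]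
    abel
  have hdet : det (1 + (X ^ 2 : F[X]) • (R * Q)) = 1 := by
    have := congrArg det hfac
    rw [det_mul, det_mul] at this
    change A.charpolyRev * B.charpolyRev = (A + B).charpolyRev * _ at this
    rw [dA, dB, dS] at this
    simpa using this.symm
  obtain ⟨q, hq⟩ : ∃ q : F[X], det (1 + (X ^ 2 : F[X]) • (R * Q)) =
      1 + (R * Q).trace * X ^ 2 + q * (X ^ 2) ^ 2 := ⟨_, det_one_add_smul _ _⟩
  rw [hq] at hdet
  have htr : (R * Q).trace = - q * X ^ 2 := by
    have : (X ^ 2 : F[X]) * ((R * Q).trace + q * X ^ 2) = 0 := by linear_combination hdet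
    rcases mul_eq_zero.mp this with h | h
    · exact absurd h (pow_ne_zero _ X_ne_zero)
    · linear_combination h
  have htrC : ∀ N : Matrix ι ι F, (N.map (C : F →+* F[X])).trace = C N.trace := fun N => by
    simp [trace, map_sum]
  have key : ∃ p : F[X], (R * Q).trace =
      C (A * B).trace + X * C ((A + B) * (A * B)).trace + X ^ 2 * p := by
    have e1 : R * Q = Q + (X : F[X]) • ((A + B).map C * Q)
        + (X ^ 2 : F[X]) • ((A + B).map C * ((A + B).map C * R) * Q) := by
      conv_lhs => rw [hR, hR]
      simp only [add_mul, mul_add, one_mul, smul_mul_assoc, mul_smul_comm, smul_add, mul_one,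
        mul_assoc, smul_smul, pow_two]
      abel
    refine ⟨((A + B).map C * ((A + B).map C * R) * Q).trace, ?_⟩
    conv_lhs => rw [e1]
    rw [trace_add, trace_add, trace_smul, trace_smul, hQ', ← Matrix.map_mul]
    simp only [smul_eq_mul]
    rw [htrC, htrC]
  obtain ⟨p, hp⟩ := key
  rw [htr] at hp
  constructor
  · have := congrArg (fun p => coeff p 0) hp
    simpa [coeff_X_pow, mul_coeff_zero] using this.symm
  · have := congrArg (fun p => coeff p 1) hp
    simpa [coeff_X_pow_mul', coeff_mul_X_pow', coeff_X_mul, coeff_C] using this.symm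

open scoped Matrix in
open Polynomial in
theorem Matrix.dotProduct_pow_mulVec_eq_zero_of_isNilpotent {F ι : Type*} [Field F] [Fintype ι]
    [DecidableEq ι] {B : Matrix ι ι F} {y f : ι → F} (hB : IsNilpotent B)
    (hBy : IsNilpotent (B + vecMulVec y f)) (k : ℕ) : f ⬝ᵥ (B ^ k *ᵥ y) = 0 := by
  have dB := charpolyRev_eq_one_of_isNilpotent hB
  have dS := charpolyRev_eq_one_of_isNilpotent hBy
  set T : Matrix ι ι F[X] := 1 - (X : F[X]) • B.map C with hT
  have hTR : T * T.adjugate = 1 := by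
    rw [mul_adjugate]
    change B.charpolyRev • _ = _
    rw [dB, one_smul]
  set R := T.adjugate
  have hR : R = 1 + (X : F[X]) • (B.map C * R) := by
    have : T * R = R - (X : F[X]) • (B.map C * R) := by
      rw [hT, sub_mul, one_mul, smul_mul_assoc]
    rw [← hTR, this]; abel
  set y' : ι → F[X] := fun i => C (y i)
  set f' : ι → F[X] := fun i => C (f i)
  have hfac : 1 - (X : F[X]) • (B + vecMulVec y f).map C
      = T * (1 - vecMulVec ((X : F[X]) • (R *ᵥ y')) f') := by
    have h1 : (vecMulVec y f).map C = vecMulVec y' f' := by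
      ext i j : 2; simp [vecMulVec_apply, y', f']
    rw [mul_sub, mul_one, mul_vecMulVec, mulVec_smul, mulVec_mulVec, hTR, one_mulVec, hT,
      Matrix.map_add _ (fun a b => C_add), smul_add, h1, smul_vecMulVec, sub_sub]
  have h0 : f' ⬝ᵥ (R *ᵥ y') = 0 := by
    have := congrArg det hfac
    rw [det_mul] at this
    change (B + vecMulVec y f).charpolyRev = B.charpolyRev * _ at this
    rw [dB, dS, one_mul, sub_eq_add_neg, ← neg_vecMulVec, vecMulVec_eq Unit,
      det_one_add_replicateCol_mul_replicateRow, dotProduct_neg, dotProduct_smul, smul_eq_mul] at this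
    have h2 : (X : F[X]) * (f' ⬝ᵥ (R *ᵥ y')) = 0 := by linear_combination this
    simpa [X_ne_zero] using h2
  have step : ∀ k : ℕ, f' ⬝ᵥ (((B ^ k).map C * R) *ᵥ y') =
      C (f ⬝ᵥ (B ^ k *ᵥ y)) + X * (f' ⬝ᵥ (((B ^ (k + 1)).map C * R) *ᵥ y')) := by
    intro k
    have e : (B ^ k).map C * R = (B ^ k).map C + (X : F[X]) • ((B ^ (k + 1)).map C * R) := by
      conv_lhs => rw [hR]
      rw [mul_add, mul_one, mul_smul_comm, ← mul_assoc, ← Matrix.map_mul, pow_succ]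
    conv_lhs => rw [e]
    rw [add_mulVec, dotProduct_add, smul_mulVec, dotProduct_smul, smul_eq_mul]
    have hC : C (f ⬝ᵥ (B ^ k *ᵥ y)) = f' ⬝ᵥ ((B ^ k).map C *ᵥ y') := by
      rw [RingHom.map_dotProduct]
      exact congrArg (f' ⬝ᵥ ·) (funext fun i => RingHom.map_mulVec C (B ^ k) y i)
    rw [hC]
  have all : ∀ k : ℕ, f' ⬝ᵥ (((B ^ k).map C * R) *ᵥ y') = 0 := by
    intro k
    induction k with
    | zero => simpa using h0
    | succ k ih =>
      have h := step k
      rw [ih] at h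
      have c0 := congrArg (fun p => coeff p 0) h
      simp only [coeff_zero, coeff_add, coeff_C_zero, mul_coeff_zero, coeff_X_zero, zero_mul,
        add_zero] at c0
      rw [← c0, C_0, zero_add] at h
      simpa [X_ne_zero] using h.symm
  have h := step k
  rw [all, all] at h
  have c0 := congrArg (fun p => coeff p 0) h
  simpa using c0.symm

theorem Submodule.trace_mul_eq_zero {F ι : Type*} [Field F] [Fintype ι] [DecidableEq ι]
    {V : Submodule F (Matrix ι ι F)} (hV : ∀ A ∈ V, IsNilpotent A) {A B : Matrix ι ι F}
    (hA : A ∈ V) (hB : B ∈ V) : (A * B).trace = 0 :=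
  (Matrix.trace_mul_eq_zero_of_isNilpotent_aux (hV A hA) (hV B hB) (hV _ (V.add_mem hA hB))).1

theorem Submodule.trace_sq_mul_add {F ι : Type*} [Field F] [Fintype ι] [DecidableEq ι]
    {V : Submodule F (Matrix ι ι F)} (hV : ∀ A ∈ V, IsNilpotent A) {A B : Matrix ι ι F}
    (hA : A ∈ V) (hB : B ∈ V) : (A * (A * B)).trace + (A * (B * B)).trace = 0 := by
  have h := (Matrix.trace_mul_eq_zero_of_isNilpotent_aux (hV A hA) (hV B hB)
    (hV _ (V.add_mem hA hB))).2
  rw [add_mul, Matrix.trace_add, Matrix.trace_mul_comm B, mul_assoc] at h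
  exact h

theorem Submodule.trace_mul_anticomm {F ι : Type*} [Field F] [Fintype ι] [DecidableEq ι]
    {V : Submodule F (Matrix ι ι F)} (hV : ∀ A ∈ V, IsNilpotent A) {M A B : Matrix ι ι F}
    (hM : M ∈ V) (hA : A ∈ V) (hB : B ∈ V) : (M * (A * B + B * A)).trace = 0 := by
  have h1 := trace_sq_mul_add hV hM (V.add_mem hA hB)
  have h2 := trace_sq_mul_add hV hM hA
  have h3 := trace_sq_mul_add hV hM hB
  simp only [mul_add, add_mul, Matrix.trace_add] at *
  linear_combination h1 - h2 - h3
section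

open scoped Matrix
open Matrix

theorem eq_zero_of_forall_ne_zero_imp {F M : Type*} [Field F] [AddCommGroup M] [Module F M]
    {V : Submodule F M} {l u : M → F} (hl : ∀ A B, l (A + B) = l A + l B)
    (hu : ∀ A B, u (A + B) = u A + u B) (hne : ∃ D ∈ V, l D ≠ 0)
    (h : ∀ A ∈ V, l A ≠ 0 → u A = 0) : ∀ A ∈ V, u A = 0 := by
  intro A hA
  obtain ⟨D, hD, hlD⟩ := hne
  by_cases hlA : l A = 0
  · have h1 := h (A + D) (V.add_mem hA hD) (by rwa [hl, hlA, zero_add])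
    rwa [hu, h D hD hlD, add_zero] at h1
  · exact h A hA hlA

variable {F ι : Type*} [Field F] [Fintype ι] [DecidableEq ι]

theorem IsNilpotent.mulVec_eq_zero_of_eq_smul {A : Matrix ι ι F} (hA : IsNilpotent A) {v : ι → F}
    {a : F} (h : A *ᵥ v = a • v) : A *ᵥ v = 0 := by
  obtain ⟨k, hk⟩ := hA
  have hp : ∀ k : ℕ, A ^ k *ᵥ v = a ^ k • v := by
    intro k
    induction k with
    | zero => simp
    | succ k ih => rw [_root_.pow_succ, ← mulVec_mulVec, h, mulVec_smul, ih, smul_smul, _root_.pow_succ']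
  have h1 := hp k
  rw [hk, zero_mulVec, eq_comm, smul_eq_zero] at h1
  rw [h]
  rcases h1 with h1 | h1
  · rw [eq_zero_of_pow_eq_zero h1, zero_smul]
  · rw [h1, smul_zero]

theorem IsNilpotent.mulVec_mulVec_eq_zero {A : Matrix ι ι F} (hA : IsNilpotent A) {v : ι → F}
    {a b : F} (h : A *ᵥ (A *ᵥ v) = a • (A *ᵥ v) + b • v) : A *ᵥ (A *ᵥ v) = 0 := by
  have hp : ∀ k : ℕ, A ^ (k + 2) *ᵥ v = a • (A ^ (k + 1) *ᵥ v) + b • (A ^ k *ᵥ v) := by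
    intro k
    rw [pow_add, ← mulVec_mulVec, pow_two, ← mulVec_mulVec, h, mulVec_add, mulVec_smul, mulVec_smul,
      mulVec_mulVec, ← _root_.pow_succ]
  classical
  have hex : ∃ k, A ^ k *ᵥ v = 0 := by
    obtain ⟨k, hk⟩ := hA
    exact ⟨k, by rw [hk, zero_mulVec]⟩
  have hk := Nat.find_spec hex
  have hmin := fun j => Nat.find_min (H := hex) (m := j)
  generalize Nat.find hex = k at hk hmin
  match k with
  | 0 => rw [pow_zero, one_mulVec] at hk; simp [hk]
  | 1 => rw [pow_one] at hk; simp [hk]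
  | 2 => rwa [pow_two, ← mulVec_mulVec] at hk
  | k + 3 =>
    have h4 : A ^ (k + 4) *ᵥ v = 0 := by
      rw [_root_.pow_succ', ← mulVec_mulVec, hk, mulVec_zero]
    have hb := hp (k + 2)
    rw [h4, hk, smul_zero, zero_add, eq_comm, smul_eq_zero] at hb
    have hb0 := hb.resolve_right (hmin _ (by omega))
    have ha := hp (k + 1)
    rw [hk, hb0, zero_smul, add_zero, eq_comm, smul_eq_zero] at ha
    exact absurd (ha.resolve_right (hmin _ (by omega))) (by
      intro ha0
      have h2 := hp 0
      rw [ha0, hb0] at h2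
      have h3 : A ^ (k + 2) *ᵥ v = 0 := by
        rw [pow_add, ← mulVec_mulVec, show A ^ 2 *ᵥ v = 0 by simpa using h2, mulVec_zero]
      exact hmin _ (by omega) h3)

theorem Submodule.pow_mulVec_apply_eq_zero {V : Submodule F (Matrix ι ι F)}
    (hV : ∀ A ∈ V, IsNilpotent A) {z : ι → F} {j : ι} (hz : vecMulVec z (Pi.single j 1) ∈ V)
    {A : Matrix ι ι F} (hA : A ∈ V) (k : ℕ) : (A ^ k *ᵥ z) j = 0 := by
  simpa using dotProduct_pow_mulVec_eq_zero_of_isNilpotent (hV A hA)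
    (hV _ (V.add_mem hA hz)) k

theorem Submodule.mulVec_eq_zero_of_vecMulVec_mem {V : Submodule F (Matrix ι ι F)}
    (hV : ∀ A ∈ V, IsNilpotent A) {o i l : ι} (hol : l ≠ o) (hil : l ≠ i) (hoi : o ≠ i) {c : F}
    (h1 : ∃ A ∈ V, A l o ≠ 0)
    (hz : ∀ j, j ≠ o → j ≠ i → vecMulVec (Pi.single i 1 + c • Pi.single o 1) (Pi.single j 1) ∈ V)
    {A : Matrix ι ι F} (hA : A ∈ V) : A *ᵥ (Pi.single i 1 + c • Pi.single o 1) = 0 := by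
  set z : ι → F := Pi.single i 1 + c • Pi.single o 1
  have hzo : z o = c := by simp [z, hoi]
  have hzi : z i = 1 := by simp [z, hoi.symm]
  have hAz : ∀ A ∈ V, A *ᵥ z = (A *ᵥ z) i • z + ((A *ᵥ z) o - c * (A *ᵥ z) i) • Pi.single o 1 := by
    intro A hA
    ext j
    by_cases hjo : j = o
    · subst hjo; simp [hzo]; ring
    by_cases hji : j = i
    · subst hji; simp [hzi, hjo]
    · have := pow_mulVec_apply_eq_zero hV (hz j hjo hji) hA 1
      rw [pow_one] at this
      rw [this]
      simp [z, hjo, hji]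
  have hβ : ∀ A ∈ V, (A *ᵥ z) o - c * (A *ᵥ z) i = 0 := by
    refine eq_zero_of_forall_ne_zero_imp (l := fun A => A l o) (fun A B => by simp)
      (fun A B => by simp [add_mulVec]; ring) h1 ?_
    intro A hA hAl
    have h2 := pow_mulVec_apply_eq_zero hV (hz l hol hil) hA 2
    have h1 := pow_mulVec_apply_eq_zero hV (hz l hol hil) hA 1
    rw [pow_one] at h1
    rw [pow_two, ← mulVec_mulVec, hAz A hA, mulVec_add, mulVec_smul, mulVec_smul] at h2
    simpa [h1, hAl] using h2
  have h := hAz A hA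
  rw [hβ A hA, zero_smul, add_zero] at h
  exact (hV A hA).mulVec_eq_zero_of_eq_smul h

theorem Submodule.exists_mulVec_eq_zero_of_corner {V : Submodule F (Matrix ι ι F)}
    (hV : ∀ A ∈ V, IsNilpotent A) {o i l w : ι} (hoi : o ≠ i) (hol : l ≠ o) (hil : l ≠ i)
    (hwo : w ≠ o) (hwi : w ≠ i) (hwl : w ≠ l) {c τ : F} (hτ : τ ≠ 0)
    (h1 : ∀ k, k ≠ o → ∃ A ∈ V, A *ᵥ Pi.single o 1 = Pi.single k 1)
    (hz : ∀ j, j ≠ o → j ≠ i → j ≠ l →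
      vecMulVec (Pi.single i 1 + c • Pi.single o 1) (Pi.single j 1) ∈ V)
    (hl : ∀ A ∈ V, (A *ᵥ (Pi.single i 1 + c • Pi.single o 1)) l = - τ * A w o) :
    ∃ v ≠ 0, ∀ A ∈ V, A *ᵥ v = 0 := by
  set z : ι → F := Pi.single i 1 + c • Pi.single o 1 with hzdef
  have hzo : z o = c := by simp [z, hoi]
  have hzi : z i = 1 := by simp [z, hoi.symm]
  have hzj : ∀ j, j ≠ o → j ≠ i → z j = 0 := fun j h h' => by simp [z, h, h']
  clear_value z
  have col : ∀ (A : Matrix ι ι F) a b, (A *ᵥ Pi.single b 1) a = A a b := by simp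
  set β : Matrix ι ι F → F := fun A => (A *ᵥ z) o - c * (A *ᵥ z) i with hβdef
  have hβadd : ∀ A B, β (A + B) = β A + β B := fun A B => by
    simp only [hβdef, add_mulVec, Pi.add_apply]; ring
  have hAzj : ∀ A ∈ V, ∀ j, j ≠ o → j ≠ i → j ≠ l → (A *ᵥ z) j = 0 := by
    intro A hA j hjo hji hjl
    have := pow_mulVec_apply_eq_zero hV (hz j hjo hji hjl) hA 1
    rwa [pow_one] at this
  have hAAzj : ∀ A ∈ V, ∀ j, j ≠ o → j ≠ i → j ≠ l → (A *ᵥ (A *ᵥ z)) j = 0 := by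
    intro A hA j hjo hji hjl
    have := pow_mulVec_apply_eq_zero hV (hz j hjo hji hjl) hA 2
    rwa [pow_two, ← mulVec_mulVec] at this
  have hAAAzj : ∀ A ∈ V, ∀ j, j ≠ o → j ≠ i → j ≠ l → (A *ᵥ (A *ᵥ (A *ᵥ z))) j = 0 := by
    intro A hA j hjo hji hjl
    have := pow_mulVec_apply_eq_zero hV (hz j hjo hji hjl) hA 3
    rwa [pow_succ, pow_two, ← mulVec_mulVec, ← mulVec_mulVec] at this
  have dec : ∀ v : ι → F, (∀ j, j ≠ o → j ≠ i → j ≠ l → v j = 0) →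
      v = v i • z + (v o - c * v i) • Pi.single o 1 + v l • Pi.single l 1 := by
    intro v hv
    ext j
    by_cases hjo : j = o
    · subst hjo; simp [hzo, hol.symm]; ring
    by_cases hji : j = i
    · subst hji; simp [hzi, hjo, hil.symm]
    by_cases hjl : j = l
    · subst hjl; simp [hzj j hjo hji, hjo]
    · simp [hv j hjo hji hjl, hzj j hjo hji, hjo, hjl]
  have hAz : ∀ A ∈ V, A *ᵥ z = (A *ᵥ z) i • z + β A • Pi.single o 1
      + (- τ * A w o) • Pi.single l 1 := by
    intro A hA
    conv_lhs => rw [dec (A *ᵥ z) (hAzj A hA)]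
    rw [hl A hA]
  have hAAz : ∀ A ∈ V, A *ᵥ (A *ᵥ z) = (A *ᵥ z) i • (A *ᵥ z) + β A • (A *ᵥ Pi.single o 1)
      + (- τ * A w o) • (A *ᵥ Pi.single l 1) := by
    intro A hA
    conv_lhs => rw [hAz A hA]
    rw [mulVec_add, mulVec_add, mulVec_smul, mulVec_smul, mulVec_smul]
  obtain ⟨D, hD, hDw⟩ := h1 w hwo
  have hDo : ∀ k, D k o = (Pi.single w 1 : ι → F) k := fun k => by rw [← hDw, col]
  have hDwo : D w o = 1 := by simp [hDo]
  have hne : ∃ D ∈ V, D w o ≠ 0 := ⟨D, hD, by simp [hDwo]⟩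
  have hβw : ∀ A ∈ V, β A - τ * A w l = 0 := by
    refine eq_zero_of_forall_ne_zero_imp (l := fun A => A w o) (fun A B => by simp)
      (fun A B => by simp only [hβadd, Matrix.add_apply]; ring) hne ?_
    intro A hA hAw
    have h2 := hAAzj A hA w hwo hwi hwl
    rw [hAAz A hA] at h2
    simp only [Pi.add_apply, Pi.smul_apply, col, smul_eq_mul, hAzj A hA w hwo hwi hwl] at h2
    have : A w o * (β A - τ * A w l) = 0 := by linear_combination h2
    exact (mul_eq_zero.mp this).resolve_left hAw
  have hwi0 : ∀ A ∈ V, A w i = - c * A w o := by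
    intro A hA
    have := hAzj A hA w hwo hwi hwl
    rw [hzdef, mulVec_add, mulVec_smul] at this
    simp only [Pi.add_apply, Pi.smul_apply, col, smul_eq_mul] at this
    linear_combination this
  have hβ1 : ∀ A ∈ V, A w o = 0 → A l o ≠ 0 → β A = 0 := by
    intro A hA hAw hAl
    by_cases hj : ∃ j, j ≠ o ∧ j ≠ i ∧ j ≠ l ∧ A j o ≠ 0
    · obtain ⟨j, hjo, hji, hjl, hAj⟩ := hj
      have h2 := hAAzj A hA j hjo hji hjl
      rw [hAAz A hA] at h2
      simpa only [Pi.add_apply, Pi.smul_apply, col, smul_eq_mul, hAzj A hA j hjo hji hjl, hAw,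
        mul_zero, zero_mul, zero_add, add_zero, mul_eq_zero, hAj, or_false] using h2
    · push Not at hj
      have h3 := hAAAzj A hA w hwo hwi hwl
      have hx : A *ᵥ Pi.single o 1 = A i o • z + (A o o - c * A i o) • Pi.single o 1
          + A l o • Pi.single l 1 := by
        conv_lhs => rw [dec (A *ᵥ Pi.single o 1) (fun j a b d => by rw [col]; exact hj j a b d)]
        simp only [col]
      rw [hAAz A hA, mulVec_add, mulVec_add, mulVec_smul, mulVec_smul, mulVec_smul, hx,
        mulVec_add, mulVec_add, mulVec_smul, mulVec_smul, mulVec_smul] at h3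
      simp only [Pi.add_apply, Pi.smul_apply, col, smul_eq_mul, hAzj A hA w hwo hwi hwl,
        hAAzj A hA w hwo hwi hwl, hAw] at h3
      have h4 := hβw A hA
      have h5 : A l o * (β A) ^ 2 = 0 := by linear_combination τ * h3 + A l o * β A * h4
      exact pow_eq_zero_iff (two_ne_zero) |>.mp ((mul_eq_zero.mp h5).resolve_left hAl)
  obtain ⟨G, hG, hGl⟩ := h1 l hol
  have hGo : ∀ k, G k o = (Pi.single l 1 : ι → F) k := fun k => by rw [← hGl, col]
  have hβ2 : ∀ A ∈ V, A w o = 0 → β A = 0 := by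
    intro A hA hAw
    by_cases hAl : A l o = 0
    · have h2 := hβ1 (A + G) (V.add_mem hA hG) (by simp [hAw, hGo, hwl])
        (by simp [hAl, hGo])
      rwa [hβadd, hβ1 G hG (by simp [hGo, hwl]) (by simp [hGo]), add_zero] at h2
    · exact hβ1 A hA hAw hAl
  have hβ3 : ∀ A ∈ V, β A = A w o * β D := by
    intro A hA
    have h2 := hβ2 (A + (- A w o) • D) (V.add_mem hA (V.smul_mem _ hD)) (by simp [hDwo])
    rw [hβadd] at h2
    have h3 : β ((- A w o) • D) = - A w o * β D := by
      simp only [hβdef, smul_mulVec, Pi.smul_apply, smul_eq_mul]; ring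
    rw [h3] at h2
    linear_combination h2
  set κ := β D
  set p : ι → F := κ • Pi.single o 1 + (-τ) • Pi.single l 1 with hp
  clear_value p
  have hAz' : ∀ A ∈ V, A *ᵥ z = (A *ᵥ z) i • z + A w o • p := by
    intro A hA
    conv_lhs => rw [hAz A hA, hβ3 A hA]
    rw [hp, smul_add, smul_smul, smul_smul, add_assoc, mul_comm (A w o) (-τ)]
  have hAAz' : ∀ A ∈ V, A *ᵥ (A *ᵥ z) = (A *ᵥ z) i • (A *ᵥ z) + A w o • (A *ᵥ p) := by
    intro A hA
    conv_lhs => rw [hAz' A hA]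
    rw [mulVec_add, mulVec_smul, mulVec_smul]
  have hApj : ∀ j, j ≠ o → j ≠ i → j ≠ l → ∀ A ∈ V, (A *ᵥ p) j = 0 := by
    intro j hjo hji hjl
    refine eq_zero_of_forall_ne_zero_imp (l := fun A => A w o) (fun A B => by simp)
      (fun A B => by simp [add_mulVec]) hne ?_
    intro A hA hAw
    have h2 := hAAzj A hA j hjo hji hjl
    rw [hAAz' A hA] at h2
    simpa only [Pi.add_apply, Pi.smul_apply, smul_eq_mul, hAzj A hA j hjo hji hjl,
      mul_zero, zero_add, mul_eq_zero, hAw, false_or] using h2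
  set γ : Matrix ι ι F → F := fun A =>
    (A *ᵥ p) o - c * (A *ᵥ p) i + κ * (τ⁻¹ * (A *ᵥ p) l) with hγdef
  have hAp : ∀ A ∈ V, A *ᵥ p = (A *ᵥ p) i • z + γ A • Pi.single o 1
      + (- τ⁻¹ * (A *ᵥ p) l) • p := by
    intro A hA
    conv_lhs => rw [dec (A *ᵥ p) (fun j a b d => hApj j a b d A hA)]
    ext k
    simp only [hp, hγdef, Pi.add_apply, Pi.smul_apply, smul_eq_mul]
    field_simp
    ring
  have hγ : ∀ A ∈ V, γ A = 0 := by
    refine eq_zero_of_forall_ne_zero_imp (l := fun A => A w o) (fun A B => by simp)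
      (fun A B => by simp only [hγdef, add_mulVec, Pi.add_apply]; ring) hne ?_
    intro A hA hAw
    have h3 := hAAAzj A hA w hwo hwi hwl
    rw [hAAz' A hA, mulVec_add, mulVec_smul, mulVec_smul, hAp A hA, mulVec_add, mulVec_add,
      mulVec_smul, mulVec_smul, mulVec_smul] at h3
    simp only [Pi.add_apply, Pi.smul_apply, col, smul_eq_mul, hAzj A hA w hwo hwi hwl,
        hAAzj A hA w hwo hwi hwl, hApj w hwo hwi hwl A hA] at h3
    have h5 : γ A * (A w o) ^ 2 = 0 := by linear_combination h3
    exact (mul_eq_zero.mp h5).resolve_right (pow_ne_zero _ hAw)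
  have hAp' : ∀ A ∈ V, A *ᵥ p = (A *ᵥ p) i • z + (- τ⁻¹ * (A *ᵥ p) l) • p := by
    intro A hA
    conv_lhs => rw [hAp A hA, hγ A hA, zero_smul, add_zero]
  have hDz : D *ᵥ z = (D *ᵥ z) i • z + p := by
    conv_lhs => rw [hAz' D hD, hDwo, one_smul]
  have hsq : ∀ A ∈ V, A *ᵥ z = D *ᵥ z → A *ᵥ (D *ᵥ z) = 0 := by
    intro A hA hAD
    rw [← hAD]
    apply (hV A hA).mulVec_mulVec_eq_zero (a := (D *ᵥ z) i - τ⁻¹ * (A *ᵥ p) l)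
      (b := (A *ᵥ p) i + τ⁻¹ * (A *ᵥ p) l * (D *ᵥ z) i)
    have hp' : p = D *ᵥ z - (D *ᵥ z) i • z := by rw [eq_sub_iff_add_eq, add_comm]; exact hDz.symm
    conv_lhs => rw [hAD, hDz, mulVec_add, mulVec_smul, hAp' A hA]
    rw [hAD]
    generalize (A *ᵥ p) i = s
    generalize (A *ᵥ p) l = t
    rw [hp']
    module
  refine ⟨D *ᵥ z, ?_, ?_⟩
  · intro h0
    have := hl D hD
    rw [h0, hDwo] at this
    simp at this
    exact hτ this
  · intro A hA
    set A' := A + (- A w o) • D with hA'def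
    have hA' : A' ∈ V := V.add_mem hA (V.smul_mem _ hD)
    have h0 : A' *ᵥ z = 0 := by
      apply (hV A' hA').mulVec_eq_zero_of_eq_smul (a := (A' *ᵥ z) i)
      have hw0 : A' w o = 0 := by simp [hA'def, hDwo]
      conv_lhs => rw [hAz' A' hA', hw0, zero_smul, add_zero]
    have h2 := hsq (D + A') (V.add_mem hD hA') (by rw [add_mulVec, h0, add_zero])
    rw [add_mulVec, hsq D hD rfl, zero_add, hA'def, add_mulVec, smul_mulVec, hsq D hD rfl,
      smul_zero, add_zero] at h2
    exact h2

end

section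

open scoped Matrix
open Matrix

variable {F : Type*} [Field F]

theorem Matrix.pow_card_eq_zero_of_isNilpotent {ι : Type*} [Fintype ι] [DecidableEq ι]
    {A : Matrix ι ι F} (hA : IsNilpotent A) : A ^ Fintype.card ι = 0 := by
  have h := Matrix.isNilpotent_charpoly_sub_pow_of_isNilpotent hA
  have h1 := A.aeval_self_charpoly
  rw [sub_eq_zero.mp h.eq_zero] at h1
  simpa using h1

theorem Submodule.corner_apply_one_eq_zero_fin_three {V : Submodule F (Matrix (Fin 3) (Fin 3) F)}
    (hV : ∀ A ∈ V, IsNilpotent A)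
    (h1 : ∀ h : Fin 3 → F, h 0 = 0 → ∃ A ∈ V, ∀ i, A i 0 = h i) {r : Fin 3 → F} (hr : r 0 = 0)
    (hM : single 1 2 1 + vecMulVec (Pi.single 0 1) r ∈ V) : r 1 = 0 := by
  by_contra ha
  set M : Matrix (Fin 3) (Fin 3) F := single 1 2 1 + vecMulVec (Pi.single 0 1) r with hMdef
  set a := r 1 with hadef
  set b := r 2 with hbdef
  set k := b / a with hkdef
  have hk : k * a = b := by rw [hkdef]; field_simp
  clear_value k
  have hMe : M = !![0, a, b; 0, 0, 1; 0, 0, 0] := by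
    ext i j
    fin_cases i <;> fin_cases j <;>
      simp [hMdef, vecMulVec_apply, Matrix.add_apply, hr, hadef, hbdef]
  have htr : ∀ A ∈ V, A 0 0 + A 1 1 + A 2 2 = 0 := by
    intro A hA
    have := (Matrix.isNilpotent_trace_of_isNilpotent (hV A hA)).eq_zero
    rwa [trace_fin_three] at this
  have htrMul : ∀ A, (M * A).trace = a * A 1 0 + b * A 2 0 + A 2 1 := by
    intro A
    simp only [trace_fin_three, mul_apply, Fin.sum_univ_three]
    simp [hMe]
  have htrM : ∀ A ∈ V, a * A 1 0 + b * A 2 0 + A 2 1 = 0 := by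
    intro A hA
    have := trace_mul_eq_zero hV hM hA
    rwa [htrMul] at this
  have hsq : ∀ A ∈ V, a * A 2 0 + (a * (A * A) 1 0 + b * (A * A) 2 0 + (A * A) 2 1) = 0 := by
    intro A hA
    have := trace_sq_mul_add hV hM hA
    rw [htrMul, htrMul] at this
    have h2 : (M * A) 1 0 = A 2 0 ∧ (M * A) 2 0 = 0 ∧ (M * A) 2 1 = 0 := by
      simp only [mul_apply, Fin.sum_univ_three]
      simp [hMe]
    rw [h2.1, h2.2.1, h2.2.2] at this
    linear_combination this
  have hnorm : ∀ h : Fin 3 → F, h 0 = 0 → ∀ c : F, ∃ A ∈ V, (∀ i, A i 0 = h i) ∧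
      A 1 2 = 2 * k * A 1 1 - c := by
    intro h hh c
    obtain ⟨A, hA, hAh⟩ := h1 h hh
    refine ⟨A + (2 * k * A 1 1 - c - A 1 2) • M, V.add_mem hA (V.smul_mem _ hM), ?_, ?_⟩
    · intro i
      rw [← hAh i, hMe]
      fin_cases i <;> simp
    · simp [hMe]
  obtain ⟨A, hA, hAh, hA12⟩ := hnorm ![0, 1, 0] rfl (k ^ 2 * a)
  obtain ⟨B, hB, hBh, hB12⟩ := hnorm ![0, -k, 1] rfl 0
  have A0 : A 0 0 = 0 := by simp [hAh]
  have A1 : A 1 0 = 1 := by simp [hAh]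
  have A2 : A 2 0 = 0 := by simp [hAh]
  have B0 : B 0 0 = 0 := by simp [hBh]
  have B1 : B 1 0 = -k := by simp [hBh]
  have B2 : B 2 0 = 1 := by simp [hBh]
  have A22 : A 2 2 = - A 1 1 := by linear_combination htr A hA - A0
  have A21 : A 2 1 = - a := by linear_combination htrM A hA - a * A1 - b * A2
  have A11 : A 1 1 = b := by
    have := hsq A hA
    simp only [mul_apply, Fin.sum_univ_three, A0, A1, A2, A21, A22] at this
    exact mul_left_cancel₀ ha (by linear_combination this)
  have A3 := Matrix.pow_card_eq_zero_of_isNilpotent (hV A hA)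
  rw [Fintype.card_fin, pow_succ, pow_two] at A3
  have A01 : A 0 1 = 0 := by
    have := congrFun (congrFun A3 1) 0
    simp only [mul_apply, Fin.sum_univ_three, A0, A1, A2, A21, A22, hA12, A11, Matrix.zero_apply] at this
    linear_combination this + (b - k * a) * hk
  have A02 : A 0 2 = 0 := by
    have := congrFun (congrFun A3 0) 0
    simp only [mul_apply, Fin.sum_univ_three, A0, A1, A2, A21, A22, A01, Matrix.zero_apply] at this
    exact mul_left_cancel₀ ha (by linear_combination -this)
  have B22 : B 2 2 = - B 1 1 := by linear_combination htr B hB - B0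
  have B21 : B 2 1 = 0 := by linear_combination htrM B hB - a * B1 - b * B2 + hk
  have B01 : B 0 1 = 0 := by
    have := trace_mul_eq_zero hV hA hB
    simp only [trace_fin_three, mul_apply, Fin.sum_univ_three, A0, A1, A2, A21, A22, A01, A02,
      A11, hA12, hB12, B22, B21, B0, B1, B2] at this
    linear_combination this + 2 * B 1 1 * hk
  have := hsq B hB
  simp only [mul_apply, Fin.sum_univ_three, B22, B21, B0, B1, B2, B01, hB12] at this
  exact ha (by linear_combination this - B 1 1 * hk)

theorem Matrix.trace_single_add_vecMulVec_mul {ι : Type*} [Fintype ι] [DecidableEq ι]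
    (i j o : ι) (r : ι → F) (B : Matrix ι ι F) :
    ((single i j 1 + vecMulVec (Pi.single o 1) r) * B).trace = B j i + ∑ k, r k * B k o := by
  rw [add_mul, trace_add, vecMulVec_mul, trace_vecMulVec, single_one_dotProduct,
    trace_single_mul, one_smul]
  rfl

theorem Matrix.mul_single_add_vecMulVec_apply {ι : Type*} [Fintype ι] [DecidableEq ι]
    (a b o : ι) (s : ι → F) (A : Matrix ι ι F) (x y : ι) :
    (A * (single a b 1 + vecMulVec (Pi.single o 1) s) : Matrix ι ι F) x y =
      (if y = b then A x a else 0) + A x o * s y := by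
  rw [mul_add, Matrix.add_apply, mul_vecMulVec, mulVec_single_one, vecMulVec_apply]
  congr 1
  by_cases h : y = b
  · subst h; simp
  · simp [h]

theorem Matrix.single_add_vecMulVec_mul_apply {ι : Type*} [Fintype ι] [DecidableEq ι]
    {a b o : ι} (s : ι → F) (A : Matrix ι ι F) {x : ι} (y : ι) (hx : x ≠ o) :
    ((single a b 1 + vecMulVec (Pi.single o 1) s) * A : Matrix ι ι F) x y =
      if x = a then A b y else 0 := by
  rw [add_mul, Matrix.add_apply, vecMulVec_mul, vecMulVec_apply, Pi.single_eq_of_ne hx, zero_mul,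
    add_zero]
  by_cases h : x = a
  · subst h; simp
  · simp [h]

theorem Submodule.corner_anticomm {ι : Type*} [Fintype ι] [DecidableEq ι]
    {V : Submodule F (Matrix ι ι F)} (hV : ∀ A ∈ V, IsNilpotent A) {o i j a b : ι}
    {r s : ι → F} (hj : j ≠ o) (hb : b ≠ o) (hr : r o = 0) (hs : s o = 0)
    (hM : single i j 1 + vecMulVec (Pi.single o 1) r ∈ V)
    (hN : single a b 1 + vecMulVec (Pi.single o 1) s ∈ V) {A : Matrix ι ι F} (hA : A ∈ V) :
    (if i = b then A j a else 0) + A j o * s i + (if j = a then A b i else 0) + r a * A b o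
      = 0 := by
  have h := trace_mul_anticomm hV hM hA hN
  rw [trace_single_add_vecMulVec_mul, Matrix.add_apply, mul_single_add_vecMulVec_apply,
    single_add_vecMulVec_mul_apply _ _ _ hj] at h
  have h2 : ∀ k, r k * (A * (single a b 1 + vecMulVec (Pi.single o 1) s) +
      (single a b 1 + vecMulVec (Pi.single o 1) s) * A : Matrix ι ι F) k o =
      if k = a then r a * A b o else 0 := by
    intro k
    by_cases hk : k = o
    · subst hk
      rw [hr, zero_mul]
      split_ifs with h3
      · rw [← h3, hr, zero_mul]
      · rfl
    · rw [Matrix.add_apply, mul_single_add_vecMulVec_apply, single_add_vecMulVec_mul_apply _ _ _ hk,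
        if_neg hb.symm, hs]
      split_ifs with h3
      · rw [h3]; ring
      · ring
  simp only [h2, Finset.sum_ite_eq', Finset.mem_univ, if_true] at h
  linear_combination h

theorem Submodule.exists_mulVec_eq_zero_of_corner_vecMulVec {m : ℕ}
    {V : Submodule F (Matrix (Fin (m + 2)) (Fin (m + 2)) F)}
    (hV : ∀ A ∈ V, IsNilpotent A) (h0 : ∀ A ∈ V, A 0 0 = 0)
    (h1 : ∀ h : Fin (m + 2) → F, h 0 = 0 → ∃ A ∈ V, ∀ i, A i 0 = h i)
    (hW : ∀ i j : Fin (m + 2), 0 < i → i < j →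
      ∃ r : Fin (m + 2) → F, r 0 = 0 ∧ single i j 1 + vecMulVec (Pi.single 0 1) r ∈ V) :
    ∃ z ≠ 0, ∀ A ∈ V, A *ᵥ z = 0 := by
  have hW' : ∀ i j : Fin (m + 2), ∃ r : Fin (m + 2) → F, r 0 = 0 ∧ (0 < i → i < j →
      single i j 1 + vecMulVec (Pi.single 0 1) r ∈ V) := by
    intro i j
    by_cases h : 0 < i ∧ i < j
    · obtain ⟨r, hr, hr'⟩ := hW i j h.1 h.2
      exact ⟨r, hr, fun _ _ => hr'⟩
    · exact ⟨0, rfl, fun h1 h2 => absurd ⟨h1, h2⟩ h⟩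
  choose R hR0 hR using hW'
  have h01 : (0 : Fin (m + 2)) < 1 := by simp
  have hlt : ∀ j : Fin (m + 2), j ≠ 0 → j ≠ 1 → 1 < j := fun j hj hj' =>
    lt_of_le_of_ne (Fin.one_le_of_ne_zero hj) hj'.symm
  have hne0 : ∀ {j : Fin (m + 2)}, 1 < j → j ≠ 0 := fun h h' => by simp [h'] at h
  have htr : ∀ A ∈ V, ∀ i j, 0 < i → i < j → A j i + ∑ k, R i j k * A k 0 = 0 := by
    intro A hA i j hi hij
    rw [← trace_single_add_vecMulVec_mul]
    exact trace_mul_eq_zero hV (hR i j hi hij) hA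
  have hanti : ∀ A ∈ V, ∀ i j a b, 0 < i → i < j → 0 < a → a < b →
      (if i = b then A j a else 0) + A j 0 * R a b i + (if j = a then A b i else 0)
        + R i j a * A b 0 = 0 := fun A hA i j a b hi hij ha hab =>
    corner_anticomm hV (hi.trans hij).ne' (ha.trans hab).ne' (hR0 _ _) (hR0 _ _) (hR i j hi hij)
      (hR a b ha hab) hA
  have col : ∀ k, k ≠ 0 → ∃ A ∈ V, ∀ i, A i 0 = (Pi.single k 1 : Fin (m + 2) → F) i := by
    intro k hk
    exact h1 _ (by simp [hk.symm])
  -- the first row of the corner corrections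
  have hR1 : ∀ j, 1 < j → R 1 j 1 = 0 := by
    intro j hj
    by_cases hi : ∃ i, 1 < i ∧ i ≠ j
    · obtain ⟨i, hi, hij⟩ := hi
      obtain ⟨A, hA, hAi⟩ := col i (hne0 hi)
      have := hanti A hA 1 j 1 i h01 hj h01 hi
      rw [if_neg hi.ne, if_neg hj.ne', hAi, hAi, Pi.single_eq_same, Pi.single_eq_of_ne hij.symm]
        at this
      linear_combination this
    · push Not at hi
      have hjv : 1 < (j : ℕ) := hj
      have hm : m = 1 := by
        by_contra hm
        have h2 := hi ⟨2, by omega⟩ (by simp [Fin.lt_def])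
        have h3 := hi ⟨3, by omega⟩ (by simp [Fin.lt_def])
        simpa using h2.trans h3.symm
      subst hm
      obtain rfl : j = 2 := by
        have : ∀ j : Fin 3, 1 < j → j = 2 := by decide
        exact this j hj
      exact corner_apply_one_eq_zero_fin_three hV h1 (hR0 1 2) (hR 1 2 h01 hj)
  -- normalised matrices kill the second basis vector
  have hAe1 : ∀ A ∈ V, (∀ i, A i 0 = (Pi.single 1 1 : Fin (m + 2) → F) i) → ∀ i, A i 1 = 0 := by
    intro A hA hA1
    have hj1 : ∀ j, 1 < j → A j 1 = 0 := by
      intro j hj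
      have := htr A hA 1 j h01 hj
      simpa [hA1, Pi.single_apply, hR1 j hj] using this
    have hcol0 : A *ᵥ Pi.single 0 1 = Pi.single 1 1 := by
      rw [mulVec_single_one]; ext i; exact hA1 i
    have h3 : A *ᵥ (A *ᵥ Pi.single 0 1) =
        A 1 1 • (A *ᵥ Pi.single 0 1) + A 0 1 • (Pi.single 0 1 : Fin (m + 2) → F) := by
      rw [hcol0, mulVec_single_one]
      ext i
      by_cases hi0 : i = 0
      · subst hi0; simp
      by_cases hi1 : i = 1
      · subst hi1; simp
      simp [hj1 i (hlt i hi0 hi1), hi0, hi1]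
    have h4 := (hV A hA).mulVec_mulVec_eq_zero h3
    rw [hcol0, mulVec_single_one] at h4
    exact fun i => congrFun h4 i
  have hR1' : ∀ i j, 0 < i → i < j → R i j 1 = 0 := by
    intro i j hi hij
    obtain ⟨A, hA, hA1⟩ := col 1 h01.ne'
    have h3 := hAe1 A hA hA1 0
    have hj1 : (1 : Fin (m + 2)) < j := lt_of_le_of_lt (Fin.one_le_of_ne_zero hi.ne') hij
    have h4 := hAe1 _ (V.add_mem hA (hR i j hi hij)) (fun k => by
      simp [hA1, vecMulVec_apply, hR0, (hne0 hj1)]) 0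
    simpa [h3, vecMulVec_apply, hj1.ne', hi.ne'] using h4
  rcases Nat.eq_zero_or_pos m with rfl | hm
  · refine ⟨Pi.single 1 1, by simp, fun A hA => ?_⟩
    obtain ⟨D, hD, hD1⟩ := col 1 h01.ne'
    have hDi := hAe1 D hD hD1
    have h4 := hAe1 (A + (- A 1 0 + 1) • D) (V.add_mem hA (V.smul_mem _ hD)) (fun k => by
      fin_cases k
      · simp [h0 A hA, h0 D hD]
      · simp [hD1])
    rw [mulVec_single_one]
    ext i
    simpa [hDi] using h4 i
  set l : Fin (m + 2) := ⟨2, by omega⟩ with hldef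
  set w : Fin (m + 2) := Fin.last _
  have hl1 : 1 < l := by simp [Fin.lt_def, hldef]
  have hlt2 : ∀ j, j ≠ 0 → j ≠ 1 → j ≠ l → l < j := fun j hj hj' hj2 => by
    have h5 : 1 < (j : ℕ) := hlt j hj hj'
    have h6 : (j : ℕ) ≠ 2 := fun h => hj2 (Fin.ext h)
    rw [Fin.lt_def]
    simp only [hldef]
    omega
  set c := R 1 l l
  have hrel : ∀ A ∈ V, ∀ j a b, 1 < j → 1 < a → a < b →
      (if j = a then A b 1 else 0) + R 1 j a * A b 0 = 0 := by
    intro A hA j a b hj ha hab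
    have := hanti A hA 1 j a b h01 hj (h01.trans ha) hab
    rwa [if_neg (ha.trans hab).ne, hR1' a b (h01.trans ha) hab, mul_zero, zero_add, zero_add]
      at this
  have hoff : ∀ j a, 1 < j → 1 < a → a ≠ j → a ≠ w → R 1 j a = 0 := by
    intro j a hj ha haj haw
    have hab : a < w := lt_of_le_of_ne (Fin.le_last a) haw
    obtain ⟨A, hA, hA1⟩ := col w (hne0 (ha.trans hab))
    simpa [haj.symm, hA1] using hrel A hA j a w hj ha hab
  have hbig : ∀ b, l < b → R 1 b = Pi.single b c := by
    intro b hb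
    ext k
    by_cases hk0 : k = 0
    · rw [hk0, hR0, Pi.single_eq_of_ne (hne0 (hl1.trans hb)).symm]
    obtain ⟨A, hA, hA1⟩ := col k hk0
    have h5 := hrel A hA l l b hl1 hl1 hb
    have h6 := htr A hA 1 b h01 (hl1.trans hb)
    simp only [if_true, hA1, Pi.single_apply, mul_ite, mul_one, mul_zero, Finset.sum_ite_eq',
      Finset.mem_univ] at h5 h6
    rw [Pi.single_apply]
    simp only [eq_comm (a := k)]
    linear_combination h6 - h5
  have hz : ∀ b, R 1 b = Pi.single b c → 1 < b →
      vecMulVec (Pi.single 1 1 + c • Pi.single 0 1) (Pi.single b 1) ∈ V := by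
    intro b hb hb1
    have := hR 1 b h01 hb1
    rw [hb] at this
    convert this using 1
    rw [Matrix.single_eq_single_vecMulVec_single]
    ext x y
    simp only [vecMulVec_apply, Matrix.add_apply, Pi.add_apply, Pi.smul_apply, smul_eq_mul,
      Pi.single_apply]
    split_ifs <;> ring
  have hRl : ∀ k, k ≠ l → k ≠ w → R 1 l k = 0 := by
    intro k hkl hkw
    by_cases hk0 : k = 0
    · rw [hk0, hR0]
    by_cases hk1 : k = 1
    · rw [hk1, hR1' _ _ h01 hl1]
    · exact hoff l k hl1 (hlt k hk0 hk1) hkl hkw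
  by_cases hcase : w ≠ l ∧ R 1 l w ≠ 0
  · have hlw : l < w := lt_of_le_of_ne (Fin.le_last l) hcase.1.symm
    refine exists_mulVec_eq_zero_of_corner hV h01.ne (hne0 hl1) hl1.ne' (hne0 (hl1.trans hlw))
      (hl1.trans hlw).ne' hcase.1 (c := c) hcase.2 ?_ ?_ ?_
    · intro k hk
      obtain ⟨A, hA, hA1⟩ := col k hk
      exact ⟨A, hA, by rw [mulVec_single_one]; exact funext hA1⟩
    · intro j hj hj1 hjl
      exact hz j (hbig j (hlt2 j hj hj1 hjl)) (hlt j hj hj1)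
    · intro A hA
      have h6 := htr A hA 1 l h01 hl1
      rw [Finset.sum_eq_add_of_mem l w (Finset.mem_univ _) (Finset.mem_univ _) hcase.1.symm
        (fun k _ hk => by rw [hRl k hk.1 hk.2, zero_mul])] at h6
      rw [mulVec_add, mulVec_smul, mulVec_single_one, mulVec_single_one]
      simp only [Pi.add_apply, Pi.smul_apply, col_apply, smul_eq_mul]
      linear_combination h6
  · have hRl' : R 1 l = Pi.single l c := by
      ext k
      by_cases hkl : k = l
      · subst hkl; rw [Pi.single_eq_same]
      rw [Pi.single_eq_of_ne hkl]
      by_cases hkw : k = w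
      · subst hkw
        by_contra h
        exact hcase ⟨hkl, h⟩
      · exact hRl k hkl hkw
    refine ⟨Pi.single 1 1 + c • Pi.single 0 1, fun h => ?_, fun A hA =>
      mulVec_eq_zero_of_vecMulVec_mem hV (hne0 hl1) hl1.ne' h01.ne ?_ ?_ hA⟩
    · simpa using congrFun h 1
    · obtain ⟨A, hA, hA1⟩ := col l (hne0 hl1)
      exact ⟨A, hA, by simp [hA1]⟩
    · intro j hj hj1
      by_cases hjl : j = l
      · rw [hjl]; exact hz l hRl' hl1
      · exact hz j (hbig j (hlt2 j hj hj1 hjl)) (hlt j hj hj1)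

end

section

variable {F E : Type*} [Field F] [AddCommGroup E] [Module F E]

theorem IsNilpotent.apply_eq_zero_of_eq_smul {A : Module.End F E} (hA : IsNilpotent A) {v : E}
    {a : F} (h : A v = a • v) : A v = 0 := by
  obtain ⟨k, hk⟩ := hA
  have hp : ∀ k : ℕ, (A ^ k) v = a ^ k • v := by
    intro k
    induction k with
    | zero => simp
    | succ k ih =>
      rw [_root_.pow_succ, Module.End.mul_apply, h, map_smul, ih, smul_smul, _root_.pow_succ']
  have h1 := hp k
  rw [hk, LinearMap.zero_apply, eq_comm, smul_eq_zero] at h1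
  rw [h]
  rcases h1 with h1 | h1
  · rw [eq_zero_of_pow_eq_zero h1, zero_smul]
  · rw [h1, smul_zero]

/-- The endomorphisms of the quotient by `p` that are induced by members of `V`. -/
def Submodule.quotientEnd (V : Submodule F (Module.End F E)) (p : Submodule F E) :
    Submodule F (Module.End F (E ⧸ p)) where
  carrier := {C | ∃ A ∈ V, C ∘ₗ p.mkQ = p.mkQ ∘ₗ A}
  add_mem' := by
    rintro C D ⟨A, hA, hC⟩ ⟨B, hB, hD⟩
    exact ⟨A + B, V.add_mem hA hB, by rw [LinearMap.add_comp, hC, hD, LinearMap.comp_add]⟩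
  zero_mem' := ⟨0, V.zero_mem, by rw [LinearMap.zero_comp, LinearMap.comp_zero]⟩
  smul_mem' := by
    rintro c C ⟨A, hA, hC⟩
    exact ⟨c • A, V.smul_mem c hA, by rw [LinearMap.smul_comp, hC, LinearMap.comp_smul]⟩

theorem Submodule.isNilpotent_of_mem_quotientEnd {V : Submodule F (Module.End F E)}
    (hV : ∀ A ∈ V, IsNilpotent A) {p : Submodule F E} {C : Module.End F (E ⧸ p)}
    (hC : C ∈ V.quotientEnd p) : IsNilpotent C := by
  obtain ⟨A, hA, hCA⟩ := hC
  obtain ⟨k, hk⟩ := hV A hA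
  have hp : ∀ k : ℕ, (C ^ k) ∘ₗ p.mkQ = p.mkQ ∘ₗ (A ^ k) := by
    intro k
    induction k with
    | zero => rfl
    | succ k ih =>
      rw [pow_succ, pow_succ, Module.End.mul_eq_comp, Module.End.mul_eq_comp, LinearMap.comp_assoc,
        hCA, ← LinearMap.comp_assoc, ih, LinearMap.comp_assoc]
  refine ⟨k, p.linearMap_qext ?_⟩
  rw [hp k, hk, LinearMap.comp_zero, LinearMap.zero_comp]

theorem Submodule.mapQ_mem_quotientEnd {V : Submodule F (Module.End F E)} {p : Submodule F E}
    {A : Module.End F E} (hA : A ∈ V) (h : p ≤ p.comap A) : p.mapQ p A h ∈ V.quotientEnd p :=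
  ⟨A, hA, p.mapQ_mkQ p A⟩

theorem Submodule.finrank_le_finrank_quotientEnd_add [FiniteDimensional F E]
    {V : Submodule F (Module.End F E)}
    {p : Submodule F E} (h : ∀ A ∈ V, p ≤ p.comap A) {K : Submodule F (Module.End F E)}
    (hK : ∀ A ∈ V, (∀ y, A y ∈ p) → A ∈ K) :
    Module.finrank F V ≤ Module.finrank F (V.quotientEnd p) + Module.finrank F K := by
  set T : V →ₗ[F] (E →ₗ[F] E ⧸ p) := (LinearMap.compRight F p.mkQ).domRestrict V with hT
  rw [← LinearMap.finrank_range_add_finrank_ker T]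
  refine add_le_add ?_ ?_
  · refine le_trans ?_ (Submodule.finrank_map_le (LinearMap.lcomp F (E ⧸ p) p.mkQ)
      (V.quotientEnd p))
    apply Submodule.finrank_mono
    rintro _ ⟨A, rfl⟩
    exact ⟨_, mapQ_mem_quotientEnd A.2 (h A A.2), p.mapQ_mkQ p _ (h := h A A.2)⟩
  · rw [← Submodule.finrank_map_subtype_eq]
    apply Submodule.finrank_mono
    rintro _ ⟨A, hA, rfl⟩
    refine hK A A.2 fun y => ?_
    have := LinearMap.congr_fun (LinearMap.mem_ker.mp hA) y
    simpa [hT] using this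

variable [FiniteDimensional F E]

theorem Module.End.apply_pow_apply_eq_zero_of_isNilpotent {B : Module.End F E} {x : E}
    {φ : Module.Dual F E} (hB : IsNilpotent B) (hBx : IsNilpotent (B + φ.smulRight x)) (k : ℕ) :
    φ ((B ^ k) x) = 0 := by
  let b := Module.finBasis F E
  have h1 := (hB.map (LinearMap.toMatrixAlgEquiv b))
  have h2 := (hBx.map (LinearMap.toMatrixAlgEquiv b))
  have h3 : LinearMap.toMatrixAlgEquiv b (φ.smulRight x) =
    Matrix.vecMulVec (b.repr x) (φ ∘ b) := LinearMap.toMatrix_smulRight b b φ x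
  rw [map_add, h3] at h2
  have h4 := Matrix.dotProduct_pow_mulVec_eq_zero_of_isNilpotent h1 h2 k
  have h5 : (LinearMap.toMatrixAlgEquiv b (B ^ k)).mulVec (b.repr x) = b.repr ((B ^ k) x) :=
    LinearMap.toMatrix_mulVec_repr b b _ _
  rw [← map_pow, h5] at h4
  rw [← b.sum_repr ((B ^ k) x), map_sum, ← h4]
  simp [dotProduct, mul_comm]

theorem Submodule.exists_forall_smulRight_mem_imp_eq_zero [Nontrivial E]
    {V : Submodule F (Module.End F E)} (hV : ∀ A ∈ V, IsNilpotent A) :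
    ∃ x ≠ 0, ∀ φ : Module.Dual F E, φ.smulRight x ∈ V → φ = 0 := by
  classical
  have hex : ∃ d, ∀ A ∈ V, A ^ d = 0 := by
    let b := Module.finBasis F E
    refine ⟨Fintype.card (Fin (Module.finrank F E)), fun A hA =>
      (LinearMap.toMatrixAlgEquiv b).injective ?_⟩
    rw [map_pow, Matrix.pow_card_eq_zero_of_isNilpotent ((hV A hA).map _), map_zero]
  obtain ⟨d, hd, hmin⟩ : ∃ d, (∀ A ∈ V, A ^ d = 0) ∧ ∀ e < d, ¬ ∀ A ∈ V, A ^ e = 0 :=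
    ⟨Nat.find hex, Nat.find_spec hex, fun e he => Nat.find_min hex he⟩
  rcases d with _ | e
  · exact absurd (hd 0 V.zero_mem) (by simp)
  have h1 := hmin e (Nat.lt_succ_self e)
  push Not at h1
  obtain ⟨B, hB, hBe⟩ := h1
  obtain ⟨x, hx⟩ : ∃ x, (B ^ e) x ≠ 0 := by
    by_contra! h
    exact hBe (LinearMap.ext h)
  refine ⟨x, fun h => hx (by rw [h, map_zero]), fun φ hφ => ?_⟩
  have hφB : ∀ k, φ ((B ^ k) x) = 0 :=
    Module.End.apply_pow_apply_eq_zero_of_isNilpotent (hV B hB) (hV _ (V.add_mem hB hφ))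
  have hpow : ∀ k y, ((B + φ.smulRight x) ^ k) y =
      (B ^ k) y + ∑ i ∈ Finset.range k, φ ((B ^ (k - 1 - i)) y) • (B ^ i) x := by
    intro k y
    induction k with
    | zero => simp
    | succ k ih =>
      rw [pow_succ', Module.End.mul_apply, ih, Finset.sum_range_succ', LinearMap.add_apply,
        map_add, map_add, map_sum, map_sum, LinearMap.smulRight_apply]
      simp only [map_smul, LinearMap.smulRight_apply, hφB, zero_smul, smul_zero,
        Finset.sum_const_zero, add_zero]
      rw [pow_succ' B, Module.End.mul_apply]
      simp only [pow_zero, Module.End.one_apply, Nat.add_sub_cancel, Nat.sub_zero, add_assoc]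
      congr 2
      refine Finset.sum_congr rfl fun i hi => ?_
      rw [pow_succ' B i, Module.End.mul_apply, Nat.sub_sub, add_comm 1 i]
  have hzero : ∀ n m, m + n = e + 1 → ∀ y, φ ((B ^ m) y) = 0 := by
    intro n
    induction n with
    | zero =>
      intro m hm y
      rw [show m = e + 1 from hm, hd B hB, LinearMap.zero_apply, map_zero]
    | succ n ih =>
      intro m hm y
      have h2 : ∀ k, m < k → φ ((B ^ k) y) = 0 := by
        intro k hk
        rw [show k = (m + 1) + (k - (m + 1)) by omega, pow_add, Module.End.mul_apply]
        exact ih (m + 1) (by omega) _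
      have h3 := congrArg (B ^ m) (hpow (e + 1) y)
      rw [hd _ (V.add_mem hB hφ), hd B hB, LinearMap.zero_apply, zero_add, map_zero, map_sum,
        Finset.sum_eq_single (e - m)] at h3
      · rw [show e + 1 - 1 - (e - m) = m by omega, map_smul, ← Module.End.mul_apply, ← pow_add,
          show m + (e - m) = e by omega, eq_comm, smul_eq_zero] at h3
        exact h3.resolve_right hx
      · intro i hi hie
        rw [Finset.mem_range] at hi
        rcases lt_or_gt_of_ne hie with h4 | h4
        · rw [h2 _ (by omega), zero_smul, map_zero]
        · rw [map_smul, ← Module.End.mul_apply, ← pow_add,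
            show m + i = (e + 1) + (m + i - (e + 1)) by omega, pow_add, hd B hB, zero_mul,
            LinearMap.zero_apply, smul_zero]
      · intro h
        exact absurd (Finset.mem_range.mpr (by omega)) h
  ext y
  simpa using hzero (e + 1) 0 (zero_add _) y

end

section

open Module

variable {F E : Type*} [Field F] [AddCommGroup E] [Module F E]

theorem Module.Basis.exists_lift_of_isCompl_span_singleton {k : ℕ} {x : E} (hx : x ≠ 0)
    {H : Submodule F E} (hc : IsCompl (Submodule.span F {x}) H)
    (b' : Basis (Fin k) F (E ⧸ Submodule.span F {x})) :
    ∃ b : Basis (Fin (k + 1)) F E, b 0 = x ∧ (∀ i : Fin k, b i.succ ∈ H) ∧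
      ∀ i, (Submodule.span F {x}).mkQ (b i.succ) = b' i := by
  refine ⟨Basis.mkFinCons x (b'.map (Submodule.quotientEquivOfIsCompl _ H hc)) ?_ ?_, ?_, ?_, ?_⟩
  · intro c y hy hcy
    have h1 : c • x ∈ Submodule.span F {x} ⊓ H :=
      ⟨Submodule.smul_mem _ _ (Submodule.mem_span_singleton_self x), by
        rw [eq_neg_of_add_eq_zero_left hcy]; exact H.neg_mem hy⟩
    rw [hc.inf_eq_bot, Submodule.mem_bot, smul_eq_zero] at h1
    exact h1.resolve_right hx
  · intro z
    obtain ⟨y, hy, w, hw, rfl⟩ := Submodule.mem_sup.mp (hc.sup_eq_top ▸ Submodule.mem_top (x := z))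
    obtain ⟨c, rfl⟩ := Submodule.mem_span_singleton.mp hy
    exact ⟨-c, by simpa [add_right_comm] using hw⟩
  · simp
  · intro i; simp
  · intro i
    simp

theorem Module.Basis.repr_succ_eq_of_mkQ {k : ℕ} {p : Submodule F E}
    {b : Basis (Fin (k + 1)) F E} {b' : Basis (Fin k) F (E ⧸ p)} (h0 : b 0 ∈ p)
    (h : ∀ i, p.mkQ (b i.succ) = b' i) (y : E) (i : Fin k) :
    b.repr y i.succ = b'.repr (p.mkQ y) i := by
  have : b.coord i.succ = b'.coord i ∘ₗ p.mkQ := by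
    refine b.ext fun j => ?_
    rw [LinearMap.comp_apply]
    refine Fin.cases ?_ (fun j => ?_) j
    · have : p.mkQ (b 0) = 0 := by simpa using h0
      rw [this]
      simp [Basis.coord_apply]
    · rw [h]
      simp [Basis.coord_apply, Finsupp.single_apply]
  exact LinearMap.congr_fun this y

theorem Submodule.finrank_eq_finrank_map_add_finrank_inf_ker {E' : Type*} [AddCommGroup E']
    [Module F E'] (f : E →ₗ[F] E') (V : Submodule F E) [FiniteDimensional F V] :
    finrank F V = finrank F (V.map f) + finrank F (V ⊓ LinearMap.ker f : Submodule F E) := by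
  rw [← LinearMap.finrank_range_add_finrank_ker (f.domRestrict V), LinearMap.range_domRestrict,
    LinearMap.ker_domRestrict, ← Submodule.finrank_map_subtype_eq]
  rw [Submodule.map_comap_subtype]

theorem Submodule.disjoint_map_applyₗ_span_singleton {V : Submodule F (End F E)}
    (hV : ∀ A ∈ V, IsNilpotent A) (x : E) :
    Disjoint (span F {x}) (V.map (LinearMap.applyₗ x)) := by
  rw [Submodule.disjoint_def]
  rintro _ hy ⟨A, hA, rfl⟩
  obtain ⟨c, hc⟩ := Submodule.mem_span_singleton.mp hy
  exact (hV A hA).apply_eq_zero_of_eq_smul hc.symm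

theorem Submodule.span_singleton_le_comap {A : End F E} {x : E} (h : A x = 0) :
    span F {x} ≤ (span F {x}).comap A := by
  rw [span_singleton_le_iff_mem, mem_comap, h]
  exact zero_mem _

variable [FiniteDimensional F E]

theorem Submodule.finrank_quotient_span_singleton {x : E} (hx : x ≠ 0) {n : ℕ}
    (hn : finrank F E = n + 1) : finrank F (E ⧸ span F {x}) = n := by
  have := Submodule.finrank_quotient_add_finrank (span F {x})
  rw [finrank_span_singleton hx] at this
  omega

theorem Submodule.finrank_map_applyₗ_add_one_le {V : Submodule F (End F E)}
    (hV : ∀ A ∈ V, IsNilpotent A) {x : E} (hx : x ≠ 0) :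
    finrank F (V.map (LinearMap.applyₗ x)) + 1 ≤ finrank F E := by
  have := Submodule.finrank_add_finrank_le_of_disjoint (disjoint_map_applyₗ_span_singleton hV x)
  rw [finrank_span_singleton hx] at this
  omega

theorem Submodule.finrank_inf_ker_applyₗ_le {V : Submodule F (End F E)} {x : E} (hx : x ≠ 0)
    (hφ : ∀ φ : Dual F E, φ.smulRight x ∈ V → φ = 0) :
    finrank F (V ⊓ LinearMap.ker (LinearMap.applyₗ x) : Submodule F (End F E)) ≤
      finrank F ((V ⊓ LinearMap.ker (LinearMap.applyₗ x)).quotientEnd (span F {x})) := by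
  refine (finrank_le_finrank_quotientEnd_add
    (V := V ⊓ LinearMap.ker (LinearMap.applyₗ x)) (p := span F {x}) (K := ⊥)
    (fun A hA => span_singleton_le_comap hA.2) (fun A hA hAy => ?_)).trans ?_
  · obtain ⟨δ, hδ⟩ := Module.Projective.exists_dual_eq_one F hx
    have h1 : A = (δ ∘ₗ A).smulRight x := by
      ext y
      obtain ⟨c, hc⟩ := mem_span_singleton.mp (hAy y)
      simp [← hc, hδ]
    have h2 := hφ (δ ∘ₗ A) (h1 ▸ hA.1)
    rw [h2] at h1
    rw [h1]
    simp
  · simp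

theorem Submodule.finrank_le_choose_two_of_isNilpotent {V : Submodule F (End F E)}
    (hV : ∀ A ∈ V, IsNilpotent A) : finrank F V ≤ (finrank F E).choose 2 := by
  induction hn : finrank F E generalizing E with
  | zero =>
    have : Subsingleton E := finrank_zero_iff.mp hn
    rw [finrank_zero_of_subsingleton]
    exact Nat.zero_le _
  | succ n ih =>
    have : Nontrivial E := nontrivial_of_finrank_pos (R := F) (by omega)
    obtain ⟨x, hx, hφ⟩ := exists_forall_smulRight_mem_imp_eq_zero hV
    have h1 := finrank_map_applyₗ_add_one_le hV hx
    have h2 := finrank_inf_ker_applyₗ_le hx hφ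
    have h3 := ih (V := (V ⊓ LinearMap.ker (LinearMap.applyₗ x)).quotientEnd (span F {x}))
      (fun C hC => isNilpotent_of_mem_quotientEnd
        (fun A (hA : A ∈ V ⊓ LinearMap.ker (LinearMap.applyₗ x)) => hV A hA.1) hC)
      (finrank_quotient_span_singleton hx hn)
    have h4 : finrank F V = finrank F (V.map (LinearMap.applyₗ x)) +
        finrank F (V ⊓ LinearMap.ker (LinearMap.applyₗ x) : Submodule F (End F E)) :=
      finrank_eq_finrank_map_add_finrank_inf_ker (LinearMap.applyₗ x) V
    rw [h4, Nat.choose_succ_succ' n 1, Nat.choose_one_right, one_add_one_eq_two]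
    omega

theorem Submodule.finrank_le_finrank_quotientEnd_span_singleton_add
    {V : Submodule F (End F E)} {z : E} (hz : z ≠ 0) (hVz : ∀ A ∈ V, A z = 0) :
    finrank F V ≤ finrank F (V.quotientEnd (span F {z})) + finrank F (E ⧸ span F {z}) := by
  refine (finrank_le_finrank_quotientEnd_add (p := span F {z})
    (K := LinearMap.range ((LinearMap.smulRightₗ (R := F) (M := E) (M₂ := E)).flip z ∘ₗ
      LinearMap.lcomp F F (span F {z}).mkQ))
    (fun A hA => span_singleton_le_comap (hVz A hA)) (fun A hA hAy => ?_)).trans ?_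
  · obtain ⟨δ, hδ⟩ := Module.Projective.exists_dual_eq_one F hz
    refine ⟨δ ∘ₗ (span F {z}).liftQ A (by
      rw [span_singleton_le_iff_mem]; exact hVz A hA), ?_⟩
    ext y
    obtain ⟨c, hc⟩ := mem_span_singleton.mp (hAy y)
    simp [← hc, hδ]
  · gcongr
    exact (LinearMap.finrank_range_le _).trans (Subspace.dual_finrank_eq).le

end

section

open Module

theorem Matrix.isNilpotent_of_forall_le_apply_eq_zero {F : Type*} [Field F] {n : ℕ}
    {A : Matrix (Fin n) (Fin n) F} (h : ∀ i j, j ≤ i → A i j = 0) : IsNilpotent A := by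
  have h1 : A.IsUpperTriangular := fun i j hij => h i j (le_of_lt hij)
  have h2 := A.aeval_self_charpoly
  rw [Matrix.charpoly_of_isUpperTriangular A h1] at h2
  exact ⟨n, by simpa [h] using h2⟩

/-- The strictly upper triangular matrices. -/
def Matrix.strictUpperTriangular (F : Type*) [Field F] (n : ℕ) :
    Submodule F (Matrix (Fin n) (Fin n) F) where
  carrier := {A | ∀ i j, j ≤ i → A i j = 0}
  add_mem' hA hB i j hij := by rw [Matrix.add_apply, hA i j hij, hB i j hij, add_zero]
  zero_mem' _ _ _ := rfl
  smul_mem' c A hA i j hij := by rw [Matrix.smul_apply, hA i j hij, smul_zero]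

theorem Submodule.mem_of_toMatrix_mem_strictUpperTriangular {F E : Type*} [Field F]
    [AddCommGroup E] [Module F E] {n : ℕ} (b : Basis (Fin n) F E) {V : Submodule F (End F E)}
    (hV : ∀ A ∈ V, ∀ i j, j ≤ i → b.repr (A (b j)) i = 0) (hdim : n.choose 2 ≤ finrank F V)
    {A : End F E} (hA : ∀ i j, j ≤ i → b.repr (A (b j)) i = 0) : A ∈ V := by
  have := Module.Finite.of_basis b
  let e := LinearMap.toMatrixAlgEquiv b
  have hmem : ∀ A, A ∈ (Matrix.strictUpperTriangular F n).comap e.toLinearMap ↔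
      ∀ i j, j ≤ i → b.repr (A (b j)) i = 0 := by
    intro A
    refine forall_congr' fun i => forall_congr' fun j => forall_congr' fun _ => ?_
    rw [← LinearMap.toMatrixAlgEquiv_apply b A i j]
    rfl
  have hle : V ≤ (Matrix.strictUpperTriangular F n).comap e.toLinearMap :=
    fun A hA => (hmem A).mpr (hV A hA)
  have hb := finrank_le_choose_two_of_isNilpotent
    (V := (Matrix.strictUpperTriangular F n).comap e.toLinearMap) (fun A hA =>
      (IsNilpotent.map_iff e.injective).mp (Matrix.isNilpotent_of_forall_le_apply_eq_zero hA))
  rw [finrank_eq_card_basis b, Fintype.card_fin] at hb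
  rw [Submodule.eq_of_le_of_finrank_le hle (hb.trans hdim), hmem]
  exact hA

variable {F : Type*} [Field F]

theorem Submodule.exists_forall_apply_eq_zero_of_basis {E : Type*} [AddCommGroup E] [Module F E]
    {m : ℕ} {V : Submodule F (End F E)} (hV : ∀ A ∈ V, IsNilpotent A)
    {b : Basis (Fin (m + 2)) F E} {b' : Basis (Fin (m + 1)) F (E ⧸ span F {b 0})}
    (hb : ∀ i, (span F {b 0}).mkQ (b i.succ) = b' i)
    (h0 : ∀ A ∈ V, b.repr (A (b 0)) 0 = 0)
    (h1 : ∀ y, b.repr y 0 = 0 → ∃ A ∈ V, A (b 0) = y)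
    (hW : ∀ C : End F (E ⧸ span F {b 0}), (∀ i j, j ≤ i → b'.repr (C (b' j)) i = 0) →
      C ∈ (V ⊓ LinearMap.ker (LinearMap.applyₗ (b 0))).quotientEnd (span F {b 0})) :
    ∃ z ≠ 0, ∀ A ∈ V, A z = 0 := by
  let e := LinearMap.toMatrixAlgEquiv b
  have hb0 : b 0 ∈ span F {b 0} := mem_span_singleton_self _
  have he : ∀ A i j, e A i j = b.repr (A (b j)) i := LinearMap.toMatrixAlgEquiv_apply b
  obtain ⟨z, hz, hz0⟩ : ∃ z ≠ 0, ∀ A ∈ V.map e.toLinearMap, A.mulVec z = 0 := by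
    refine exists_mulVec_eq_zero_of_corner_vecMulVec ?_ ?_ ?_ ?_
    · rintro _ ⟨A, hA, rfl⟩
      exact (hV A hA).map e
    · rintro _ ⟨A, hA, rfl⟩
      exact (he A 0 0).trans (h0 A hA)
    · intro h hh
      have h2 : ∀ i, b.repr (b.equivFun.symm h) i = h i :=
        fun i => congrFun (b.equivFun.apply_symm_apply h) i
      obtain ⟨A, hA, hAh⟩ := h1 (b.equivFun.symm h) (by rw [h2, hh])
      exact ⟨_, mem_map_of_mem hA, fun i => (he A i 0).trans (by rw [hAh, h2])⟩
    · intro i j hi hij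
      obtain ⟨i, rfl⟩ := Fin.exists_succ_eq.mpr hi.ne'
      obtain ⟨j, rfl⟩ := Fin.exists_succ_eq.mpr (hi.trans hij).ne'
      rw [Fin.succ_lt_succ_iff] at hij
      have hC : ∀ k l, b'.repr (Matrix.toLin b' b' (Matrix.single i j 1) (b' l)) k =
          Matrix.single i j (1 : F) k l := by
        intro k l
        rw [← LinearMap.toMatrix_apply, LinearMap.toMatrix_toLin]
      obtain ⟨A, hA, hCA⟩ := hW (Matrix.toLin b' b' (Matrix.single i j 1)) (by
        intro k l hlk
        rw [hC]
        apply Matrix.single_apply_of_ne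
        rintro ⟨rfl, rfl⟩
        exact absurd hlk (not_le.mpr hij))
      have hA0 : A (b 0) = 0 := hA.2
      refine ⟨fun k => e A 0 k, by simp [he, hA0], ?_⟩
      convert mem_map_of_mem (f := e.toLinearMap) hA.1
      ext k l
      change _ = e A k l
      rw [Matrix.add_apply, Matrix.vecMulVec_apply]
      refine Fin.cases ?_ (fun k => ?_) k
      · simp
      · rw [he A k.succ l, Basis.repr_succ_eq_of_mkQ hb0 hb, ← LinearMap.comp_apply, ← hCA,
          LinearMap.comp_apply]
        refine Fin.cases ?_ (fun l => ?_) l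
        · have : (span F {b 0}).mkQ (b 0) = 0 := by simp
          rw [this, LinearMap.map_zero, LinearEquiv.map_zero]
          simp
        · rw [hb, hC]
          simp [Matrix.single_apply]
  refine ⟨b.equivFun.symm z, b.equivFun.symm.map_ne_zero_iff.mpr hz, fun A hA => ?_⟩
  have h2 := hz0 _ (mem_map_of_mem hA)
  have h3 : (e A).mulVec (b.repr (b.equivFun.symm z)) = b.repr (A (b.equivFun.symm z)) :=
    LinearMap.toMatrix_mulVec_repr b b _ _
  have h4 : ⇑(b.repr (b.equivFun.symm z)) = z := b.equivFun.apply_symm_apply z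
  rw [h4] at h3
  apply b.repr.injective
  ext i
  rw [← h3, map_zero]
  exact congrFun h2 i

theorem Submodule.exists_basis_repr_eq_zero {E : Type*} [AddCommGroup E]
    [Module F E] [FiniteDimensional F E] {n : ℕ} (hn : finrank F E = n)
    {V : Submodule F (End F E)} (hV : ∀ A ∈ V, IsNilpotent A)
    (hdim : n.choose 2 ≤ finrank F V) :
    ∃ b : Basis (Fin n) F E, ∀ A ∈ V, ∀ i j, j ≤ i → b.repr (A (b j)) i = 0 := by
  induction n generalizing E with
  | zero => exact ⟨finBasisOfFinrankEq F E hn, fun A hA i => i.elim0⟩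
  | succ n ih =>
  rcases n with _ | m
  · let b := finBasisOfFinrankEq F E hn
    refine ⟨b, fun A hA i j _ => ?_⟩
    have h1 : A (b j) = b.repr (A (b j)) j • b j := by
      conv_lhs => rw [← b.sum_repr (A (b j))]
      rw [Fin.sum_univ_one, Fin.fin_one_eq_zero j]
    rw [(hV A hA).apply_eq_zero_of_eq_smul h1, map_zero, Finsupp.zero_apply]
  obtain ⟨z, hz, hVz⟩ : ∃ z ≠ 0, ∀ A ∈ V, A z = 0 := by
    have : Nontrivial E := nontrivial_of_finrank_pos (R := F) (by omega)
    obtain ⟨x, hx, hφ⟩ := exists_forall_smulRight_mem_imp_eq_zero hV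
    have hq := finrank_quotient_span_singleton hx hn
    have h1 := finrank_map_applyₗ_add_one_le hV hx
    have h2 := finrank_inf_ker_applyₗ_le hx hφ
    have hW : ∀ C ∈ (V ⊓ LinearMap.ker (LinearMap.applyₗ x)).quotientEnd (span F {x}),
        IsNilpotent C := fun C hC => isNilpotent_of_mem_quotientEnd
        (fun A (hA : A ∈ V ⊓ LinearMap.ker (LinearMap.applyₗ x)) => hV A hA.1) hC
    have h3 := finrank_le_choose_two_of_isNilpotent hW
    have h4 : finrank F V = finrank F (V.map (LinearMap.applyₗ x)) +
        finrank F (V ⊓ LinearMap.ker (LinearMap.applyₗ x) : Submodule F (End F E)) :=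
      finrank_eq_finrank_map_add_finrank_inf_ker (LinearMap.applyₗ x) V
    rw [h4, Nat.choose_succ_succ' (m + 1) 1, Nat.choose_one_right, one_add_one_eq_two] at hdim
    rw [hq] at h3
    obtain ⟨b', hb'⟩ := ih hq hW (by omega)
    have hcompl : IsCompl (span F {x}) (V.map (LinearMap.applyₗ x)) := by
      refine ⟨disjoint_map_applyₗ_span_singleton hV x, ?_⟩
      rw [codisjoint_iff]
      apply eq_top_of_finrank_eq
      have h5 := finrank_sup_add_finrank_inf_eq (span F {x}) (V.map (LinearMap.applyₗ x))
      rw [(disjoint_map_applyₗ_span_singleton hV x).eq_bot, finrank_bot,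
        finrank_span_singleton hx] at h5
      omega
    obtain ⟨b, rfl, hbH, hbq⟩ := Basis.exists_lift_of_isCompl_span_singleton hx hcompl b'
    have hmap : ∀ y, b.repr y 0 = 0 ↔ y ∈ V.map (LinearMap.applyₗ (b 0)) := by
      intro y
      have h6 : ∑ i : Fin (m + 1), b.repr y i.succ • b i.succ ∈ V.map (LinearMap.applyₗ (b 0)) :=
        sum_mem fun i _ => Submodule.smul_mem _ _ (hbH i)
      have h7 : b.repr y 0 • b 0 + ∑ i : Fin (m + 1), b.repr y i.succ • b i.succ = y := by
        rw [← Fin.sum_univ_succ (fun i => b.repr y i • b i), b.sum_repr]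
      constructor
      · intro h
        rw [h, zero_smul, zero_add] at h7
        rwa [h7] at h6
      · intro h
        rw [← h7, Submodule.add_mem_iff_left _ h6] at h
        have h8 := disjoint_def.mp hcompl.disjoint _
          (smul_mem _ _ (mem_span_singleton_self (b 0))) h
        exact (smul_eq_zero.mp h8).resolve_right hx
    exact exists_forall_apply_eq_zero_of_basis hV hbq
      (fun A hA => (hmap _).mpr (mem_map_of_mem hA))
      (fun y hy => (hmap y).mp hy)
      (fun C hC => mem_of_toMatrix_mem_strictUpperTriangular b' hb' (by omega) hC)
  have hq := finrank_quotient_span_singleton hz hn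
  have h1 := finrank_le_finrank_quotientEnd_span_singleton_add hz hVz
  rw [Nat.choose_succ_succ' (m + 1) 1, Nat.choose_one_right, one_add_one_eq_two] at hdim
  obtain ⟨b', hb'⟩ := ih hq (fun C hC => isNilpotent_of_mem_quotientEnd hV hC) (by omega)
  obtain ⟨H, hH⟩ := exists_isCompl (span F {z})
  obtain ⟨b, rfl, -, hbq⟩ := Basis.exists_lift_of_isCompl_span_singleton hz hH b'
  refine ⟨b, fun A hA i j => ?_⟩
  refine Fin.cases ?_ (fun j => ?_) j
  · intro _
    rw [hVz A hA, map_zero, Finsupp.zero_apply]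
  · refine Fin.cases (fun h => absurd h (by simp)) (fun i => ?_) i
    intro hij
    have h2 := hb' _ (mapQ_mem_quotientEnd hA (span_singleton_le_comap (hVz A hA))) i j
      (Fin.succ_le_succ_iff.mp hij)
    rw [← hbq, ← LinearMap.comp_apply, mapQ_mkQ, LinearMap.comp_apply] at h2
    rwa [Basis.repr_succ_eq_of_mkQ (mem_span_singleton_self _) hbq]

end

theorem stmt_6 (F : Type*) [Field F] (n : ℕ) (hn : 0 < n)
    (V : Submodule F (Matrix (Fin n) (Fin n) F))
    (hnil : ∀ A ∈ V, IsNilpotent A)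
    (hdim : Module.finrank F V = n.choose 2) :
    ∃ g : GL (Fin n) F,
      (fun A : Matrix (Fin n) (Fin n) F => (g : Matrix (Fin n) (Fin n) F) * A * ((g⁻¹ : GL (Fin n) F) : Matrix (Fin n) (Fin n) F)) '' (V : Set (Matrix (Fin n) (Fin n) F)) =
        {A : Matrix (Fin n) (Fin n) F | ∀ i j : Fin n, j ≤ i → A i j = 0} := by
  let e := Matrix.toLinAlgEquiv' (R := F) (n := Fin n)
  have hV : ∀ A ∈ V.map e.toLinearMap, IsNilpotent A := by
    rintro _ ⟨A, hA, rfl⟩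
    exact (hnil A hA).map e
  have hV' : n.choose 2 ≤ Module.finrank F (V.map e.toLinearMap) :=
    (hdim.symm.trans (e.toLinearEquiv.finrank_map_eq V).symm).le
  obtain ⟨b, hb⟩ := Submodule.exists_basis_repr_eq_zero (Module.finrank_fin_fun F) hV hV'
  let c := Pi.basisFun F (Fin n)
  let g : GL (Fin n) F := ⟨b.toMatrix c, c.toMatrix b, b.toMatrix_mul_toMatrix_flip c,
    c.toMatrix_mul_toMatrix_flip b⟩
  have hg : ∀ A, (g : Matrix (Fin n) (Fin n) F) * A *
      ((g⁻¹ : GL (Fin n) F) : Matrix (Fin n) (Fin n) F) = LinearMap.toMatrix b b (e A) := by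
    intro A
    change b.toMatrix c * A * c.toMatrix b = _
    rw [← basis_toMatrix_mul_linearMap_toMatrix_mul_basis_toMatrix b c b c (e A)]
    congr
    exact (LinearMap.toMatrix'_toLin' A).symm
  refine ⟨g, Set.Subset.antisymm ?_ fun U hU => ?_⟩
  · rintro _ ⟨A, hA, rfl⟩ i j hij
    change (_ : Matrix (Fin n) (Fin n) F) i j = 0
    rw [hg, LinearMap.toMatrix_apply]
    exact hb _ (Submodule.mem_map_of_mem hA) i j hij
  · obtain ⟨A, hA, hAU⟩ := Submodule.mem_of_toMatrix_mem_strictUpperTriangular b hb hV'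
      (A := Matrix.toLin b b U) fun i j hij => by
        rw [← LinearMap.toMatrix_apply, LinearMap.toMatrix_toLin, hU i j hij]
    refine ⟨A, hA, (hg A).trans ?_⟩
    change LinearMap.toMatrix b b (e.toLinearMap A) = U
    rw [hAU, LinearMap.toMatrix_toLin]
end

section
/- Let 𝔤 be a finite-dimensional semisimple Lie algebra over ℂ, and let V be a ℂ-linear subspace of 𝔤 such that for every x ∈ V the adjoint endomorphism ad(x) : 𝔤 → 𝔤 is nilpotent. Then 2 * dim_ℂ V ≤ dim_ℂ 𝔤 − rank 𝔤. -/
open Module LieAlgebra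

section EigenSum

variable {K L : Type*} [Field K] [LieRing L] [LieAlgebra K L]

/-- The sum of the generalized eigenspaces of `ad x` with eigenvalue in a set `S`. -/
def adEigenSum (x : L) (S : Set K) : Submodule K L :=
  ⨆ μ ∈ S, (ad K L x).maxGenEigenspace μ

lemma maxGenEigenspace_le_adEigenSum (x : L) {S : Set K} {μ : K} (hμ : μ ∈ S) :
    (ad K L x).maxGenEigenspace μ ≤ adEigenSum x S :=
  le_iSup₂_of_le μ hμ le_rfl

lemma adEigenSum_induction {x : L} {S : Set K} {p : L → Prop}
    (mem : ∀ μ ∈ S, ∀ y ∈ (ad K L x).maxGenEigenspace μ, p y)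
    (zero : p 0) (add : ∀ y z, p y → p z → p (y + z))
    {y : L} (hy : y ∈ adEigenSum x S) : p y := by
  unfold adEigenSum at hy
  rw [iSup_subtype'] at hy
  exact Submodule.iSup_induction _ (motive := p) hy (fun μ y hy ↦ mem μ μ.2 y hy) zero add

lemma lie_mem_maxGenEigenspace_ad {x y z : L} {μ ν : K}
    (hy : y ∈ (ad K L x).maxGenEigenspace μ) (hz : z ∈ (ad K L x).maxGenEigenspace ν) :
    ⁅y, z⁆ ∈ (ad K L x).maxGenEigenspace (μ + ν) :=
  LieModule.lie_mem_maxGenEigenspace_toEnd hy hz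

lemma lie_mem_adEigenSum {x y z : L} {S T U : Set K}
    (hU : ∀ s ∈ S, ∀ t ∈ T, s + t ∈ U)
    (hy : y ∈ adEigenSum x S) (hz : z ∈ adEigenSum x T) : ⁅y, z⁆ ∈ adEigenSum x U := by
  refine adEigenSum_induction (p := fun y ↦ ⁅y, z⁆ ∈ adEigenSum x U) (fun μ hμ y hy ↦ ?_)
    (by simp) (fun _ _ h₁ h₂ ↦ by rw [add_lie]; exact add_mem h₁ h₂) hy
  refine adEigenSum_induction (p := fun z ↦ ⁅y, z⁆ ∈ adEigenSum x U) (fun ν hν z hz ↦ ?_)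
    (by simp) (fun _ _ h₁ h₂ ↦ by rw [lie_add]; exact add_mem h₁ h₂) hz
  exact maxGenEigenspace_le_adEigenSum x (hU μ hμ ν hν) (lie_mem_maxGenEigenspace_ad hy hz)

lemma killingForm_eq_zero_of_mem_maxGenEigenspace {x y z : L} {μ ν : K} (h : μ + ν ≠ 0)
    (hy : y ∈ (ad K L x).maxGenEigenspace μ) (hz : z ∈ (ad K L x).maxGenEigenspace ν) :
    killingForm K L y z = 0 := by
  obtain ⟨k, hk⟩ := (End.mem_maxGenEigenspace _ _ _).mp hy
  obtain ⟨m, hm⟩ := (End.mem_maxGenEigenspace _ _ _).mp hz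
  clear hy hz
  induction k generalizing y z m with
  | zero => simp_all
  | succ k ihk =>
    induction m generalizing z with
    | zero => simp_all
    | succ m ihm =>
      have h₁ : killingForm K L ((ad K L x - μ • 1) y) z = 0 :=
        ihk (by rwa [pow_succ, End.mul_apply] at hk) _ hm
      have h₂ : killingForm K L y ((ad K L x - ν • 1) z) = 0 :=
        ihm (by rwa [pow_succ, End.mul_apply] at hm)
      have h₃ : killingForm K L ⁅x, y⁆ z = - killingForm K L y ⁅x, z⁆ := by
        rw [← lie_skew, map_neg, LinearMap.neg_apply, LieModule.traceForm_apply_lie_apply]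
      simp only [LinearMap.sub_apply, LinearMap.smul_apply, End.one_apply, map_sub, map_smul,
        ad_apply, smul_eq_mul] at h₁ h₂
      refine (mul_eq_zero.mp (?_ : (μ + ν) * _ = 0)).resolve_left h
      linear_combination h₃ - h₁ - h₂

lemma killingForm_eq_zero_of_mem_adEigenSum {x y z : L} {S T : Set K}
    (h : ∀ s ∈ S, ∀ t ∈ T, s + t ≠ 0)
    (hy : y ∈ adEigenSum x S) (hz : z ∈ adEigenSum x T) : killingForm K L y z = 0 := by
  refine adEigenSum_induction (p := fun y ↦ killingForm K L y z = 0) (fun μ hμ y hy ↦ ?_)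
    (by simp) (fun _ _ h₁ h₂ ↦ by simp [h₁, h₂]) hy
  refine adEigenSum_induction (p := fun z ↦ killingForm K L y z = 0) (fun ν hν z hz ↦ ?_)
    (by simp) (fun _ _ h₁ h₂ ↦ by simp [h₁, h₂]) hz
  exact killingForm_eq_zero_of_mem_maxGenEigenspace (h μ hμ ν hν) hy hz

/-- If `C` is stable under addition and does not contain `0`, then the component in the
`0`-eigenspace of an ad-nilpotent element of `adEigenSum x ({0} ∪ C)` is ad-nilpotent. -/
lemma isNilpotent_ad_of_isNilpotent_ad_add [IsAlgClosed K] [FiniteDimensional K L]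
    {x h n : L} {C : Set K} (hadd : ∀ s ∈ C, ∀ t ∈ C, s + t ∈ C) (hC : (0 : K) ∉ C)
    (hh : h ∈ (ad K L x).maxGenEigenspace 0) (hn : n ∈ adEigenSum x C)
    (hnil : IsNilpotent (ad K L (h + n))) : IsNilpotent (ad K L h) := by
  obtain ⟨k, hk⟩ := hnil
  refine ⟨k, ?_⟩
  rw [← LinearMap.ker_eq_top, eq_top_iff, ← End.iSup_maxGenEigenspace_eq_top (ad K L x),
    iSup_le_iff]
  intro μ e he
  have key (j : ℕ) : (ad K L h ^ j) e ∈ (ad K L x).maxGenEigenspace μ ∧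
      (ad K L (h + n) ^ j) e - (ad K L h ^ j) e ∈ adEigenSum x {ν | ν - μ ∈ C} := by
    induction j with
    | zero => simpa using he
    | succ j ih =>
      obtain ⟨ih₁, ih₂⟩ := ih
      simp only [pow_succ', End.mul_apply, ad_apply]
      refine ⟨by simpa using lie_mem_maxGenEigenspace_ad hh ih₁, ?_⟩
      generalize (ad K L (h + n) ^ j) e = u at *
      generalize (ad K L h ^ j) e = v at *
      have h₁ : ⁅h, u - v⁆ ∈ adEigenSum x {ν | ν - μ ∈ C} :=
        lie_mem_adEigenSum (S := {0}) (T := {ν | ν - μ ∈ C}) (by simp)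
          (maxGenEigenspace_le_adEigenSum x (Set.mem_singleton _) hh) ih₂
      have h₂ : ⁅n, u - v⁆ ∈ adEigenSum x {ν | ν - μ ∈ C} :=
        lie_mem_adEigenSum (S := C) (T := {ν | ν - μ ∈ C})
          (fun s hs t ht ↦ by simpa [add_sub_assoc] using hadd s hs _ ht) hn ih₂
      have h₃ : ⁅n, v⁆ ∈ adEigenSum x {ν | ν - μ ∈ C} :=
        lie_mem_adEigenSum (S := C) (T := {μ}) (by simp) hn
          (maxGenEigenspace_le_adEigenSum x (Set.mem_singleton _) ih₁)
      have hs : ⁅h + n, u⁆ - ⁅h, v⁆ = ⁅h, u - v⁆ + ⁅n, u - v⁆ + ⁅n, v⁆ := by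
        simp only [add_lie, lie_sub]; abel
      rw [hs]
      exact add_mem (add_mem h₁ h₂) h₃
  obtain ⟨h₁, h₂⟩ := key k
  rw [hk, LinearMap.zero_apply, zero_sub, neg_mem_iff] at h₂
  have hdisj := (End.independent_maxGenEigenspace (ad K L x)).disjoint_biSup
    (x := μ) (y := {ν | ν - μ ∈ C}) (by simpa using hC)
  exact Submodule.disjoint_def.mp hdisj _ h₁ h₂

end EigenSum

/-- A linear space of ad-nilpotent elements is totally isotropic for the Killing form. -/
lemma killingForm_eq_zero_of_forall_isNilpotent_ad {K L : Type*} [Field K] [CharZero K]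
    [LieRing L] [LieAlgebra K L] [FiniteDimensional K L] {V : Submodule K L}
    (hnil : ∀ x ∈ V, IsNilpotent (ad K L x)) {x y : L} (hx : x ∈ V) (hy : y ∈ V) :
    killingForm K L x y = 0 := by
  have hself (z : L) (hz : z ∈ V) : killingForm K L z z = 0 := by
    rw [killingForm_apply_apply, ← End.mul_eq_comp, ← pow_two]
    exact (LinearMap.isNilpotent_trace_of_isNilpotent
      ((hnil z hz).pow_of_pos two_ne_zero)).eq_zero
  have h := hself (x + y) (add_mem hx hy)
  simp only [map_add, LinearMap.add_apply, hself x hx, hself y hy, zero_add, add_zero,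
    LieModule.traceForm_comm K L L y x] at h
  exact add_self_eq_zero.mp h

/-- A linear space of ad-nilpotent elements has dimension at most the codimension of
`adEigenSum x ({0} ∪ C)`, whenever `C` is stable under addition and does not contain `0`. -/
lemma finrank_add_finrank_adEigenSum_le {K L : Type*} [Field K] [CharZero K] [IsAlgClosed K]
    [LieRing L] [LieAlgebra K L] [FiniteDimensional K L] [IsKilling K L] {V : Submodule K L}
    (hnil : ∀ x ∈ V, IsNilpotent (ad K L x)) {x : L}
    (hx : (LieSubalgebra.engel K x).IsCartanSubalgebra)
    {C : Set K} (hadd : ∀ s ∈ C, ∀ t ∈ C, s + t ∈ C) (hC : (0 : K) ∉ C) :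
    finrank K V + finrank K (adEigenSum x ({0} ∪ C)) ≤ finrank K L := by
  set B := adEigenSum x ({0} ∪ C) with hB
  have hVB : V ⊓ B ≤ adEigenSum x C := by
    rintro y ⟨hyV, hyB⟩
    have hsup : B = (ad K L x).maxGenEigenspace 0 ⊔ adEigenSum x C := by
      rw [hB, adEigenSum, adEigenSum, iSup_union, iSup_singleton]
    obtain ⟨h, hh, n, hn, rfl⟩ := Submodule.mem_sup.mp (hsup ▸ hyB)
    have hh0 : h = 0 := IsKilling.eq_zero_of_isNilpotent_ad_of_mem_isCartanSubalgebra K L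
      (LieSubalgebra.engel K x) hh
      (isNilpotent_ad_of_isNilpotent_ad_add hadd hC hh hn (hnil _ hyV))
    simpa [hh0] using hn
  have horth : V ⊓ B ≤ LinearMap.BilinForm.orthogonal (killingForm K L) (V ⊔ B) := by
    intro y hy w hw
    obtain ⟨v, hv, b, hb, rfl⟩ := Submodule.mem_sup.mp hw
    have h₁ := killingForm_eq_zero_of_forall_isNilpotent_ad hnil hv hy.1
    have h₂ : killingForm K L b y = 0 := by
      refine killingForm_eq_zero_of_mem_adEigenSum (fun s hs t ht h0 ↦ hC ?_) hb (hVB hy)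
      rcases hs with rfl | hs
      · rw [zero_add] at h0; exact h0 ▸ ht
      · exact h0 ▸ hadd s hs t ht
    simp [h₁, h₂]
  have h₁ := Submodule.finrank_mono horth
  rw [LinearMap.BilinForm.finrank_orthogonal (IsKilling.killingForm_nondegenerate K L)] at h₁
  have h₂ := Submodule.finrank_sup_add_finrank_inf_eq V B
  have h₃ := Submodule.finrank_le (V ⊔ B)
  omega

theorem stmt_7 (L : Type*) [LieRing L] [LieAlgebra ℂ L]
    [FiniteDimensional ℂ L] [LieAlgebra.IsSemisimple ℂ L]
    (V : Submodule ℂ L)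
    (hnil : ∀ x ∈ V, IsNilpotent (LieAlgebra.ad ℂ L x)) :
    2 * Module.finrank ℂ V ≤ Module.finrank ℂ L - LieAlgebra.rank ℂ L := by
  obtain ⟨x, hx⟩ := exists_isCartanSubalgebra_engel ℂ L
  let P : Set ℂ := {z | 0 < z.re ∨ z.re = 0 ∧ 0 < z.im}
  let N : Set ℂ := {z | z.re < 0 ∨ z.re = 0 ∧ z.im < 0}
  have hP := finrank_add_finrank_adEigenSum_le hnil hx (C := P) (by
    rintro s hs t ht
    simp only [P, Set.mem_ofPred_eq, Complex.add_re, Complex.add_im] at *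
    grind) (by simp [P])
  have hN := finrank_add_finrank_adEigenSum_le hnil hx (C := N) (by
    rintro s hs t ht
    simp only [N, Set.mem_ofPred_eq, Complex.add_re, Complex.add_im] at *
    grind) (by simp [N])
  have htop : adEigenSum x ({0} ∪ P) ⊔ adEigenSum x ({0} ∪ N) = ⊤ := by
    rw [eq_top_iff, ← End.iSup_maxGenEigenspace_eq_top (ad ℂ L x), iSup_le_iff]
    intro μ
    have hμ : μ ∈ ({0} ∪ P) ∨ μ ∈ ({0} ∪ N) := by
      simp only [P, N, Set.mem_union, Set.mem_singleton_iff, Set.mem_ofPred_eq, Complex.ext_iff,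
        Complex.zero_re, Complex.zero_im]
      grind
    rcases hμ with hμ | hμ
    · exact le_sup_of_le_left (maxGenEigenspace_le_adEigenSum x hμ)
    · exact le_sup_of_le_right (maxGenEigenspace_le_adEigenSum x hμ)
  have hinf : (LieSubalgebra.engel ℂ x).toSubmodule ≤
      adEigenSum x ({0} ∪ P) ⊓ adEigenSum x ({0} ∪ N) :=
    le_inf (maxGenEigenspace_le_adEigenSum x (by simp))
      (maxGenEigenspace_le_adEigenSum x (by simp))
  have h₁ := Submodule.finrank_mono hinf
  have h₂ := Submodule.finrank_sup_add_finrank_inf_eq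
    (adEigenSum x ({0} ∪ P)) (adEigenSum x ({0} ∪ N))
  rw [htop, finrank_top] at h₂
  have h₃ : rank ℂ L ≤ finrank ℂ (LieSubalgebra.engel ℂ x).toSubmodule :=
    rank_le_finrank_engel ℂ x
  omega
end

section
/- Let n and k be integers with 2 ≤ k and 2*k ≤ n. If 𝒜 is an intersecting family of k-element subsets of {1,...,n} such that there is no element x ∈ {1,...,n} belonging to every set of 𝒜, then |𝒜| ≤ binomial(n-1, k-1) − binomial(n-k-1, k-1) + 1. -/
open Finset
open scoped FinsetFamily

namespace Finset
variable {α : Type*} [DecidableEq α] {𝒜 : Finset (Finset α)} {A B S Y U : Finset α}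
  {i j x y : α} {k m : ℕ}

/-! ### Shifting -/

lemma compress_singleton (hij : i ≠ j) (A : Finset α) :
    UV.compress {i} {j} A = if i ∉ A ∧ j ∈ A then insert i (A.erase j) else A := by
  unfold UV.compress
  simp only [disjoint_singleton_left, singleton_subset_iff]
  split_ifs
  · ext z
    simp only [sup_eq_union, mem_sdiff, mem_union, mem_singleton, mem_insert, mem_erase]
    grind
  · rfl

lemma mem_or_exists_of_mem_shift (hij : i ≠ j) (h : B ∈ 𝓒 {i} {j} 𝒜) :
    (B ∈ 𝒜 ∧ (i ∉ B → j ∈ B → insert i (B.erase j) ∈ 𝒜)) ∨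
      ∃ A ∈ 𝒜, i ∉ A ∧ j ∈ A ∧ insert i (A.erase j) = B := by
  simp only [UV.mem_compression, compress_singleton hij] at h
  grind

lemma mem_shift_or (hij : i ≠ j) (h : A ∈ 𝒜) :
    A ∈ 𝓒 {i} {j} 𝒜 ∨ (i ∉ A ∧ j ∈ A ∧ insert i (A.erase j) ∈ 𝓒 {i} {j} 𝒜) := by
  simp only [UV.mem_compression, compress_singleton hij]
  grind

lemma mem_shift_of_mem (hij : i ≠ j) (h : A ∈ 𝒜)
    (h' : i ∉ A → j ∈ A → insert i (A.erase j) ∈ 𝒜) : A ∈ 𝓒 {i} {j} 𝒜 := by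
  simp only [UV.mem_compression, compress_singleton hij]
  grind

lemma insert_erase_mem_of_shift_eq (hij : i ≠ j) (h : 𝓒 {i} {j} 𝒜 = 𝒜) (hA : A ∈ 𝒜)
    (hi : i ∉ A) (hj : j ∈ A) : insert i (A.erase j) ∈ 𝒜 := by
  have h2 : A ∈ 𝓒 {i} {j} 𝒜 := h.symm ▸ hA
  simp only [UV.mem_compression, compress_singleton hij] at h2
  grind

lemma insert_erase_mem_powersetCard (hA : A ∈ powersetCard k S) (hiS : i ∈ S) (hi : i ∉ A)
    (hj : j ∈ A) : insert i (A.erase j) ∈ powersetCard k S := by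
  rw [mem_powersetCard] at hA ⊢
  refine ⟨insert_subset hiS ((erase_subset _ _).trans hA.1), ?_⟩
  rw [card_insert_of_notMem (by grind), card_erase_add_one hj, hA.2]

lemma insert_erase_inter_ssubset (hi : i ∉ B) (hjA : j ∈ A) (hjB : j ∈ B) :
    insert i (A.erase j) ∩ B ⊂ A ∩ B := by
  rw [insert_inter_of_notMem hi, erase_inter]
  exact erase_ssubset (mem_inter.2 ⟨hjA, hjB⟩)

lemma shift_subset_powersetCard (hij : i ≠ j) (hiS : i ∈ S) (h : 𝒜 ⊆ powersetCard k S) :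
    𝓒 {i} {j} 𝒜 ⊆ powersetCard k S := by
  intro B hB
  obtain hB | ⟨A, hA, hi, hj, rfl⟩ := mem_or_exists_of_mem_shift hij hB
  · exact h hB.1
  · exact insert_erase_mem_powersetCard (h hA) hiS hi hj

lemma intersecting_shift (hij : i ≠ j) (h : (𝒜 : Set (Finset α)).Intersecting) :
    (𝓒 {i} {j} 𝒜 : Set (Finset α)).Intersecting := by
  have key : ∀ A ∈ 𝒜, i ∉ A → j ∈ A → ∀ B ∈ 𝒜,
      (i ∉ B → j ∈ B → insert i (B.erase j) ∈ 𝒜) → ¬ Disjoint (insert i (A.erase j)) B := by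
    intro A hA hi hj B hB hB'
    by_cases hiB : i ∈ B
    · exact not_disjoint_iff.2 ⟨i, mem_insert_self _ _, hiB⟩
    by_cases hjB : j ∈ B
    · obtain ⟨z, hz, hz'⟩ := not_disjoint_iff.1 (h hA (hB' hiB hjB))
      exact not_disjoint_iff.2 ⟨z, by grind, by grind⟩
    · obtain ⟨z, hz, hz'⟩ := not_disjoint_iff.1 (h hA hB)
      exact not_disjoint_iff.2 ⟨z, by grind, hz'⟩
  intro A hA B hB
  obtain hA | ⟨A, hA', hi, hj, rfl⟩ := mem_or_exists_of_mem_shift hij hA <;>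
    obtain hB | ⟨B, hB', hi', hj', rfl⟩ := mem_or_exists_of_mem_shift hij hB
  · exact h hA.1 hB.1
  · exact fun hd => key B hB' hi' hj' A hA.1 hA.2 hd.symm
  · exact key A hA' hi hj B hB.1 hB.2
  · exact not_disjoint_iff.2 ⟨i, mem_insert_self _ _, mem_insert_self _ _⟩

lemma sum_card_sdiff_shift_lt (hi : i ∈ Y) (hj : j ∉ Y) (h : 𝓒 {i} {j} 𝒜 ≠ 𝒜) :
    ∑ A ∈ 𝓒 {i} {j} 𝒜, #(A \ Y) < ∑ A ∈ 𝒜, #(A \ Y) := by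
  have hij : i ≠ j := by grind
  have hlt : ∀ A ∈ {A ∈ 𝒜 | UV.compress {i} {j} A ∉ 𝒜},
      #(UV.compress {i} {j} A \ Y) < #(A \ Y) := by
    intro A hA
    obtain ⟨hA, hA'⟩ := mem_filter.1 hA
    rw [compress_singleton hij] at hA' ⊢
    split_ifs at hA' ⊢ with hc
    · refine card_lt_card ((ssubset_iff_of_subset (by grind)).2 ⟨j, by grind, by grind⟩)
    · exact absurd hA hA'
  have hne : {A ∈ 𝒜 | UV.compress {i} {j} A ∉ 𝒜}.Nonempty := by
    by_contra! hem
    apply h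
    rw [UV.compression, filter_image, hem, image_empty, union_empty, filter_true_of_mem]
    simpa using filter_eq_empty_iff.1 hem
  rw [UV.compression, sum_union UV.compress_disjoint,
    ← sum_filter_add_sum_filter_not 𝒜 (fun A => UV.compress {i} {j} A ∈ 𝒜), filter_image,
    sum_image UV.compress_injOn]
  exact Nat.add_lt_add_left (sum_lt_sum_of_nonempty hne hlt) _

/-- Shift into `Y` as long as the property `P` is preserved. -/
lemma exists_shift_stable (P : Finset (Finset α) → Prop) (Y : Finset α) (h : P 𝒜) :
    ∃ ℬ, P ℬ ∧ #ℬ = #𝒜 ∧ ∀ i ∈ Y, ∀ j ∉ Y, P (𝓒 {i} {j} ℬ) → 𝓒 {i} {j} ℬ = ℬ := by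
  induction hw : ∑ A ∈ 𝒜, #(A \ Y) using Nat.strong_induction_on generalizing 𝒜 with
  | _ w ih =>
    by_cases hs : ∀ i ∈ Y, ∀ j ∉ Y, P (𝓒 {i} {j} 𝒜) → 𝓒 {i} {j} 𝒜 = 𝒜
    · exact ⟨𝒜, h, rfl, hs⟩
    push Not at hs
    obtain ⟨i, hi, j, hj, hP, hne⟩ := hs
    obtain ⟨ℬ, h₁, h₂, h₃⟩ := ih _ (hw ▸ sum_card_sdiff_shift_lt hi hj hne) hP rfl
    exact ⟨ℬ, h₁, h₂.trans (UV.card_compression _ _ _), h₃⟩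

lemma not_disjoint_inter_of_stable (h𝒜 : (𝒜 : Set (Finset α)).Sized k) (hY : #Y = 2 * k)
    (hint : (𝒜 : Set (Finset α)).Intersecting)
    (hst : ∀ A ∈ 𝒜, ∀ B ∈ 𝒜, Disjoint (A ∩ Y) (B ∩ Y) → ∀ i ∈ Y, i ∉ A → i ∉ B →
      ∀ j ∈ A, j ∉ Y → insert i (A.erase j) ∈ 𝒜) (hA : A ∈ 𝒜) (hB : B ∈ 𝒜) :
    ¬ Disjoint (A ∩ Y) (B ∩ Y) := by
  induction hw : #(A ∩ B) using Nat.strong_induction_on generalizing A with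
  | _ w ih =>
    intro hd
    obtain ⟨j, hjA, hjB⟩ := not_disjoint_iff.1 (hint hA hB)
    have hjY : j ∉ Y := fun hj => disjoint_left.1 hd (by grind) (by grind : j ∈ B ∩ Y)
    have h1 : #(A ∩ Y) < k := by
      rw [← h𝒜 hA]
      exact card_lt_card ((ssubset_iff_of_subset inter_subset_left).2 ⟨j, hjA, by grind⟩)
    have h2 : #(B ∩ Y) < k := by
      rw [← h𝒜 hB]
      exact card_lt_card ((ssubset_iff_of_subset inter_subset_left).2 ⟨j, hjB, by grind⟩)
    obtain ⟨i, hiY, hi⟩ : ∃ i ∈ Y, i ∉ (A ∩ Y) ∪ (B ∩ Y) := by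
      apply exists_mem_notMem_of_card_lt_card
      have := card_union_le (A ∩ Y) (B ∩ Y)
      omega
    have hiA : i ∉ A := by grind
    have hiB : i ∉ B := by grind
    refine ih _ ?_ (hst A hA B hB hd i hiY hiA hiB j hjA hjY) rfl ?_
    · rw [← hw]
      exact card_lt_card (insert_erase_inter_ssubset hiB hjA hjB)
    · rw [disjoint_left] at hd ⊢
      intro z hz hz'
      obtain ⟨hz, hzY⟩ := mem_inter.1 hz
      obtain rfl | hz := mem_insert.1 hz
      · exact hiB (mem_inter.1 hz').1
      · exact hd (mem_inter.2 ⟨mem_of_mem_erase hz, hzY⟩) hz'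

/-! ### Counting traces -/

lemma card_le_sum_card_trace (h𝒜 : 𝒜 ⊆ powersetCard k S) (hY : Y ⊆ S) :
    #𝒜 ≤ ∑ i ∈ range (k + 1), #{T ∈ 𝒜.image (· ∩ Y) | #T = i} * (#S - #Y).choose (k - i) := by
  have hfib : ∀ T ∈ 𝒜.image (· ∩ Y),
      #{A ∈ 𝒜 | A ∩ Y = T} ≤ (#S - #Y).choose (k - #T) := by
    intro T _
    rw [← card_sdiff_of_subset hY, ← card_powersetCard]
    refine card_le_card_of_injOn (· \ Y) ?_ ?_
    · intro A hA
      obtain ⟨hA', rfl⟩ := mem_filter.1 hA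
      obtain ⟨hAS, hAk⟩ := mem_powersetCard.1 (h𝒜 hA')
      refine mem_powersetCard.2 ⟨sdiff_subset_sdiff hAS subset_rfl, ?_⟩
      have := card_sdiff_add_card_inter A Y
      simp only
      omega
    · intro A hA B hB hAB
      have hA := (mem_filter.1 hA).2
      have hB := (mem_filter.1 hB).2
      simp only at hAB
      rw [← sdiff_union_inter A Y, ← sdiff_union_inter B Y, hA, hB, hAB]
  rw [card_eq_sum_card_image (· ∩ Y) 𝒜]
  refine (sum_le_sum hfib).trans (le_of_eq ?_)
  rw [← sum_fiberwise_of_maps_to (t := range (k + 1)) (g := card)]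
  · refine sum_congr rfl fun i _ => ?_
    rw [sum_congr rfl (g := fun _ => (#S - #Y).choose (k - i)), sum_const, smul_eq_mul]
    intro T hT
    rw [(mem_filter.1 hT).2]
  · intro T hT
    obtain ⟨A, hA, rfl⟩ := mem_image.1 hT
    have := (mem_powersetCard.1 (h𝒜 hA)).2
    have := card_le_card (inter_subset_left : A ∩ Y ⊆ A)
    rw [mem_range]
    omega

lemma card_add_choose_le_of_star (hx : x ∈ Y) (hU : U ⊆ Y) (hxU : x ∉ U)
    (h𝒜 : 𝒜 ⊆ powersetCard (m + 1) Y) (hstar : ∀ A ∈ 𝒜, x ∈ A)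
    (hmeet : ∀ A ∈ 𝒜, ¬ Disjoint A U) :
    #𝒜 + (#Y - 1 - #U).choose m ≤ (#Y - 1).choose m := by
  have hU' : U ⊆ Y.erase x := subset_erase.2 ⟨hU, hxU⟩
  have hcard : #(𝒜.image (·.erase x)) = #𝒜 := by
    refine card_image_of_injOn fun A hA B hB hAB => ?_
    rw [← insert_erase (hstar A hA), ← insert_erase (hstar B hB), hAB]
  rw [← card_erase_of_mem hx, ← card_sdiff_of_subset hU', ← hcard, ← card_powersetCard,
    ← card_powersetCard, ← card_union_of_disjoint]
  · refine card_le_card (union_subset ?_ (powersetCard_mono sdiff_subset))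
    intro T hT
    obtain ⟨A, hA, rfl⟩ := mem_image.1 hT
    obtain ⟨hAS, hAk⟩ := mem_powersetCard.1 (h𝒜 hA)
    refine mem_powersetCard.2 ⟨erase_subset_erase _ hAS, ?_⟩
    rw [card_erase_of_mem (hstar A hA), hAk, Nat.add_sub_cancel]
  · rw [disjoint_left]
    intro T hT hT'
    obtain ⟨A, hA, rfl⟩ := mem_image.1 hT
    obtain ⟨z, hz, hz'⟩ := not_disjoint_iff.1 (hmeet A hA)
    have := (mem_powersetCard.1 hT').1 (mem_erase.2 ⟨by grind, hz⟩)
    grind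

lemma card_le_choose_of_intersecting (hY : #Y = 2 * (m + 1)) (h𝒜 : 𝒜 ⊆ powersetCard (m + 1) Y)
    (hint : (𝒜 : Set (Finset α)).Intersecting) : #𝒜 ≤ (2 * (m + 1) - 1).choose m := by
  have hcard : #(𝒜.image (Y \ ·)) = #𝒜 := by
    refine card_image_of_injOn fun A hA B hB hAB => ?_
    rw [← sdiff_sdiff_eq_self (mem_powersetCard.1 (h𝒜 hA)).1, hAB,
      sdiff_sdiff_eq_self (mem_powersetCard.1 (h𝒜 hB)).1]
  have hdisj : Disjoint 𝒜 (𝒜.image (Y \ ·)) := by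
    rw [disjoint_left]
    intro A hA hA'
    obtain ⟨B, hB, rfl⟩ := mem_image.1 hA'
    exact hint hA hB sdiff_disjoint
  have hle : #(𝒜 ∪ 𝒜.image (Y \ ·)) ≤ #(powersetCard (m + 1) Y) := by
    refine card_le_card (union_subset h𝒜 fun T hT => ?_)
    obtain ⟨A, hA, rfl⟩ := mem_image.1 hT
    obtain ⟨hAS, hAk⟩ := mem_powersetCard.1 (h𝒜 hA)
    refine mem_powersetCard.2 ⟨sdiff_subset, ?_⟩
    rw [card_sdiff_of_subset hAS]
    omega
  rw [card_union_of_disjoint hdisj, hcard, card_powersetCard, hY] at hle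
  have h1 : (2 * (m + 1)).choose (m + 1) = 2 * (2 * (m + 1) - 1).choose m := by
    rw [show 2 * (m + 1) = (2 * m + 1) + 1 by ring, Nat.choose_succ_succ, Nat.add_sub_cancel,
      ← Nat.choose_symm_half]
    ring
  omega

/-- The Hilton-Milner bound, for families of `k`-sets. -/
def HiltonMilnerBound (α : Type*) [DecidableEq α] (k : ℕ) : Prop :=
  ∀ (S : Finset α) (𝒜 : Finset (Finset α)), 2 * k ≤ #S → 𝒜 ⊆ powersetCard k S →
    (𝒜 : Set (Finset α)).Intersecting → (∀ x, ∃ A ∈ 𝒜, x ∉ A) →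
      #𝒜 + (#S - k - 1).choose (k - 1) ≤ (#S - 1).choose (k - 1) + 1

lemma card_trace_add_choose_le (hmk : m + 1 < k)
    (ih : 1 ≤ m → HiltonMilnerBound α (m + 1)) (hY : #Y = 2 * k) (h𝒜 : 𝒜 ⊆ powersetCard (m + 1) Y)
    (hint : (𝒜 : Set (Finset α)).Intersecting)
    (hU : ∀ x, ∃ U ⊆ Y, #U ≤ k ∧ x ∉ U ∧ ∀ A ∈ 𝒜, ¬ Disjoint A U) :
    #𝒜 + (k - 1).choose m ≤ (2 * k - 1).choose m := by
  obtain rfl | ⟨A, hA⟩ := 𝒜.eq_empty_or_nonempty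
  · simpa using Nat.choose_le_choose m (by omega : k - 1 ≤ 2 * k - 1)
  by_cases hx : ∃ x, ∀ A ∈ 𝒜, x ∈ A
  · obtain ⟨x, hx⟩ := hx
    obtain ⟨U, hUY, hUk, hxU, hmeet⟩ := hU x
    have := card_add_choose_le_of_star ((mem_powersetCard.1 (h𝒜 hA)).1 (hx A hA)) hUY hxU h𝒜 hx
      hmeet
    rw [hY] at this
    have := Nat.choose_le_choose m (by omega : k - 1 ≤ 2 * k - 1 - #U)
    omega
  push Not at hx
  obtain rfl | hm := Nat.eq_zero_or_pos m
  · obtain ⟨a, rfl⟩ := card_eq_one.1 (mem_powersetCard.1 (h𝒜 hA)).2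
    obtain ⟨B, hB, haB⟩ := hx a
    exact absurd (disjoint_singleton_left.2 haB) (hint hA hB)
  have := ih hm Y 𝒜 (by omega) h𝒜 hint hx
  rw [hY, Nat.add_sub_cancel] at this
  have h1 := Nat.choose_le_choose m (by omega : k ≤ 2 * k - (m + 1) - 1)
  obtain ⟨l, rfl⟩ : ∃ l, k = l + 1 := ⟨k - 1, by omega⟩
  obtain ⟨r, rfl⟩ : ∃ r, m = r + 1 := ⟨m - 1, by omega⟩
  rw [Nat.choose_succ_succ'] at h1
  have := Nat.choose_pos (by omega : r ≤ l)
  simp only [Nat.add_sub_cancel] at *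
  omega

lemma card_add_choose_le_of_trace (hk : 2 ≤ k) (ih : ∀ l, 2 ≤ l → l < k → HiltonMilnerBound α l)
    (h𝒜 : 𝒜 ⊆ powersetCard k S) (hYS : Y ⊆ S) (hY : #Y = 2 * k)
    (htr : ∀ A ∈ 𝒜, ∀ B ∈ 𝒜, ¬ Disjoint (A ∩ Y) (B ∩ Y)) (hnt : ∀ x, ∃ A ∈ 𝒜, x ∉ A) :
    #𝒜 + (#S - k - 1).choose (k - 1) ≤ (#S - 1).choose (k - 1) + 1 := by
  obtain ⟨q, rfl⟩ : ∃ q, k = q + 1 := ⟨k - 1, by omega⟩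
  have hSY := card_le_card hYS
  set a : ℕ → ℕ := fun i => #{T ∈ 𝒜.image (· ∩ Y) | #T = i} with ha
  have hint : ∀ i, ({T ∈ 𝒜.image (· ∩ Y) | #T = i} : Set (Finset α)).Intersecting := by
    intro i T hT T' hT'
    obtain ⟨A, hA, rfl⟩ := mem_image.1 hT.1
    obtain ⟨B, hB, rfl⟩ := mem_image.1 hT'.1
    exact htr A hA B hB
  have hsub : ∀ i, {T ∈ 𝒜.image (· ∩ Y) | #T = i} ⊆ powersetCard i Y := by
    intro i T hT
    obtain ⟨hT, hTi⟩ := mem_filter.1 hT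
    obtain ⟨A, hA, rfl⟩ := mem_image.1 hT
    exact mem_powersetCard.2 ⟨inter_subset_right, hTi⟩
  have ha0 : a 0 = 0 := by
    rw [ha, card_eq_zero, filter_eq_empty_iff]
    intro T hT hT0
    obtain ⟨A, hA, rfl⟩ := mem_image.1 hT
    apply htr A hA A hA
    rw [card_eq_zero.1 hT0]
    exact disjoint_empty_left _
  have hlt : ∀ m, m < q → a (m + 1) + q.choose m ≤ (2 * (q + 1) - 1).choose m := by
    intro m hm
    refine card_trace_add_choose_le (k := q + 1) (by omega)
      (fun h => ih _ (by omega) (by omega)) hY (hsub _) (by simpa using hint (m + 1)) fun x => ?_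
    obtain ⟨A, hA, hxA⟩ := hnt x
    refine ⟨A ∩ Y, inter_subset_right, ?_, by grind, ?_⟩
    · exact (card_le_card inter_subset_left).trans (mem_powersetCard.1 (h𝒜 hA)).2.le
    · intro T hT
      obtain ⟨B, hB, rfl⟩ := mem_image.1 (mem_filter.1 hT).1
      exact htr B hB A hA
  have hq : a (q + 1) ≤ (2 * (q + 1) - 1).choose q :=
    card_le_choose_of_intersecting hY (hsub _) (by simpa using hint (q + 1))
  have hsum := card_le_sum_card_trace h𝒜 hYS
  rw [sum_range_succ'] at hsum
  change #𝒜 ≤ ∑ m ∈ range (q + 1), a (m + 1) * (#S - #Y).choose (q + 1 - (m + 1)) + a 0 * _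
    at hsum
  rw [ha0, zero_mul, add_zero, hY] at hsum
  have hV : ∀ c d : ℕ, c + (#S - 2 * (q + 1)) = d →
      d.choose q = ∑ m ∈ range (q + 1), c.choose m * (#S - 2 * (q + 1)).choose (q - m) := by
    rintro c d rfl
    rw [Nat.add_choose_eq, Nat.sum_antidiagonal_eq_sum_range_succ_mk]
  rw [Nat.add_sub_cancel, hV q (#S - (q + 1) - 1) (by omega),
    hV (2 * (q + 1) - 1) (#S - 1) (by omega)]
  refine (Nat.add_le_add_right hsum _).trans ?_
  rw [← sum_add_distrib, sum_range_succ, sum_range_succ, add_assoc]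
  refine Nat.add_le_add (sum_le_sum fun m hm => ?_) (by simpa using hq)
  rw [Nat.add_sub_add_right, ← add_mul]
  exact Nat.mul_le_mul_right _ (hlt m (mem_range.1 hm))

/-! ### The Hilton-Milner theorem -/

lemma card_add_choose_le_of_meets_pair (hk : 2 ≤ k) (ih : ∀ l, 2 ≤ l → l < k → HiltonMilnerBound α l)
    (hS : 2 * k ≤ #S) (h𝒜 : 𝒜 ⊆ powersetCard k S) (hint : (𝒜 : Set (Finset α)).Intersecting)
    (hx : x ∈ S) (hy : y ∈ S) (hxy : x ≠ y) (hx' : ∃ A ∈ 𝒜, x ∉ A) (hy' : ∃ A ∈ 𝒜, y ∉ A)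
    (hmeet : ∀ A ∈ 𝒜, x ∈ A ∨ y ∈ A) :
    #𝒜 + (#S - k - 1).choose (k - 1) ≤ (#S - 1).choose (k - 1) + 1 := by
  obtain ⟨Y, hxyY, hYS, hY⟩ := exists_subsuperset_card_eq (s := {x, y}) (t := S) (n := 2 * k)
    (by grind) (by rw [card_pair hxy]; omega) hS
  have hxY : x ∈ Y := hxyY (by simp)
  have hyY : y ∈ Y := hxyY (by simp)
  let P : Finset (Finset α) → Prop := fun ℬ => ℬ ⊆ powersetCard k S ∧
    (ℬ : Set (Finset α)).Intersecting ∧ (∃ A ∈ ℬ, x ∉ A) ∧ (∃ A ∈ ℬ, y ∉ A) ∧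
    (∀ A ∈ ℬ, x ∈ A ∨ y ∈ A) ∧ ∀ A ∈ powersetCard k S, x ∈ A → y ∈ A → A ∈ ℬ
  have hP : P (𝒜 ∪ {A ∈ powersetCard k S | x ∈ A ∧ y ∈ A}) := by
    refine ⟨union_subset h𝒜 (filter_subset _ _), ?_, by grind, by grind, by grind, by grind⟩
    intro A hA B hB
    simp only [coe_union, Set.mem_union, mem_coe, mem_filter] at hA hB
    rcases hA with hA | hA <;> rcases hB with hB | hB
    · exact hint hA hB
    · rcases hmeet A hA with h | h
      · exact not_disjoint_iff.2 ⟨x, h, hB.2.1⟩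
      · exact not_disjoint_iff.2 ⟨y, h, hB.2.2⟩
    · rcases hmeet B hB with h | h
      · exact not_disjoint_iff.2 ⟨x, hA.2.1, h⟩
      · exact not_disjoint_iff.2 ⟨y, hA.2.2, h⟩
    · exact not_disjoint_iff.2 ⟨x, hA.2.1, hB.2.1⟩
  obtain ⟨ℬ, ⟨h1, h2, h3, h4, h5, h6⟩, hcard, hst⟩ := exists_shift_stable P Y hP
  have hle : #𝒜 ≤ #ℬ := hcard ▸ card_le_card subset_union_left
  refine (Nat.add_le_add_right hle _).trans (card_add_choose_le_of_trace hk ih h1 hYS hY ?_ ?_)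
  · refine fun A hA B hB => not_disjoint_inter_of_stable
      (fun A hA => (mem_powersetCard.1 (h1 hA)).2) hY h2 ?_ hA hB
    intro A hA B hB hd i hiY hiA hiB j hj hjY
    have hij : i ≠ j := by grind
    have hix : i ≠ x ∧ i ≠ y := by
      have hxd : x ∈ A ∩ Y → x ∉ B ∩ Y := fun h => disjoint_left.1 hd h
      have hyd : y ∈ A ∩ Y → y ∉ B ∩ Y := fun h => disjoint_left.1 hd h
      simp only [mem_inter, hxY, hyY, and_true] at hxd hyd
      have hA' := h5 A hA
      have hB' := h5 B hB
      constructor <;> rintro rfl <;> tauto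
    refine insert_erase_mem_of_shift_eq hij (hst i hiY j hjY ?_) hA hiA hj
    have hmiss : ∀ z, i ≠ z → (∃ A ∈ ℬ, z ∉ A) → ∃ A ∈ 𝓒 {i} {j} ℬ, z ∉ A := by
      rintro z hz ⟨A, hA, hzA⟩
      rcases mem_shift_or hij hA with h | h
      · exact ⟨A, h, hzA⟩
      · exact ⟨_, h.2.2, by grind⟩
    refine ⟨shift_subset_powersetCard hij (hYS hiY) h1, intersecting_shift hij h2,
      hmiss x hix.1 h3, hmiss y hix.2 h4, ?_, ?_⟩
    · intro B hB
      obtain hB | ⟨A, hA, hi, hj, rfl⟩ := mem_or_exists_of_mem_shift hij hB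
      · exact h5 B hB.1
      · have := h5 A hA
        grind
    · intro A hA hxA hyA
      refine mem_shift_of_mem hij (h6 A hA hxA hyA) fun hi hj => ?_
      exact h6 _ (insert_erase_mem_powersetCard hA (hYS hiY) hi hj) (by grind) (by grind)
  · intro z
    by_cases hzx : z = x
    · exact hzx ▸ h3
    by_cases hzy : z = y
    · exact hzy ▸ h4
    obtain ⟨A, hA1, hA2, hA3⟩ := exists_subsuperset_card_eq (s := {x, y}) (t := S.erase z) (n := k)
      (by grind) (by rw [card_pair hxy]; omega)
      (by have := pred_card_le_card_erase (s := S) (a := z); omega)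
    exact ⟨A, h6 A (mem_powersetCard.2 ⟨hA2.trans (erase_subset _ _), hA3⟩) (hA1 (by simp))
      (hA1 (by simp)), fun h => by simpa using hA2 h⟩

/-- The **Hilton-Milner theorem**. -/
theorem hiltonMilnerBound (hk : 2 ≤ k) : HiltonMilnerBound α k := by
  induction k using Nat.strong_induction_on with
  | _ k ih =>
  replace ih : ∀ l, 2 ≤ l → l < k → HiltonMilnerBound α l := fun l h h' => ih l h' h
  intro S 𝒜 hS h𝒜 hint hnt
  obtain ⟨Y, hYS, hY⟩ := exists_subset_card_eq hS
  obtain ⟨ℬ, ⟨h1, h2, h3⟩, hcard, hst⟩ := exists_shift_stable (𝒜 := 𝒜)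
    (fun ℬ => ℬ ⊆ powersetCard k S ∧ (ℬ : Set (Finset α)).Intersecting ∧ ∀ x, ∃ A ∈ ℬ, x ∉ A) Y
    ⟨h𝒜, hint, hnt⟩
  rw [← hcard]
  by_cases htriv : ∀ i ∈ Y, ∀ j ∉ Y, ∀ x, ∃ A ∈ 𝓒 {i} {j} ℬ, x ∉ A
  · refine card_add_choose_le_of_trace hk ih h1 hYS hY (fun A hA B hB =>
      not_disjoint_inter_of_stable (fun A hA => (mem_powersetCard.1 (h1 hA)).2) hY h2 ?_ hA hB) h3
    intro A hA B hB _ i hiY hiA hiB j hj hjY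
    have hij : i ≠ j := by grind
    exact insert_erase_mem_of_shift_eq hij (hst i hiY j hjY
      ⟨shift_subset_powersetCard hij (hYS hiY) h1, intersecting_shift hij h2,
        htriv i hiY j hjY⟩) hA hiA hj
  · push Not at htriv
    obtain ⟨i, hi, j, hj, x, hx⟩ := htriv
    have hij : i ≠ j := by grind
    have hmeet : ∀ A ∈ ℬ, x ∈ A ∨ x = i ∧ j ∈ A := by
      intro A hA
      rcases mem_shift_or hij hA with h | h
      · exact .inl (hx A h)
      · have := hx _ h.2.2
        grind
    obtain ⟨A, hA, hxA⟩ := h3 x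
    obtain rfl : x = i := ((hmeet A hA).resolve_left hxA).1
    have hjA := ((hmeet A hA).resolve_left hxA).2
    exact card_add_choose_le_of_meets_pair hk ih hS h1 h2 (hYS hi) ((mem_powersetCard.1 (h1 hA)).1 hjA)
      hij (h3 x) (h3 j) fun A hA => (hmeet A hA).imp_right And.right

end Finset

theorem stmt_8 (n k : ℕ) (hk : 2 ≤ k) (hkn : 2 * k ≤ n)
    (𝒜 : Finset (Finset ℕ))
    (hground : ∀ A ∈ 𝒜, A ⊆ Finset.Icc 1 n)
    (hcard : ∀ A ∈ 𝒜, A.card = k)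
    (hint : ∀ A ∈ 𝒜, ∀ B ∈ 𝒜, (A ∩ B).Nonempty)
    (hnocommon : ¬∃ x ∈ Finset.Icc 1 n, ∀ A ∈ 𝒜, x ∈ A) :
    𝒜.card ≤ (n - 1).choose (k - 1) - (n - k - 1).choose (k - 1) + 1 := by
  push Not at hnocommon
  have hnt : ∀ x, ∃ A ∈ 𝒜, x ∉ A := by
    intro x
    by_cases hx : x ∈ Finset.Icc 1 n
    · exact hnocommon x hx
    · obtain ⟨A, hA, -⟩ := hnocommon 1 (Finset.mem_Icc.2 ⟨le_rfl, by omega⟩)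
      exact ⟨A, hA, fun h => hx (hground A hA h)⟩
  have h := Finset.hiltonMilnerBound hk (Finset.Icc 1 n) 𝒜 (by simpa using hkn)
    (fun A hA => Finset.mem_powersetCard.2 ⟨hground A hA, hcard A hA⟩)
    (fun A hA B hB => Finset.not_disjoint_iff_nonempty_inter.2 (hint A hA B hB)) hnt
  rw [Nat.card_Icc, Nat.add_sub_cancel] at h
  omega
end

section
/- Let V be a ℂ-linear subspace of Λ^k ℂ^n. Suppose that for every invertible upper triangular n×n complex matrix g, the algebra automorphism of Λ ℂ^n induced by g maps V onto V. Then there is a shifted family 𝒜 of k-element subsets of {1,...,n} such that V is the ℂ-span of { m_S : S ∈ 𝒜 }. -/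
/-- The exterior monomial `e_{i_1} ∧ ⋯ ∧ e_{i_k}` indexed by a subset `S = {i_1 < ⋯ < i_k}`
of the index set. -/
noncomputable def extMonomial {n : ℕ} (S : Finset (Fin n)) :
    ExteriorAlgebra ℂ (Fin n → ℂ) :=
  ((S.sort (· ≤ ·)).map fun i => ExteriorAlgebra.ι ℂ (Pi.single i 1)).prod

open ExteriorAlgebra in
/-- Reordering the factors of a product of vectors changes it at most by a sign. -/
lemma prod_map_ι_of_perm {R M I : Type*} [CommRing R] [AddCommGroup M] [Module R M]
    (f : I → M) {l₁ l₂ : List I} (h : l₁.Perm l₂) :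
    (l₁.map fun i => ι R (f i)).prod = (l₂.map fun i => ι R (f i)).prod ∨
      (l₁.map fun i => ι R (f i)).prod = -(l₂.map fun i => ι R (f i)).prod := by
  induction h with
  | nil => simp
  | cons a _ ih => rcases ih with ih | ih <;> simp [ih]
  | swap a b l =>
    right
    have hab : ι R (f b) * ι R (f a) = -(ι R (f a) * ι R (f b)) :=
      eq_neg_of_add_eq_zero_left (ι_add_mul_swap _ _)
    simp only [List.map_cons, List.prod_cons, ← mul_assoc, hab, neg_mul]
  | trans _ _ ih₁ ih₂ =>
    rcases ih₁ with ih₁ | ih₁ <;> rcases ih₂ with ih₂ | ih₂ <;> simp [ih₁, ih₂]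

/-- If a sum of eigenvectors for distinct eigenvalues lies in an invariant subspace, then so does
each of the summands. -/
lemma Submodule.mem_of_sum_eigenvectors_mem {K E I : Type*} [Field K] [AddCommGroup E] [Module K E]
    (f : E →ₗ[K] E) (p : Submodule K E) (hp : ∀ x ∈ p, f x ∈ p) (w : I → K)
    (hw : Function.Injective w) (s : Finset I) (x : I → E) (hx : ∀ i ∈ s, f (x i) = w i • x i)
    (hsum : ∑ i ∈ s, x i ∈ p) : ∀ i ∈ s, x i ∈ p := by
  classical
  induction s using Finset.induction_on generalizing x with
  | empty => simp
  | insert a s ha ih =>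
    have hdiff : ∑ i ∈ s, (w i - w a) • x i ∈ p := by
      have h := p.sub_mem (hp _ hsum) (p.smul_mem (w a) hsum)
      rw [map_sum, Finset.smul_sum, ← Finset.sum_sub_distrib, Finset.sum_insert ha,
        hx a (Finset.mem_insert_self a s), sub_self, zero_add] at h
      convert h using 1
      exact Finset.sum_congr rfl fun i hi => by
        rw [hx i (Finset.mem_insert_of_mem hi), sub_smul]
    have hs : ∀ i ∈ s, x i ∈ p := fun i hi => by
      have hmem := ih (fun i => (w i - w a) • x i)
        (fun i hi => by rw [map_smul, hx i (Finset.mem_insert_of_mem hi), smul_comm]) hdiff i hi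
      refine (p.smul_mem_iff (sub_ne_zero.mpr fun h => ha ?_)).mp hmem
      exact hw h ▸ hi
    rw [Finset.sum_insert ha] at hsum
    intro i hi
    rcases Finset.mem_insert.mp hi with rfl | hi
    · exact (p.add_mem_iff_left (p.sum_mem hs)).mp hsum
    · exact hs i hi

lemma extMonomial_eq_ιMulti_family {n k : ℕ} (S : Set.powersetCard (Fin n) k) :
    ExteriorAlgebra.ιMulti_family ℂ k (fun i : Fin n => (Pi.single i 1 : Fin n → ℂ)) S =
      extMonomial (S : Finset (Fin n)) := by
  obtain ⟨S, hS⟩ := S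
  have hS' : S.card = k := hS
  subst hS'
  rw [ExteriorAlgebra.ιMulti_family, ExteriorAlgebra.ιMulti_apply, extMonomial]
  congr 1
  apply List.ext_getElem
  · simp
  · intro i h₁ h₂
    simp only [List.getElem_ofFn, List.getElem_map, Function.comp_apply,
      Set.powersetCard.ofFinEmbEquiv_symm_apply]
    rfl

lemma exteriorPower_eq_span_extMonomial (n k : ℕ) :
    ⋀[ℂ]^k (Fin n → ℂ) =
      Submodule.span ℂ (extMonomial '' {S : Finset (Fin n) | S.card = k}) := by
  have hspan : Submodule.span ℂ (Set.range fun i : Fin n => (Pi.single i 1 : Fin n → ℂ)) = ⊤ := by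
    simp [← Pi.basisFun_apply]
  rw [← exteriorPower.ιMulti_family_span_fixedDegree_of_span ℂ hspan]
  congr 1
  ext x
  constructor
  · rintro ⟨S, rfl⟩
    exact ⟨S, S.2, (extMonomial_eq_ιMulti_family S).symm⟩
  · rintro ⟨S, hS, rfl⟩
    exact ⟨⟨S, hS⟩, extMonomial_eq_ιMulti_family ⟨S, hS⟩⟩

lemma map_extMonomial {n : ℕ} (f : (Fin n → ℂ) →ₗ[ℂ] (Fin n → ℂ)) (S : Finset (Fin n)) :
    ExteriorAlgebra.map f (extMonomial S) =
      ((S.sort (· ≤ ·)).map fun i => ExteriorAlgebra.ι ℂ (f (Pi.single i 1))).prod := by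
  simp [extMonomial, map_list_prod, Function.comp_def]

lemma map_diagonal_extMonomial {n : ℕ} (t : Fin n → ℂ) (S : Finset (Fin n)) :
    ExteriorAlgebra.map (Matrix.toLin' (Matrix.diagonal t)) (extMonomial S) =
      (∏ i ∈ S, t i) • extMonomial S := by
  have hlist : ∀ l : List (Fin n),
      (l.map fun i => ExteriorAlgebra.ι ℂ
        (Matrix.toLin' (Matrix.diagonal t) (Pi.single i 1))).prod =
      (l.map t).prod • (l.map fun i => ExteriorAlgebra.ι ℂ (Pi.single i 1 : Fin n → ℂ)).prod := by
    intro l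
    induction l with
    | nil => simp
    | cons a l ih =>
      have ha : Matrix.toLin' (Matrix.diagonal t) (Pi.single a 1) =
          t a • (Pi.single a 1 : Fin n → ℂ) := by
        rw [Matrix.toLin'_apply, Matrix.diagonal_mulVec_single, ← Pi.single_smul, smul_eq_mul]
      simp only [List.map_cons, List.prod_cons, ih, ha, map_smul, smul_mul_smul_comm]
  rw [map_extMonomial, hlist, ← extMonomial]
  congr 1
  rw [← List.prod_toFinset _ (S.sort_nodup _), Finset.sort_toFinset]

lemma prod_two_pow_two_pow_injective (n : ℕ) :
    Function.Injective fun S : Finset (Fin n) => ∏ i ∈ S, (2 : ℂ) ^ 2 ^ (i : ℕ) := by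
  intro S T h
  simp only [Finset.prod_pow_eq_pow_sum] at h
  have hnat : 2 ^ ∑ i ∈ S, 2 ^ (i : ℕ) = 2 ^ ∑ i ∈ T, 2 ^ (i : ℕ) := by exact_mod_cast h
  have hsum := Nat.pow_right_injective le_rfl hnat
  apply Finset.map_injective Fin.valEmbedding
  apply Finset.geomSum_injective le_rfl
  simpa using hsum

/-- A subspace stable under the diagonal matrices contains each monomial occurring in one of its
elements. -/
lemma extMonomial_mem_of_sum_mem {n : ℕ} (V : Submodule ℂ (ExteriorAlgebra ℂ (Fin n → ℂ)))
    (htorus : ∀ t : Fin n → ℂ, (∀ i, t i ≠ 0) → ∀ x ∈ V,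
      ExteriorAlgebra.map (Matrix.toLin' (Matrix.diagonal t)) x ∈ V)
    (s : Finset (Finset (Fin n))) (c : Finset (Fin n) → ℂ)
    (hsum : ∑ S ∈ s, c S • extMonomial S ∈ V) {S : Finset (Fin n)} (hS : S ∈ s) (hc : c S ≠ 0) :
    extMonomial S ∈ V := by
  refine (V.smul_mem_iff hc).mp ?_
  obtain ⟨t, ht, hinj⟩ : ∃ t : Fin n → ℂ, (∀ i, t i ≠ 0) ∧
      Function.Injective fun S : Finset (Fin n) => ∏ i ∈ S, t i :=
    ⟨fun i => 2 ^ 2 ^ (i : ℕ), fun i => pow_ne_zero _ two_ne_zero, prod_two_pow_two_pow_injective n⟩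
  refine V.mem_of_sum_eigenvectors_mem
    (ExteriorAlgebra.map (Matrix.toLin' (Matrix.diagonal t))).toLinearMap
    (htorus t ht) _ hinj s (fun S => c S • extMonomial S) (fun T _ => ?_) hsum S hS
  rw [map_smul, AlgHom.toLinearMap_apply, map_diagonal_extMonomial, smul_comm]

/-- The transvection `e_i ↦ e_i + e_j` adds to a monomial divisible by `e_i`, up to sign, the
monomial with `e_i` replaced by `e_j`. -/
lemma extMonomial_insert_erase_mem {n : ℕ} (V : Submodule ℂ (ExteriorAlgebra ℂ (Fin n → ℂ)))
    {i j : Fin n}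
    (hV : ∀ x ∈ V, ExteriorAlgebra.map (Matrix.toLin' (Matrix.transvection j i (1 : ℂ))) x ∈ V)
    {S : Finset (Fin n)} (hi : i ∈ S) (hj : j ∉ S) (hS : extMonomial S ∈ V) :
    extMonomial (insert j (S.erase i)) ∈ V := by
  set e : Fin n → (Fin n → ℂ) := fun a => Pi.single a 1
  set f := Matrix.toLin' (Matrix.transvection j i (1 : ℂ))
  have hfe : ∀ a, f (e a) = e a + if a = i then e j else 0 := by
    intro a
    ext b
    by_cases hai : a = i
    · simp [f, e, Matrix.transvection, hai, Pi.single_apply, Matrix.single_apply]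
      grind
    · simp [f, e, Matrix.transvection, hai, Matrix.single_apply]
      grind
  set l := (S.erase i).sort (· ≤ ·)
  have hperm : ∀ a ∉ S.erase i, ((insert a (S.erase i)).sort (· ≤ ·)).Perm (a :: l) := by
    intro a ha
    rw [List.perm_ext_iff_of_nodup (Finset.sort_nodup _ _)
      (List.nodup_cons.mpr ⟨by simpa [l] using ha, Finset.sort_nodup _ _⟩)]
    simp
  have hpi := hperm i (Finset.notMem_erase i S)
  rw [Finset.insert_erase hi] at hpi
  have hpj := hperm j fun h => hj (Finset.mem_of_mem_erase h)
  have hmem : (((i :: l).map fun a => ExteriorAlgebra.ι ℂ (e a)).prod) ∈ V := by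
    rcases prod_map_ι_of_perm (R := ℂ) e hpi with h | h
    · exact h ▸ hS
    · rw [← neg_mem_iff (x := List.prod _)]
      exact h ▸ hS
  have hmap : ExteriorAlgebra.map f ((i :: l).map fun a => ExteriorAlgebra.ι ℂ (e a)).prod =
      ((i :: l).map fun a => ExteriorAlgebra.ι ℂ (e a)).prod +
        ((j :: l).map fun a => ExteriorAlgebra.ι ℂ (e a)).prod := by
    have hl : (l.map fun a => ExteriorAlgebra.ι ℂ (f (e a))) =
        l.map fun a => ExteriorAlgebra.ι ℂ (e a) := by
      refine List.map_congr_left fun a ha => ?_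
      have hai : a ≠ i := Finset.ne_of_mem_erase ((Finset.mem_sort _).mp ha)
      rw [hfe, if_neg hai, add_zero]
    simp only [List.map_cons, List.prod_cons, map_mul, map_list_prod, List.map_map,
      Function.comp_def, ExteriorAlgebra.map_apply_ι, hl]
    rw [hfe, if_pos rfl, map_add, add_mul]
  have hmem' := hV _ hmem
  rw [hmap, V.add_mem_iff_right hmem] at hmem'
  rcases prod_map_ι_of_perm (R := ℂ) e hpj with h | h
  · exact (congrArg (· ∈ V) h).mpr hmem'
  · exact (congrArg (· ∈ V) h).mpr (V.neg_mem hmem')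

theorem stmt_11 (n k : ℕ)
    (V : Submodule ℂ (ExteriorAlgebra ℂ (Fin n → ℂ)))
    (hV : V ≤ ⋀[ℂ]^k (Fin n → ℂ))
    (hborel : ∀ g : Matrix (Fin n) (Fin n) ℂ, IsUnit g →
      (∀ i j : Fin n, j < i → g i j = 0) →
      Submodule.map (ExteriorAlgebra.map (Matrix.toLin' g)).toLinearMap V = V) :
    ∃ 𝒜 : Finset (Finset (Fin n)), (∀ S ∈ 𝒜, S.card = k) ∧
      (∀ S ∈ 𝒜, ∀ i ∈ S, ∀ j : Fin n, j < i → j ∉ S →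
        insert j (S.erase i) ∈ 𝒜) ∧
      V = Submodule.span ℂ (extMonomial '' (𝒜 : Set (Finset (Fin n)))) := by
  classical
  have hstable : ∀ g : Matrix (Fin n) (Fin n) ℂ, IsUnit g → (∀ i j : Fin n, j < i → g i j = 0) →
      ∀ x ∈ V, ExteriorAlgebra.map (Matrix.toLin' g) x ∈ V := fun g hg hg' x hx =>
    (hborel g hg hg').le (Submodule.mem_map_of_mem hx)
  refine ⟨Finset.univ.filter fun S => S.card = k ∧ extMonomial S ∈ V, by simp +contextual, ?_, le_antisymm ?_ ?_⟩
  · intro S hS i hi j hji hj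
    rw [Finset.mem_filter_univ] at hS ⊢
    refine ⟨?_, extMonomial_insert_erase_mem V (hstable _ ?_ ?_) hi hj hS.2⟩
    · rw [Finset.card_insert_of_notMem fun h => hj (Finset.mem_of_mem_erase h),
        Finset.card_erase_add_one hi, hS.1]
    · rw [Matrix.isUnit_iff_isUnit_det, Matrix.det_transvection_of_ne _ _ hji.ne]
      exact isUnit_one
    · intro a b hba
      have : ¬(j = a ∧ i = b) := by rintro ⟨rfl, rfl⟩; exact lt_asymm hba hji
      simp [Matrix.transvection, this, Matrix.one_apply_ne hba.ne']
  · intro x hx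
    have hx' := hV hx
    rw [exteriorPower_eq_span_extMonomial, Finsupp.mem_span_image_iff_linearCombination] at hx'
    obtain ⟨c, hc, rfl⟩ := hx'
    rw [Finsupp.linearCombination_apply, Finsupp.sum] at hx ⊢
    refine Submodule.sum_mem _ fun S hS =>
      Submodule.smul_mem _ _ (Submodule.subset_span ⟨S, ?_, rfl⟩)
    have hmem := extMonomial_mem_of_sum_mem V
      (fun t ht => hstable _ (by simpa [Matrix.isUnit_diagonal, Pi.isUnit_iff] using ht)
        fun a b hba => Matrix.diagonal_apply_ne _ hba.ne')
      c.support c hx hS (Finsupp.mem_support_iff.mp hS)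
    simpa using ⟨hc hS, hmem⟩
  · rw [Submodule.span_le]
    rintro _ ⟨S, hS, rfl⟩
    exact (Finset.mem_filter.mp hS).2.2
end

section
/- Let k be an odd positive integer and n = 2k. Let 𝒜 be the family of all k-element subsets of {1,...,n} that contain the element 1, and let V be the ℂ-span of { m_A + m_{A^c} : A ∈ 𝒜 } in Λ^k ℂ^n, where A^c = {1,...,n} \ A. Then x ∧ y = 0 for all x, y ∈ V. -/
section ExteriorProducts

variable {R M : Type*} [CommRing R] [AddCommGroup M] [Module R M]

theorem ExteriorAlgebra.prod_map_ι_mul_ι (l : List M) (x : M) :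
    (l.map (ι R)).prod * ι R x = (-1) ^ l.length * (ι R x * (l.map (ι R)).prod) := by
  induction l with
  | nil => simp
  | cons a l ih =>
    have h : ι R a * ι R x = -(ι R x * ι R a) := eq_neg_of_add_eq_zero_left (ι_add_mul_swap a x)
    have hc : Commute (ι R a) ((-1) ^ l.length) := (Commute.neg_one_right _).pow_right _
    rw [List.map_cons, List.prod_cons, mul_assoc, ih, ← mul_assoc, hc.eq, mul_assoc,
      ← mul_assoc (ι R a), h, List.length_cons, pow_succ]
    noncomm_ring

theorem ExteriorAlgebra.prod_map_ι_mul_prod_map_ι (l m : List M) :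
    (l.map (ι R)).prod * (m.map (ι R)).prod =
      (-1) ^ (l.length * m.length) * ((m.map (ι R)).prod * (l.map (ι R)).prod) := by
  induction m with
  | nil => simp
  | cons a m ih =>
    have hc : Commute (ι R a) ((-1) ^ (l.length * m.length)) :=
      (Commute.neg_one_right _).pow_right _
    rw [List.map_cons, List.prod_cons, ← mul_assoc, prod_map_ι_mul_ι, mul_assoc, mul_assoc, ih,
      ← mul_assoc (ι R a), hc.eq, List.length_cons, mul_add, mul_one, add_comm, pow_add]
    simp only [mul_assoc]

theorem ExteriorAlgebra.prod_map_ι_mul_prod_map_ι_eq_zero {l m : List M} {x : M}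
    (hl : x ∈ l) (hm : x ∈ m) : (l.map (ι R)).prod * (m.map (ι R)).prod = 0 := by
  obtain ⟨a, b, rfl⟩ := List.append_of_mem hl
  obtain ⟨c, d, rfl⟩ := List.append_of_mem hm
  have h : ι R x * (((b ++ c).map (ι R)).prod * ι R x) = 0 := by
    have hc : Commute (ι R x) ((-1) ^ (b ++ c).length) := (Commute.neg_one_right _).pow_right _
    rw [prod_map_ι_mul_ι, ← mul_assoc, hc.eq, mul_assoc, ← mul_assoc (ι R x), ι_sq_zero,
      zero_mul, mul_zero]
  calc _ = (a.map (ι R)).prod * (ι R x * (((b ++ c).map (ι R)).prod * ι R x)) *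
        (d.map (ι R)).prod := by
        simp only [List.map_append, List.map_cons, List.prod_append, List.prod_cons, mul_assoc]
    _ = 0 := by rw [h, mul_zero, zero_mul]

end ExteriorProducts

theorem extMonomial_eq_prod_map_ι {n : ℕ} (S : Finset (Fin n)) :
    extMonomial S = (((S.sort (· ≤ ·)).map fun i => (Pi.single i 1 : Fin n → ℂ)).map
      (ExteriorAlgebra.ι ℂ)).prod := by
  rw [extMonomial, List.map_map]
  rfl

theorem extMonomial_mul_of_mem {n : ℕ} {S T : Finset (Fin n)} {i : Fin n}
    (hS : i ∈ S) (hT : i ∈ T) : extMonomial S * extMonomial T = 0 := by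
  rw [extMonomial_eq_prod_map_ι, extMonomial_eq_prod_map_ι]
  exact ExteriorAlgebra.prod_map_ι_mul_prod_map_ι_eq_zero
    (List.mem_map_of_mem ((Finset.mem_sort _).2 hS))
    (List.mem_map_of_mem ((Finset.mem_sort _).2 hT))

theorem extMonomial_mul_comm_of_odd {n : ℕ} {S T : Finset (Fin n)}
    (hS : Odd S.card) (hT : Odd T.card) :
    extMonomial S * extMonomial T = -(extMonomial T * extMonomial S) := by
  rw [extMonomial_eq_prod_map_ι, extMonomial_eq_prod_map_ι,
    ExteriorAlgebra.prod_map_ι_mul_prod_map_ι]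
  simp [(hS.mul hT).neg_one_pow]

theorem extMonomial_add_compl_mul {k : ℕ} (hodd : Odd k) {A B : Finset (Fin (2 * k))}
    (hA : A.card = k) (hB : B.card = k) {i : Fin (2 * k)} (hiA : i ∈ A) (hiB : i ∈ B) :
    (extMonomial A + extMonomial Aᶜ) * (extMonomial B + extMonomial Bᶜ) = 0 := by
  have hcompl : extMonomial Aᶜ * extMonomial Bᶜ = 0 := by
    have hpos : 0 < (A ∩ B).card := Finset.card_pos.2 ⟨i, Finset.mem_inter.2 ⟨hiA, hiB⟩⟩
    have hcard := Finset.card_union_add_card_inter A B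
    obtain ⟨j, hj⟩ : ∃ j, j ∉ A ∪ B := by
      by_contra! h
      rw [Finset.eq_univ_iff_forall.2 h, Finset.card_univ, Fintype.card_fin] at hcard
      omega
    rw [Finset.mem_union, not_or] at hj
    exact extMonomial_mul_of_mem (Finset.mem_compl.2 hj.1) (Finset.mem_compl.2 hj.2)
  have hcross : extMonomial A * extMonomial Bᶜ + extMonomial Aᶜ * extMonomial B = 0 := by
    by_cases hAB : A = B
    · subst hAB
      have hAc : Aᶜ.card = k := by rw [Finset.card_compl, Fintype.card_fin]; omega
      rw [extMonomial_mul_comm_of_odd (hA.symm ▸ hodd) (hAc.symm ▸ hodd), neg_add_cancel]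
    · obtain ⟨a, haA, haB⟩ : ∃ a ∈ A, a ∉ B := Finset.not_subset.1 fun h =>
        hAB (Finset.eq_of_subset_of_card_le h (by omega))
      obtain ⟨b, hbB, hbA⟩ : ∃ b ∈ B, b ∉ A := Finset.not_subset.1 fun h =>
        hAB (Finset.eq_of_subset_of_card_le h (by omega)).symm
      rw [extMonomial_mul_of_mem haA (Finset.mem_compl.2 haB),
        extMonomial_mul_of_mem (Finset.mem_compl.2 hbA) hbB, add_zero]
  rw [add_mul, mul_add, mul_add, extMonomial_mul_of_mem hiA hiB, hcompl, zero_add, add_zero,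
    hcross]

theorem stmt_14 (k : ℕ) (hk : 0 < k) (hodd : Odd k) :
    ∀ x ∈ Submodule.span ℂ
      {z : ExteriorAlgebra ℂ (Fin (2 * k) → ℂ) |
        ∃ A : Finset (Fin (2 * k)), A.card = k ∧ (⟨0, by omega⟩ : Fin (2 * k)) ∈ A ∧
          z = extMonomial A + extMonomial Aᶜ},
    ∀ y ∈ Submodule.span ℂ
      {z : ExteriorAlgebra ℂ (Fin (2 * k) → ℂ) |
        ∃ A : Finset (Fin (2 * k)), A.card = k ∧ (⟨0, by omega⟩ : Fin (2 * k)) ∈ A ∧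
          z = extMonomial A + extMonomial Aᶜ},
      x * y = 0 := by
  intro x hx y hy
  induction hx, hy using Submodule.span_induction₂ with
  | mem_mem x y hx hy =>
    obtain ⟨A, hA, hiA, rfl⟩ := hx
    obtain ⟨B, hB, hiB, rfl⟩ := hy
    exact extMonomial_add_compl_mul hodd hA hB hiA hiB
  | zero_left => exact zero_mul _
  | zero_right => exact mul_zero _
  | add_left x y z _ _ _ hx hy => rw [add_mul, hx, hy, add_zero]
  | add_right x y z _ _ _ hx hy => rw [mul_add, hx, hy, add_zero]
  | smul_left r x y _ _ h => rw [smul_mul_assoc, h, smul_zero]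
  | smul_right r x y _ _ h => rw [mul_smul_comm, h, smul_zero]
end
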